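/- (Forrester–Frankel asymptotics, Laguerre case, integer q.) Let m ≥ 1, q = (q_1,…,q_m) with each q_i ∈ ℕ, q_i ≥ 1, |q| := q_1+⋯+q_m, α > −1 real fixed, and let μ_1,…,μ_m ∈ (0,1) be pairwise distinct. With the Laguerre weight ω_N(x) = x^α e^{−4Nx} on Ω = (0,∞), define A_N := N^{Σ_{i=1}^m (q_i² − q_i)} · ∏_{i=1}^m μ_i^{−α q_i} e^{4N q_i μ_i} · ∏_{i=1}^m [ (∏_{l=1}^{q_i−1} l!)² / ∏_{l=1}^{2q_i−1} l! ] · (2π)^{q_i² − q_i} · ∏_{1≤j<k≤m} |μ_k − μ_j|^{−2 q_j q_k} · ∏_{i=1}^m ( (2/π)·√(1/μ_i − 1) )^{q_i²}. Then there exist C > 0 and N₀ ∈ ℕ such that for all N ≥ N₀: | H_{N,N,m,q}(μ) / ( H_{N+|q|,N} · A_N ) − 1 | ≤ C/N. -/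

import Mathlib

open MeasureTheory Finset

/-- The Vandermonde product for a real tuple. -/
noncomputable def vandR {n : ℕ} (z : Fin n → ℝ) : ℝ :=
  ∏ j : Fin n, ∏ k ∈ Finset.Ioi j, (z k - z j)

/-- `FirstOrderLimit f L` says that `f N = L + O(1/N)`. -/
def FirstOrderLimit (f : ℕ → ℝ) (L : ℝ) : Prop :=
  (fun N => f N - L) =O[Filter.atTop] (fun N : ℕ => (N : ℝ)⁻¹)

namespace FirstOrderLimit

open Filter Asymptotics Topology

variable {f g : ℕ → ℝ} {L M : ℝ}

lemma congr' (h : FirstOrderLimit f L) (e : f =ᶠ[atTop] g) : FirstOrderLimit g L :=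
  IsBigO.congr' h (e.mono fun N hN => by simp [hN]) EventuallyEq.rfl

lemma congr_limit (h : FirstOrderLimit f L) (e : L = M) : FirstOrderLimit f M := e ▸ h

lemma const (c : ℝ) : FirstOrderLimit (fun _ => c) c := by
  simp [FirstOrderLimit, Asymptotics.isBigO_zero]

lemma add (hf : FirstOrderLimit f L) (hg : FirstOrderLimit g M) :
    FirstOrderLimit (fun N => f N + g N) (L + M) :=
  (IsBigO.add hf hg).congr_left fun N => by ring

lemma const_mul (c : ℝ) (hf : FirstOrderLimit f L) :
    FirstOrderLimit (fun N => c * f N) (c * L) :=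
  (IsBigO.const_mul_left hf c).congr_left fun N => by ring

lemma sub (hf : FirstOrderLimit f L) (hg : FirstOrderLimit g M) :
    FirstOrderLimit (fun N => f N - g N) (L - M) :=
  (IsBigO.sub hf hg).congr_left fun N => by ring

lemma tendsto (hf : FirstOrderLimit f L) : Tendsto f atTop (𝓝 L) := by
  have := IsBigO.trans_tendsto hf tendsto_inv_atTop_nhds_zero_nat
  simpa using this.add_const L

lemma isBigO_one (hf : FirstOrderLimit f L) : f =O[atTop] (fun _ => (1 : ℝ)) :=
  hf.tendsto.isBigO_one ℝ

lemma mul (hf : FirstOrderLimit f L) (hg : FirstOrderLimit g M) :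
    FirstOrderLimit (fun N => f N * g N) (L * M) := by
  have h1 : (fun N => (f N - L) * g N) =O[atTop] (fun N : ℕ => (N : ℝ)⁻¹) := by
    simpa using IsBigO.mul hf hg.isBigO_one
  exact (h1.add (IsBigO.const_mul_left hg L)).congr_left fun N => by ring

lemma pow (hf : FirstOrderLimit f L) (k : ℕ) :
    FirstOrderLimit (fun N => f N ^ k) (L ^ k) := by
  induction k with
  | zero => simpa using const 1
  | succ k ih => simpa [pow_succ] using ih.mul hf

lemma sum {ι : Type*} (s : Finset ι) {F : ι → ℕ → ℝ} {L : ι → ℝ}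
    (h : ∀ i ∈ s, FirstOrderLimit (F i) (L i)) :
    FirstOrderLimit (fun N => ∑ i ∈ s, F i N) (∑ i ∈ s, L i) := by
  classical
  induction s using Finset.induction_on with
  | empty => simpa using const 0
  | insert a s ha ih =>
    simp only [Finset.sum_insert ha]
    exact (h a (by simp)).add (ih fun i hi => h i (by simp [hi]))

lemma prod {ι : Type*} (s : Finset ι) {F : ι → ℕ → ℝ} {L : ι → ℝ}
    (h : ∀ i ∈ s, FirstOrderLimit (F i) (L i)) :
    FirstOrderLimit (fun N => ∏ i ∈ s, F i N) (∏ i ∈ s, L i) := by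
  classical
  induction s using Finset.induction_on with
  | empty => simpa using const 1
  | insert a s ha ih =>
    simp only [Finset.prod_insert ha]
    exact (h a (by simp)).mul (ih fun i hi => h i (by simp [hi]))

lemma inv (hf : FirstOrderLimit f L) (hL : L ≠ 0) :
    FirstOrderLimit (fun N => (f N)⁻¹) L⁻¹ := by
  have h1 : (fun N => (f N)⁻¹) =O[atTop] (fun _ => (1 : ℝ)) :=
    (hf.tendsto.inv₀ hL).isBigO_one ℝ
  have h2 : (fun N => (f N - L) * (f N)⁻¹) =O[atTop] (fun N : ℕ => (N : ℝ)⁻¹) := by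
    simpa using IsBigO.mul hf h1
  refine (h2.const_mul_left (-L⁻¹)).congr' ?_ EventuallyEq.rfl
  filter_upwards [hf.tendsto.eventually_ne hL] with N hN
  field_simp
  ring

lemma div (hf : FirstOrderLimit f L) (hg : FirstOrderLimit g M) (hM : M ≠ 0) :
    FirstOrderLimit (fun N => f N / g N) (L / M) := by
  simpa [div_eq_mul_inv] using hf.mul (hg.inv hM)

lemma det {ι : Type*} [Fintype ι] [DecidableEq ι] {A : ℕ → Matrix ι ι ℝ} {B : Matrix ι ι ℝ}
    (h : ∀ i j, FirstOrderLimit (fun N => A N i j) (B i j)) :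
    FirstOrderLimit (fun N => (A N).det) B.det := by
  simp only [Matrix.det_apply']
  exact sum _ fun σ _ => (prod _ fun i _ => h _ _).const_mul _

lemma inv_nat : FirstOrderLimit (fun N => (N : ℝ)⁻¹) 0 := by
  simpa [FirstOrderLimit] using isBigO_refl _ _

/-- A bounded sequence divided by `N` is `O(1/N)`. -/
lemma of_isBigO_one_mul_inv (h : f =O[atTop] (fun _ => (1 : ℝ))) :
    FirstOrderLimit (fun N => f N * (N : ℝ)⁻¹) 0 := by
  simpa [FirstOrderLimit] using h.mul (isBigO_refl (fun N : ℕ => (N : ℝ)⁻¹) atTop)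

lemma bdd_mul (hf : f =O[atTop] (fun _ => (1 : ℝ))) (hg : FirstOrderLimit g 0) :
    FirstOrderLimit (fun N => f N * g N) 0 := by
  simpa [FirstOrderLimit] using hf.mul (by simpa [FirstOrderLimit] using hg)

lemma of_abs_le {C : ℝ} (h : ∀ᶠ N : ℕ in atTop, |f N - L| ≤ C / N) : FirstOrderLimit f L :=
  IsBigO.of_bound C (h.mono fun N hN => by
    simpa [div_eq_mul_inv] using hN)

lemma comp_add (hf : FirstOrderLimit f L) (k : ℕ) :
    FirstOrderLimit (fun N => f (N + k)) L := by
  have h1 := IsBigO.comp_tendsto hf (tendsto_add_atTop_nat k)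
  refine h1.trans ?_
  refine IsBigO.of_bound 1 ?_
  filter_upwards [eventually_gt_atTop 0] with N hN
  have hN' : (0 : ℝ) < N := by exact_mod_cast hN
  simp only [Function.comp, Real.norm_eq_abs, one_mul, Nat.cast_add]
  rw [abs_of_pos (by positivity), abs_of_pos (by positivity)]
  gcongr
  simp

lemma exists_bound (hf : FirstOrderLimit f L) :
    ∃ C > (0 : ℝ), ∃ N₀ : ℕ, ∀ N ≥ N₀, |f N - L| ≤ C / N := by
  obtain ⟨C, hC, h⟩ := IsBigO.exists_pos hf
  obtain ⟨N₀, hN⟩ := eventually_atTop.1 h.bound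
  refine ⟨C, hC, N₀, fun N hN' => ?_⟩
  have := hN N hN'
  simpa [div_eq_mul_inv] using this

end FirstOrderLimit
lemma vandR_eq_det {n : ℕ} (z : Fin n → ℝ) : vandR z = (Matrix.vandermonde z).det := by
  rw [Matrix.det_vandermonde, vandR]

/-- Andréief's identity for Vandermonde determinants. -/
lemma integral_vandR_sq_mul_prod {M : ℕ} (s : Set ℝ) (w : ℝ → ℝ)
    (hw : ∀ k : ℕ, IntegrableOn (fun x => x ^ k * w x) s) :
    ∫ z in Set.univ.pi (fun _ : Fin M => s), vandR z ^ 2 * ∏ l, w (z l) =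
      M.factorial * (Matrix.of fun i j : Fin M => ∫ x in s, x ^ (i + j : ℕ) * w x).det := by
  set G : Matrix (Fin M) (Fin M) ℝ :=
    Matrix.of fun i j : Fin M => ∫ x in s, x ^ (i + j : ℕ) * w x with hG
  have hvol : (volume : Measure (Fin M → ℝ)).restrict (Set.univ.pi fun _ => s) =
      Measure.pi fun _ => volume.restrict s := by
    rw [volume_pi, Measure.restrict_pi_pi]
  have hexp : ∀ z : Fin M → ℝ, vandR z ^ 2 * ∏ l, w (z l) =
      ∑ σ : Equiv.Perm (Fin M), ∑ τ : Equiv.Perm (Fin M),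
        ((Equiv.Perm.sign σ : ℤ) : ℝ) * ((Equiv.Perm.sign τ : ℤ) : ℝ) *
          ∏ l, (z l ^ (σ l + τ l : ℕ) * w (z l)) := by
    intro z
    rw [vandR_eq_det, ← Matrix.det_transpose, Matrix.det_apply', sq, Finset.sum_mul_sum,
      Finset.sum_mul]
    refine Finset.sum_congr rfl fun σ _ => ?_
    rw [Finset.sum_mul]
    refine Finset.sum_congr rfl fun τ _ => ?_
    simp only [Matrix.transpose_apply, Matrix.vandermonde_apply, pow_add, Finset.prod_mul_distrib]
    ring
  have h_int : ∀ σ τ : Equiv.Perm (Fin M), Integrable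
      (fun z : Fin M → ℝ => ∏ l, (z l ^ (σ l + τ l : ℕ) * w (z l)))
      (Measure.pi fun _ => volume.restrict s) := fun σ τ =>
    Integrable.fintype_prod (f := fun l x => x ^ (σ l + τ l : ℕ) * w x) fun l => hw _
  rw [hvol]
  simp_rw [hexp]
  rw [integral_finsetSum _ fun σ _ => integrable_finsetSum _ fun τ _ => (h_int σ τ).const_mul _]
  have key : ∀ σ : Equiv.Perm (Fin M),
      ∫ z : Fin M → ℝ, ∑ τ : Equiv.Perm (Fin M),
        ((Equiv.Perm.sign σ : ℤ) : ℝ) * ((Equiv.Perm.sign τ : ℤ) : ℝ) *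
          ∏ l, (z l ^ (σ l + τ l : ℕ) * w (z l)) ∂(Measure.pi fun _ => volume.restrict s) =
        G.det := by
    intro σ
    rw [integral_finsetSum _ fun τ _ => (h_int σ τ).const_mul _]
    have h1 : ∀ τ : Equiv.Perm (Fin M), ∫ z : Fin M → ℝ,
        ((Equiv.Perm.sign σ : ℤ) : ℝ) * ((Equiv.Perm.sign τ : ℤ) : ℝ) *
          ∏ l, (z l ^ (σ l + τ l : ℕ) * w (z l)) ∂(Measure.pi fun _ => volume.restrict s) =
        ((Equiv.Perm.sign σ : ℤ) : ℝ) * (((Equiv.Perm.sign τ : ℤ) : ℝ) *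
          ∏ l, (G.submatrix σ id).transpose (τ l) l) := by
      intro τ
      rw [integral_const_mul,
        integral_fintype_prod_eq_prod (f := fun l x => x ^ (σ l + τ l : ℕ) * w x), mul_assoc]
      rfl
    rw [Finset.sum_congr rfl fun τ _ => h1 τ, ← Finset.mul_sum, ← Matrix.det_apply',
      Matrix.det_transpose, Matrix.det_permute, ← mul_assoc]
    have : ((Equiv.Perm.sign σ : ℤ) : ℝ) * ((Equiv.Perm.sign σ : ℤ) : ℝ) = 1 := by
      exact_mod_cast Int.units_coe_mul_self (Equiv.Perm.sign σ)
    rw [this, one_mul]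
  rw [Finset.sum_congr rfl fun σ _ => key σ, Finset.sum_const, Finset.card_univ,
    Fintype.card_perm, Fintype.card_fin, nsmul_eq_mul]
/-- The determinant of the matrix `1 / (i + j + c)`, reduced by one Schur complement. -/
lemma det_inv_add_add_succ (n : ℕ) (c : ℝ) (hc : 0 < c) :
    (Matrix.of fun i j : Fin (n + 1) => 1 / ((i : ℝ) + j + c)).det =
      1 / c * (∏ i : Fin n, ((i : ℝ) + 1) / ((i : ℝ) + 1 + c)) ^ 2 *
        (Matrix.of fun i j : Fin n => 1 / ((i : ℝ) + j + (c + 2))).det := by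
  set A := (Matrix.of fun i j : Fin (n + 1) => 1 / ((i : ℝ) + j + c)) with hA
  set B : Matrix (Fin (n + 1)) (Fin (n + 1)) ℝ :=
    Matrix.of fun i j => if i = 0 then A i j else A i j - A i 0 / A 0 0 * A 0 j with hB
  have hAB : A.det = B.det := by
    refine Matrix.det_eq_of_forall_row_eq_smul_add_const
      (fun i => if i = 0 then 0 else A i 0 / A 0 0) 0 (by simp) fun i j => ?_
    by_cases h : i = 0 <;> simp [hB, h]
  have h00 : A 0 0 = 1 / c := by simp [hA]
  set v : Fin n → ℝ := fun i => ((i : ℝ) + 1) / ((i : ℝ) + 1 + c) with hv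
  set H : Matrix (Fin n) (Fin n) ℝ := Matrix.of fun i j => 1 / ((i : ℝ) + j + (c + 2)) with hH
  rw [hAB, Matrix.det_succ_column_zero, Finset.sum_eq_single 0]
  · have hsub : (B.submatrix (Fin.succAbove 0) Fin.succ) =
        Matrix.of fun i j : Fin n => v i * (Matrix.of fun i j => v j * H i j) i j := by
      ext i j
      have h1 : (0 : ℝ) < (i : ℝ) + 1 + c := by positivity
      have h2 : (0 : ℝ) < (j : ℝ) + 1 + c := by positivity
      have h3 : (0 : ℝ) < (i : ℝ) + j + (c + 2) := by positivity
      have h4 : (0 : ℝ) < (i : ℝ) + 1 + (j + 1) + c := by positivity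
      simp only [Matrix.submatrix_apply, hB, hA, hH, hv, Matrix.of_apply, Fin.zero_succAbove,
        Fin.succ_ne_zero, if_false, Fin.val_succ, Fin.val_zero, Nat.cast_add, Nat.cast_one,
        Nat.cast_zero, zero_add, add_zero]
      field_simp
      ring
    have hB00 : B 0 0 = 1 / c := by simp [hB, h00]
    rw [hsub, hB00, Matrix.det_mul_column, Matrix.det_mul_row]
    simp
    ring
  · intro i _ hi
    have : B i 0 = 0 := by
      have : A 0 0 ≠ 0 := by rw [h00]; positivity
      simp [hB, hi, this]
    simp [this]
  · simp

lemma det_inv_add_add (n : ℕ) (c : ℝ) (hc : 0 < c) :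
    (Matrix.of fun i j : Fin n => 1 / ((i : ℝ) + j + c)).det =
      (∏ i ∈ range n, (i.factorial : ℝ)) ^ 2 /
        ∏ i ∈ range n, ∏ j ∈ range n, ((i : ℝ) + j + c) := by
  induction n generalizing c with
  | zero => simp
  | succ n ih =>
    rw [det_inv_add_add_succ n c hc, ih (c + 2) (by linarith)]
    have e1 : ∏ i : Fin n, ((i : ℝ) + 1) / ((i : ℝ) + 1 + c) =
        (n.factorial : ℝ) / ∏ i ∈ range n, ((i : ℝ) + 1 + c) := by
      rw [Finset.prod_div_distrib, ← Finset.prod_range_add_one_eq_factorial,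
        Finset.prod_range (fun i => ((i : ℝ) + 1 + c))]
      push_cast
      rw [Finset.prod_range (fun i => ((i : ℝ) + 1))]
    have e2 : ∏ i ∈ range (n + 1), ∏ j ∈ range (n + 1), ((i : ℝ) + j + c) =
        c * (∏ i ∈ range n, ((i : ℝ) + 1 + c)) ^ 2 *
          ∏ i ∈ range n, ∏ j ∈ range n, ((i : ℝ) + j + (c + 2)) := by
      rw [Finset.prod_range_succ']
      simp_rw [Finset.prod_range_succ' _ n]
      rw [Finset.prod_mul_distrib]
      have : ∀ i j : ℕ, (((i + 1 : ℕ) : ℝ) + ((j + 1 : ℕ) : ℝ) + c) = (i : ℝ) + j + (c + 2) := by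
        intros; push_cast; ring
      simp_rw [this]
      simp only [Nat.cast_add, Nat.cast_one, Nat.cast_zero, zero_add, add_zero]
      ring
    rw [e1, e2, Finset.prod_range_succ]
    have : (0 : ℝ) < ∏ i ∈ range n, ((i : ℝ) + 1 + c) :=
      Finset.prod_pos fun i _ => by positivity
    have : (0 : ℝ) < ∏ i ∈ range n, ∏ j ∈ range n, ((i : ℝ) + j + (c + 2)) :=
      Finset.prod_pos fun i _ => Finset.prod_pos fun j _ => by positivity
    field_simp

lemma prod_Icc_factorial (n : ℕ) :
    (∏ l ∈ Icc 1 (n - 1), (l.factorial : ℝ)) = ∏ l ∈ range n, (l.factorial : ℝ) := by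
  cases n with
  | zero => simp
  | succ n =>
    rw [Finset.prod_range_succ', Nat.factorial_zero, Nat.cast_one, mul_one, Nat.add_sub_cancel]
    rw [Finset.prod_bij' (fun i _ => i - 1) (fun i _ => i + 1)] <;> simp
    · intros; omega
    · omega
    · intro a h1 _; rw [Nat.sub_add_cancel h1]

/-- The Hilbert matrix determinant. -/
lemma det_hilbert (n : ℕ) :
    (Matrix.of fun i j : Fin n => 1 / ((i : ℝ) + j + 1)).det =
      (∏ i ∈ range n, (i.factorial : ℝ)) ^ 4 / ∏ i ∈ range (2 * n), (i.factorial : ℝ) := by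
  rw [det_inv_add_add n 1 one_pos]
  have h1 : ∀ i : ℕ, (i.factorial : ℝ) * ∏ j ∈ range n, ((i : ℝ) + j + 1) =
      ((n + i).factorial : ℝ) := by
    intro i
    rw [add_comm n i, ← Nat.factorial_mul_ascFactorial, Nat.ascFactorial_eq_prod_range]
    push_cast
    congr 1
    refine Finset.prod_congr rfl fun j _ => by ring
  have h2 : ∏ i ∈ range (2 * n), (i.factorial : ℝ) = (∏ i ∈ range n, (i.factorial : ℝ)) ^ 2 *
      ∏ i ∈ range n, ∏ j ∈ range n, ((i : ℝ) + j + 1) := by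
    rw [two_mul, Finset.prod_range_add, ← Finset.prod_congr rfl fun i _ => h1 i,
      Finset.prod_mul_distrib]
    ring
  have : (0 : ℝ) < ∏ i ∈ range n, ∏ j ∈ range n, ((i : ℝ) + j + 1) :=
      Finset.prod_pos fun i _ => Finset.prod_pos fun j _ => by positivity
  have : (0 : ℝ) < ∏ i ∈ range n, (i.factorial : ℝ) :=
      Finset.prod_pos fun i _ => by positivity
  rw [h2]
  field_simp

/-- The Gram matrix of the monomials for Lebesgue measure on `[-1, 1]`, up to the factor `2`. -/
lemma det_legendre_gram (n : ℕ) :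
    (Matrix.of fun i j : Fin n => if Even (i + j : ℕ) then 1 / ((i : ℝ) + j + 1) else 0).det =
      2 ^ (n ^ 2 - n) *
        ((∏ i ∈ range n, (i.factorial : ℝ)) ^ 4 / ∏ i ∈ range (2 * n), (i.factorial : ℝ)) := by
  classical
  open Polynomial in
  set A : Matrix (Fin n) (Fin n) ℝ :=
    Matrix.of fun i c => ((C 2 * X + C (-1) : ℝ[X]) ^ (i : ℕ)).coeff c with hA
  have hdeg : ∀ i : ℕ, ((Polynomial.C 2 * Polynomial.X + Polynomial.C (-1) : Polynomial ℝ) ^ i).natDegree = i := by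
    intro i
    rw [Polynomial.natDegree_pow, Polynomial.natDegree_linear two_ne_zero, mul_one]
  have hdetA : A.det = 2 ^ (n * (n - 1) / 2) := by
    rw [Matrix.det_of_isLowerTriangular]
    · have : ∀ i : Fin n, A i i = 2 ^ (i : ℕ) := by
        intro i
        have h1 := Polynomial.leadingCoeff_pow
          (Polynomial.C 2 * Polynomial.X + Polynomial.C (-1) : Polynomial ℝ) (i : ℕ)
        rw [Polynomial.leadingCoeff, hdeg, Polynomial.leadingCoeff_linear two_ne_zero] at h1
        simpa [hA] using h1
      simp_rw [this]
      rw [Finset.prod_pow_eq_pow_sum, Fin.sum_univ_eq_sum_range (fun i => i), Finset.sum_range_id]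
    · intro i j hij
      simp only [hA, Matrix.of_apply]
      refine Polynomial.coeff_eq_zero_of_natDegree_lt ?_
      rw [hdeg]
      simpa using hij
  have hM : (Matrix.of fun i j : Fin n =>
        if Even (i + j : ℕ) then 1 / ((i : ℝ) + j + 1) else 0) =
      A * (Matrix.of fun i j : Fin n => 1 / ((i : ℝ) + j + 1)) * A.transpose := by
    ext i j
    have e1 : ∫ y in (0 : ℝ)..1, (2 * y + -1) ^ (i + j : ℕ) =
        if Even (i + j : ℕ) then 1 / ((i : ℝ) + j + 1) else 0 := by
      rw [intervalIntegral.integral_comp_mul_add (fun x => x ^ (i + j : ℕ)) two_ne_zero,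
        integral_pow]
      norm_num
      split_ifs with h
      · rw [Odd.neg_one_pow (by exact h.add_one)]; ring
      · rw [Even.neg_one_pow (by rw [Nat.even_add_one]; exact h)]; simp
    have e2 : ∀ (i : Fin n) (y : ℝ), (2 * y + -1) ^ (i : ℕ) = ∑ c : Fin n, A i c * y ^ (c : ℕ) := by
      intro i y
      have := Polynomial.eval_eq_sum_range'
        (p := (Polynomial.C 2 * Polynomial.X + Polynomial.C (-1) : Polynomial ℝ) ^ (i : ℕ))
        (n := n) (by rw [hdeg]; exact i.2) y
      rw [Finset.sum_range] at this
      simpa [hA] using this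
    rw [Matrix.of_apply, ← e1]
    simp_rw [pow_add, e2, Finset.sum_mul_sum]
    rw [intervalIntegral.integral_finsetSum fun c _ => by
      apply Continuous.intervalIntegrable; fun_prop]
    simp only [Matrix.mul_apply, Matrix.transpose_apply, Finset.sum_mul, Matrix.of_apply]
    rw [Finset.sum_comm]
    refine Finset.sum_congr rfl fun c _ => ?_
    rw [intervalIntegral.integral_finsetSum fun c _ => by
      apply Continuous.intervalIntegrable; fun_prop]
    refine Finset.sum_congr rfl fun d _ => ?_
    have : ∀ y : ℝ, A i c * y ^ (c : ℕ) * (A j d * y ^ (d : ℕ)) =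
      A i c * A j d * y ^ (c + d : ℕ) := by intro y; ring
    simp_rw [this]
    rw [intervalIntegral.integral_const_mul, integral_pow]
    simp
    ring
  rw [hM, Matrix.det_mul, Matrix.det_mul, Matrix.det_transpose, hdetA, det_hilbert]
  have h2 : n ^ 2 - n = n * (n - 1) / 2 + n * (n - 1) / 2 := by
    have h3 : 2 ∣ n * (n - 1) := (Nat.even_mul_pred_self n).two_dvd
    have : n ^ 2 - n = n * (n - 1) := by rw [Nat.mul_sub, sq, mul_one]
    omega
  rw [h2, pow_add]
  ring

/-- The Taylor coefficients at the origin of `sin (κ (s - t)) / (π (s - t))`. -/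
noncomputable def sineKernelCoeff (κ : ℝ) (a b : ℕ) : ℝ :=
  1 / Real.pi * (κ ^ (a + b + 1) / ((a + b + 1) * a.factorial * b.factorial)) *
    ((Complex.I ^ a).re * (Complex.I ^ b).re + (Complex.I ^ a).im * (Complex.I ^ b).im)

lemma det_sineKernelCoeff (κ : ℝ) (n : ℕ) :
    (Matrix.of fun a b : Fin n => sineKernelCoeff κ a b).det =
      (1 / Real.pi) ^ n * κ ^ (n ^ 2) * 2 ^ (n ^ 2 - n) *
        ((∏ i ∈ range n, (i.factorial : ℝ)) ^ 2 / ∏ i ∈ range (2 * n), (i.factorial : ℝ)) := by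
  set ε : ℕ → ℝ := fun a => (Complex.I ^ a).re + (Complex.I ^ a).im with hε
  set w : Fin n → ℝ := fun a => ε a * κ ^ (a : ℕ) / (a : ℕ).factorial with hw
  set M : Matrix (Fin n) (Fin n) ℝ :=
    Matrix.of fun i j : Fin n => if Even (i + j : ℕ) then 1 / ((i : ℝ) + j + 1) else 0 with hM
  have hI : ∀ a : ℕ, ∃ s : ℝ, s ^ 2 = 1 ∧
      (Complex.I ^ a).re = (if Even a then s else 0) ∧ (Complex.I ^ a).im = (if Even a then 0 else s) := by
    intro a
    rcases Nat.even_or_odd' a with ⟨k, rfl | rfl⟩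
    · refine ⟨(-1) ^ k, by rw [← pow_mul, mul_comm, pow_mul]; simp, ?_⟩
      rw [pow_mul, Complex.I_sq]
      have : ((-1 : ℂ)) ^ k = (((-1 : ℝ) ^ k : ℝ) : ℂ) := by push_cast; rfl
      rw [this, Complex.ofReal_re, Complex.ofReal_im]
      simp
    · refine ⟨(-1) ^ k, by rw [← pow_mul, mul_comm, pow_mul]; simp, ?_⟩
      rw [pow_succ, pow_mul, Complex.I_sq]
      have : ((-1 : ℂ)) ^ k = (((-1 : ℝ) ^ k : ℝ) : ℂ) := by push_cast; rfl
      rw [this, Complex.re_ofReal_mul, Complex.im_ofReal_mul]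
      simp
  have hε2 : ∀ a, ε a ^ 2 = 1 := by
    intro a
    obtain ⟨s, hs, h1, h2⟩ := hI a
    simp only [hε, h1, h2]
    split_ifs <;> simpa using hs
  have hT : (Matrix.of fun a b : Fin n => sineKernelCoeff κ a b) =
      (κ / Real.pi) • Matrix.of fun i j => w i * (Matrix.of fun i j => w j * M i j) i j := by
    ext a b
    simp only [Matrix.of_apply, Matrix.smul_apply, smul_eq_mul, sineKernelCoeff, hw, hM, hε]
    obtain ⟨s, hs, h1, h2⟩ := hI a
    obtain ⟨t, ht, h3, h4⟩ := hI b
    rw [h1, h2, h3, h4]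
    have ha : ((a : ℕ).factorial : ℝ) ≠ 0 := by positivity
    have hb : ((b : ℕ).factorial : ℝ) ≠ 0 := by positivity
    have hab : ((a : ℝ) + b + 1) ≠ 0 := by positivity
    by_cases h5 : Even (a : ℕ) <;> by_cases h6 : Even (b : ℕ) <;>
      simp [h5, h6, Nat.even_add] <;> field_simp <;> ring
  rw [hT, Matrix.det_smul, Matrix.det_mul_column, Matrix.det_mul_row, det_legendre_gram]
  have hprod : (∏ i, w i) ^ 2 * (∏ i ∈ range n, (i.factorial : ℝ)) ^ 2 = κ ^ (n ^ 2 - n) := by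
    rw [Finset.prod_range, ← mul_pow, ← Finset.prod_mul_distrib, ← Finset.prod_pow]
    have : ∀ i : Fin n, (w i * ((i : ℕ).factorial : ℝ)) ^ 2 = κ ^ (2 * (i : ℕ)) := by
      intro i
      have ha : ((i : ℕ).factorial : ℝ) ≠ 0 := by positivity
      simp only [hw]
      rw [div_mul_cancel₀ _ ha, mul_pow, hε2, one_mul, ← pow_mul, mul_comm]
    rw [Finset.prod_congr rfl fun i _ => this i, Finset.prod_pow_eq_pow_sum, ← Finset.mul_sum,
      Fin.sum_univ_eq_sum_range (fun i => i), mul_comm 2, Finset.sum_range_id_mul_two, Nat.mul_sub,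
      sq, mul_one]
  have hn : n ^ 2 = (n ^ 2 - n) + n := (Nat.sub_add_cancel (Nat.le_self_pow two_ne_zero n)).symm
  have hκ : κ ^ (n ^ 2) = κ ^ (n ^ 2 - n) * κ ^ n := by rw [← pow_add, ← hn]
  rw [hκ, ← hprod, Fintype.card_fin, div_pow, div_pow, one_pow]
  have : (0 : ℝ) < ∏ i ∈ range n, (i.factorial : ℝ) :=
      Finset.prod_pos fun i _ => by positivity
  have := Real.pi_pos
  field_simp
/-- The monic orthogonal polynomials for the weight `x ^ α * exp (-β x)` on `(0, ∞)`. -/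
noncomputable def monicLaguerre (α β : ℝ) : ℕ → Polynomial ℝ
  | 0 => 1
  | 1 => Polynomial.X - Polynomial.C ((α + 1) / β)
  | n + 2 => (Polynomial.X - Polynomial.C ((2 * (n + 1) + α + 1) / β)) * monicLaguerre α β (n + 1) -
      Polynomial.C ((n + 1) * (n + 1 + α) / β ^ 2) * monicLaguerre α β n

/-- Integration of polynomials against `x ^ α * exp (-β x)` on `(0, ∞)`, as a linear functional. -/
noncomputable def laguerreInt (α β : ℝ) : Polynomial ℝ →ₗ[ℝ] ℝ :=
  Polynomial.lsum fun k => (Real.Gamma (k + α + 1) / β ^ (k + α + 1)) • LinearMap.id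

section Laguerre

open Polynomial

variable {α β : ℝ}

lemma laguerreInt_monomial (k : ℕ) (c : ℝ) :
    laguerreInt α β (monomial k c) = c * (Real.Gamma (k + α + 1) / β ^ (k + α + 1)) := by
  simp [laguerreInt, Polynomial.lsum_apply, mul_comm]

lemma integrableOn_pow_mul_laguerreWeight (hα : -1 < α) (hβ : 0 < β) (k : ℕ) :
    IntegrableOn (fun x => x ^ k * (x ^ α * Real.exp (-β * x))) (Set.Ioi 0) := by
  have h := integrableOn_rpow_mul_exp_neg_mul_rpow (s := k + α) (p := 1) (b := β)
    (by have : (0 : ℝ) ≤ k := by positivity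
        linarith) one_pos hβ
  refine h.congr_fun (fun x hx => ?_) measurableSet_Ioi
  simp only [Real.rpow_one]
  rw [Real.rpow_add hx, Real.rpow_natCast, mul_assoc]

lemma integrableOn_eval_mul_laguerreWeight (hα : -1 < α) (hβ : 0 < β) (p : ℝ[X]) :
    IntegrableOn (fun x => p.eval x * (x ^ α * Real.exp (-β * x))) (Set.Ioi 0) := by
  simp_rw [eval_eq_sum_range, Finset.sum_mul, mul_assoc]
  exact integrable_finsetSum _ fun k _ =>
    (integrableOn_pow_mul_laguerreWeight hα hβ k).const_mul _

lemma integral_pow_mul_laguerreWeight (hα : -1 < α) (hβ : 0 < β) (k : ℕ) :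
    ∫ x in Set.Ioi 0, x ^ k * (x ^ α * Real.exp (-β * x)) =
      Real.Gamma (k + α + 1) / β ^ (k + α + 1) := by
  have hk : 0 < (k : ℝ) + α + 1 := by
    have : (0 : ℝ) ≤ k := by positivity
    linarith
  have h := Real.integral_rpow_mul_exp_neg_mul_Ioi hk hβ
  rw [Real.div_rpow zero_le_one hβ.le, Real.one_rpow, one_div_mul_eq_div] at h
  rw [← h]
  refine setIntegral_congr_fun measurableSet_Ioi fun x hx => ?_
  rw [show (k : ℝ) + α + 1 - 1 = k + α by ring, Real.rpow_add hx, Real.rpow_natCast, mul_assoc,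
    neg_mul]

lemma laguerreInt_eq_integral (hα : -1 < α) (hβ : 0 < β) (p : ℝ[X]) :
    laguerreInt α β p = ∫ x in Set.Ioi 0, p.eval x * (x ^ α * Real.exp (-β * x)) := by
  conv_lhs => rw [p.as_sum_range, map_sum]
  simp_rw [eval_eq_sum_range, Finset.sum_mul, mul_assoc]
  rw [integral_finsetSum _ fun k _ =>
    (integrableOn_pow_mul_laguerreWeight hα hβ k).const_mul _]
  refine Finset.sum_congr rfl fun k _ => ?_
  rw [laguerreInt_monomial, integral_const_mul, integral_pow_mul_laguerreWeight hα hβ]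

/-- Integration by parts for the Laguerre weight. -/
lemma laguerreInt_parts (hα : -1 < α) (hβ : 0 < β) (p : ℝ[X]) :
    laguerreInt α β (X * derivative p + (C (α + 1) - C β * X) * p) = 0 := by
  induction p using Polynomial.induction_on' with
  | add p q hp hq =>
    have e : X * derivative (p + q) + (C (α + 1) - C β * X) * (p + q) =
        (X * derivative p + (C (α + 1) - C β * X) * p) +
          (X * derivative q + (C (α + 1) - C β * X) * q) := by
      rw [derivative_add]; ring
    rw [e, map_add, hp, hq, add_zero]
  | monomial k c =>
    have hk : 0 < (k : ℝ) + α + 1 := by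
      have : (0 : ℝ) ≤ k := by positivity
      linarith
    have e : X * derivative (monomial k c) + (C (α + 1) - C β * X) * monomial k c =
        monomial k ((k + α + 1) * c) - monomial (k + 1) (β * c) := by
      cases k with
      | zero =>
        simp only [← C_mul_X_pow_eq_monomial, map_mul]
        simp
        ring
      | succ k =>
        simp only [← C_mul_X_pow_eq_monomial, derivative_C_mul_X_pow, map_mul, map_add]
        simp
        ring
    rw [e, map_sub, laguerreInt_monomial, laguerreInt_monomial]
    have e2 : ((k + 1 : ℕ) : ℝ) + α + 1 = (k + α + 1) + 1 := by push_cast; ring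
    rw [e2, Real.Gamma_add_one hk.ne', Real.rpow_add hβ ((k : ℝ) + α + 1) 1, Real.rpow_one]
    have hb := (Real.rpow_pos_of_pos hβ ((k : ℝ) + α + 1)).ne'
    generalize β ^ ((k : ℝ) + α + 1) = b at hb ⊢
    field_simp
    ring

lemma monicLaguerre_succ (n : ℕ) :
    monicLaguerre α β (n + 1) = (X - C ((2 * n + α + 1) / β)) * monicLaguerre α β n -
      C (n * (n + α) / β ^ 2) * monicLaguerre α β (n - 1) := by
  cases n with
  | zero => simp [monicLaguerre]
  | succ n => simp [monicLaguerre]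

lemma X_mul_monicLaguerre (n : ℕ) :
    X * monicLaguerre α β n = monicLaguerre α β (n + 1) +
      C ((2 * n + α + 1) / β) * monicLaguerre α β n +
      C (n * (n + α) / β ^ 2) * monicLaguerre α β (n - 1) := by
  rw [monicLaguerre_succ]; ring

lemma X_mul_derivative_monicLaguerre (hβ : 0 < β) (n : ℕ) :
    X * derivative (monicLaguerre α β n) = C (n : ℝ) * monicLaguerre α β n +
      C (n * (n + α) / β) * monicLaguerre α β (n - 1) := by
  induction n using Nat.strong_induction_on with
  | _ n ih =>
    match n with
    | 0 => simp [monicLaguerre]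
    | 1 =>
      simp [monicLaguerre]
      rw [add_comm 1 α, sub_add_cancel]
    | n + 2 =>
      have h1 := ih (n + 1) (by omega)
      have h0 := ih n (by omega)
      have r1 := monicLaguerre_succ (α := α) (β := β) (n + 1)
      have r0 := monicLaguerre_succ (α := α) (β := β) n
      have d1 := congrArg derivative r1
      simp only [Nat.add_sub_cancel, derivative_sub, derivative_mul, derivative_X, derivative_C,
        Nat.cast_add, Nat.cast_one, sub_zero, zero_mul, zero_add, one_mul] at h1 r1 r0 d1
      simp only [show n + 2 - 1 = n + 1 from rfl, show n + 1 + 1 = n + 2 from rfl] at *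
      apply Polynomial.funext
      intro x
      have h1' := congrArg (eval x) h1
      have h0' := congrArg (eval x) h0
      have r1' := congrArg (eval x) r1
      have r0' := congrArg (eval x) r0
      have d1' := congrArg (eval x) d1
      simp only [eval_mul, eval_add, eval_sub, eval_X, eval_C, Nat.cast_add, Nat.cast_ofNat] at *
      generalize eval x (monicLaguerre α β (n + 2)) = p2 at *
      generalize eval x (monicLaguerre α β (n + 1)) = p1 at *
      generalize eval x (monicLaguerre α β n) = p0 at *
      generalize eval x (monicLaguerre α β (n - 1)) = pm at *
      generalize eval x (derivative (monicLaguerre α β (n + 2))) = q2 at *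
      generalize eval x (derivative (monicLaguerre α β (n + 1))) = q1 at *
      generalize eval x (derivative (monicLaguerre α β n)) = q0 at *
      have hb := hβ.ne'
      have e0 : x * q0 = n * p0 + β * ((x - (2 * n + α + 1) / β) * p0 - p1) := by
        rw [h0', r0']; field_simp; ring
      rw [d1', r1']
      have : x * (p1 + (x - (2 * (n + 1) + α + 1) / β) * q1 -
          (n + 1) * (n + 1 + α) / β ^ 2 * q0) = x * p1 + (x - (2 * (n + 1) + α + 1) / β) * (x * q1)
          - (n + 1) * (n + 1 + α) / β ^ 2 * (x * q0) := by ring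
      rw [this, h1', e0]
      field_simp
      ring

lemma monicLaguerre_ode (hβ : 0 < β) (n : ℕ) :
    X * derivative (derivative (monicLaguerre α β n)) +
      (C (α + 1) - C β * X) * derivative (monicLaguerre α β n) +
      C (β * n) * monicLaguerre α β n = 0 := by
  cases n with
  | zero => simp [monicLaguerre]
  | succ n =>
    have h1 := X_mul_derivative_monicLaguerre (α := α) hβ (n + 1)
    have h0 := X_mul_derivative_monicLaguerre (α := α) hβ n
    have r0 := monicLaguerre_succ (α := α) (β := β) n
    have d1 := congrArg derivative h1
    simp only [Nat.add_sub_cancel, derivative_add, derivative_mul, derivative_X, derivative_C,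
        Nat.cast_add, Nat.cast_one, zero_mul, zero_add, one_mul] at h1 h0 r0 d1
    apply mul_left_cancel₀ (X_ne_zero (R := ℝ))
    rw [mul_zero]
    apply Polynomial.funext
    intro x
    have h1' := congrArg (eval x) h1
    have h0' := congrArg (eval x) h0
    have r0' := congrArg (eval x) r0
    have d1' := congrArg (eval x) d1
    simp only [eval_mul, eval_add, eval_sub, eval_X, eval_C, Nat.cast_add, Nat.cast_one,
      eval_zero] at *
    generalize eval x (monicLaguerre α β (n + 1)) = p1 at *
    generalize eval x (monicLaguerre α β n) = p0 at *
    generalize eval x (monicLaguerre α β (n - 1)) = pm at *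
    generalize eval x (derivative (monicLaguerre α β (n + 1))) = q1 at *
    generalize eval x (derivative (derivative (monicLaguerre α β (n + 1)))) = s1 at *
    generalize eval x (derivative (monicLaguerre α β n)) = q0 at *
    have hb := hβ.ne'
    have e0 : x * q0 = n * p0 + β * ((x - (2 * n + α + 1) / β) * p0 - p1) := by
      rw [h0', r0']; field_simp; ring
    have e1 : x * (x * s1) = x * ((n + 1) * q1) + (n + 1) * (n + 1 + α) / β * (x * q0) - x * q1 := by
      linear_combination x * d1'
    have e2 : (n + 1) * (n + 1 + α) / β * p0 = x * q1 - (n + 1) * p1 := by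
      rw [h1']; ring
    have e3 : (n + 1) * (n + 1 + α) / β * (x * q0) =
        (n + β * (x - (2 * n + α + 1) / β)) * (x * q1 - (n + 1) * p1) -
          (n + 1) * (n + 1 + α) * p1 := by
      rw [e0, ← e2]; field_simp; ring
    have e4 : x * (x * s1 + (α + 1 - β * x) * q1 + β * (n + 1) * p1) =
      x * (x * s1) + (α + 1 - β * x) * (x * q1) + x * (β * (n + 1) * p1) := by ring
    rw [e4, e1, e3]
    field_simp
    ring

lemma laguerreInt_derivative_mul (hα : -1 < α) (hβ : 0 < β) (n : ℕ) (q : ℝ[X]) :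
    laguerreInt α β (X * derivative (monicLaguerre α β n) * derivative q) =
      β * n * laguerreInt α β (monicLaguerre α β n * q) := by
  have h := laguerreInt_parts hα hβ (derivative (monicLaguerre α β n) * q)
  have h2 := monicLaguerre_ode (α := α) hβ n
  have e : X * derivative (derivative (monicLaguerre α β n) * q) +
      (C (α + 1) - C β * X) * (derivative (monicLaguerre α β n) * q) =
      X * derivative (monicLaguerre α β n) * derivative q -
        C (β * n) * (monicLaguerre α β n * q) := by
    rw [derivative_mul]
    linear_combination q * h2
  rw [e, map_sub, ← smul_eq_C_mul, map_smul, smul_eq_mul] at h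
  linarith

lemma laguerreInt_mul_of_ne (hα : -1 < α) (hβ : 0 < β) {n m : ℕ} (h : n ≠ m) :
    laguerreInt α β (monicLaguerre α β n * monicLaguerre α β m) = 0 := by
  have h1 := laguerreInt_derivative_mul hα hβ n (monicLaguerre α β m)
  have h2 := laguerreInt_derivative_mul hα hβ m (monicLaguerre α β n)
  rw [mul_right_comm, h1, mul_comm (monicLaguerre α β m)] at h2
  have h3 : (β * ((n : ℝ) - m)) *
      laguerreInt α β (monicLaguerre α β n * monicLaguerre α β m) = 0 := by linarith
  have h4 : ((n : ℝ) - m) ≠ 0 := sub_ne_zero.2 (by exact_mod_cast h)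
  simpa [hβ.ne', h4] using h3

/-- The squared norms of the monic Laguerre polynomials. -/
noncomputable def laguerreNorm (α β : ℝ) (n : ℕ) : ℝ :=
  laguerreInt α β (monicLaguerre α β n * monicLaguerre α β n)

lemma laguerreNorm_zero : laguerreNorm α β 0 = Real.Gamma (α + 1) / β ^ (α + 1) := by
  have := laguerreInt_monomial (α := α) (β := β) 0 1
  simpa [laguerreNorm, monicLaguerre] using this

lemma laguerreNorm_succ (hα : -1 < α) (hβ : 0 < β) (n : ℕ) :
    laguerreNorm α β (n + 1) = (n + 1) * (n + 1 + α) / β ^ 2 * laguerreNorm α β n := by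
  have hX : ∀ i j : ℕ, laguerreInt α β (X * monicLaguerre α β i * monicLaguerre α β j) =
      laguerreInt α β (monicLaguerre α β (i + 1) * monicLaguerre α β j) +
      (2 * i + α + 1) / β * laguerreInt α β (monicLaguerre α β i * monicLaguerre α β j) +
      i * (i + α) / β ^ 2 *
        laguerreInt α β (monicLaguerre α β (i - 1) * monicLaguerre α β j) := by
    intro i j
    rw [X_mul_monicLaguerre, add_mul, add_mul, mul_assoc (C _), mul_assoc (C _), map_add, map_add,
      ← smul_eq_C_mul, ← smul_eq_C_mul, map_smul, map_smul, smul_eq_mul, smul_eq_mul]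
  have h1 := hX n (n + 1)
  have h2 := hX (n + 1) n
  rw [laguerreInt_mul_of_ne hα hβ (show n ≠ n + 1 by omega)] at h1
  rw [laguerreInt_mul_of_ne hα hβ (show n + 1 ≠ n by omega),
    laguerreInt_mul_of_ne hα hβ (show n + 1 + 1 ≠ n by omega)] at h2
  have h3 : (n : ℝ) * (n + α) / β ^ 2 *
        laguerreInt α β (monicLaguerre α β (n - 1) * monicLaguerre α β (n + 1)) = 0 := by
    rw [laguerreInt_mul_of_ne hα hβ (show n - 1 ≠ n + 1 by omega), mul_zero]
  rw [h3, mul_right_comm] at h1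
  rw [h1] at h2
  simpa [laguerreNorm] using h2

lemma laguerreNorm_pos (hα : -1 < α) (hβ : 0 < β) (n : ℕ) : 0 < laguerreNorm α β n := by
  induction n with
  | zero =>
    rw [laguerreNorm_zero]
    exact div_pos (Real.Gamma_pos_of_pos (by linarith)) (Real.rpow_pos_of_pos hβ _)
  | succ n ih =>
    rw [laguerreNorm_succ hα hβ]
    have : (0 : ℝ) < n + 1 + α := by
      have : (0 : ℝ) ≤ n := by positivity
      linarith
    positivity

lemma monicLaguerre_monic_natDegree (n : ℕ) :
    (monicLaguerre α β n).Monic ∧ (monicLaguerre α β n).natDegree = n := by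
  induction n using Nat.strong_induction_on with
  | _ n ih =>
    match n with
    | 0 => simp [monicLaguerre]
    | 1 => exact ⟨monic_X_sub_C _, natDegree_X_sub_C _⟩
    | n + 2 =>
      obtain ⟨m1, d1⟩ := ih (n + 1) (by omega)
      obtain ⟨m0, d0⟩ := ih n (by omega)
      have hm := (monic_X_sub_C ((2 * ((n : ℝ) + 1) + α + 1) / β)).mul m1
      have hd : ((X - C ((2 * ((n : ℝ) + 1) + α + 1) / β)) * monicLaguerre α β (n + 1)).natDegree =
          n + 2 := by
        rw [(monic_X_sub_C _).natDegree_mul m1, natDegree_X_sub_C, d1]; omega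
      have hlt : (C (((n : ℝ) + 1) * (n + 1 + α) / β ^ 2) * monicLaguerre α β n).degree <
          ((X - C ((2 * ((n : ℝ) + 1) + α + 1) / β)) * monicLaguerre α β (n + 1)).degree := by
        refine degree_lt_degree ?_
        rw [hd]
        refine lt_of_le_of_lt (natDegree_C_mul_le _ _) ?_
        omega
      refine ⟨hm.sub_of_left hlt, ?_⟩
      rw [monicLaguerre, natDegree_sub_eq_left_of_natDegree_lt, hd]
      rw [hd]
      refine lt_of_le_of_lt (natDegree_C_mul_le _ _) ?_
      omega

/-- The Christoffel–Darboux formula, tested against two linear functionals. -/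
lemma christoffel_darboux (hα : -1 < α) (hβ : 0 < β) (l l' : ℝ[X] →ₗ[ℝ] ℝ) (n : ℕ) :
    ∑ j ∈ range n, (l (X * monicLaguerre α β j) * l' (monicLaguerre α β j) -
        l (monicLaguerre α β j) * l' (X * monicLaguerre α β j)) / laguerreNorm α β j =
      (l (monicLaguerre α β n) * l' (X * derivative (monicLaguerre α β n)) -
        l (X * derivative (monicLaguerre α β n)) * l' (monicLaguerre α β n)) /
        (β * laguerreNorm α β n) := by
  have hb := hβ.ne'
  have hD : ∀ (l : ℝ[X] →ₗ[ℝ] ℝ) (n : ℕ), l (X * derivative (monicLaguerre α β n)) =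
      n * l (monicLaguerre α β n) + n * (n + α) / β * l (monicLaguerre α β (n - 1)) := by
    intro l n
    rw [X_mul_derivative_monicLaguerre hβ, map_add, ← smul_eq_C_mul, ← smul_eq_C_mul, map_smul,
      map_smul, smul_eq_mul, smul_eq_mul]
  have hX : ∀ (l : ℝ[X] →ₗ[ℝ] ℝ) (n : ℕ), l (X * monicLaguerre α β n) =
      l (monicLaguerre α β (n + 1)) + (2 * n + α + 1) / β * l (monicLaguerre α β n) +
        n * (n + α) / β ^ 2 * l (monicLaguerre α β (n - 1)) := by
    intro l n
    rw [X_mul_monicLaguerre, map_add, map_add, ← smul_eq_C_mul, ← smul_eq_C_mul, map_smul,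
      map_smul, smul_eq_mul, smul_eq_mul]
  induction n with
  | zero => simp [monicLaguerre]
  | succ n ih =>
    rw [Finset.sum_range_succ, ih, hD l n, hD l' n, hD l (n + 1), hD l' (n + 1), hX l n, hX l' n,
      laguerreNorm_succ hα hβ]
    have h1 := (laguerreNorm_pos hα hβ n).ne'
    have h2 : (n : ℝ) + 1 + α ≠ 0 := by
      have : (0 : ℝ) ≤ n := by positivity
      linarith
    have h3 : (n : ℝ) + 1 ≠ 0 := by positivity
    simp only [Nat.add_sub_cancel, Nat.cast_add, Nat.cast_one]
    field_simp
    ring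

end Laguerre
section Scaling

open Polynomial

variable {α β t : ℝ}

lemma monicLaguerre_comp (ht : t ≠ 0) (n : ℕ) :
    (monicLaguerre α (β / t) n).comp (C t * X) = C (t ^ n) * monicLaguerre α β n := by
  have e : ∀ x : ℝ, x / (β / t) = t * (x / β) := fun x => by field_simp
  induction n using Nat.strong_induction_on with
  | _ n ih =>
    match n with
    | 0 => simp [monicLaguerre]
    | 1 =>
      simp only [monicLaguerre, sub_comp, mul_comp, X_comp, C_comp, pow_one, e, C_mul]
      ring
    | n + 2 =>
      have e2 : ((n : ℝ) + 1) * (n + 1 + α) / (β / t) ^ 2 =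
          t ^ 2 * ((n + 1) * (n + 1 + α) / β ^ 2) := by field_simp
      simp only [monicLaguerre, sub_comp, mul_comp, pow_comp, X_comp, C_comp, ih (n + 1) (by omega),
        ih n (by omega), e, e2, C_mul, C_pow]
      ring

lemma monicLaguerre_eval_scale (ht : t ≠ 0) (n : ℕ) (y : ℝ) :
    (monicLaguerre α (β / t) n).eval (t * y) = t ^ n * (monicLaguerre α β n).eval y := by
  have := congrArg (eval y) (monicLaguerre_comp (α := α) (β := β) ht n)
  simpa using this

lemma monicLaguerre_derivative_eval_scale (ht : t ≠ 0) (n : ℕ) (y : ℝ) :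
    t * (derivative (monicLaguerre α (β / t) n)).eval (t * y) =
      t ^ n * (derivative (monicLaguerre α β n)).eval y := by
  have := congrArg (fun p => eval y (derivative p)) (monicLaguerre_comp (α := α) (β := β) ht n)
  simpa [derivative_comp, -map_pow] using this

lemma laguerreNorm_scale (hα : -1 < α) (hβ : 0 < β) (ht : 0 < t) (n : ℕ) :
    laguerreNorm α (β / t) n = t ^ (2 * n) * t ^ (α + 1) * laguerreNorm α β n := by
  induction n with
  | zero =>
    rw [laguerreNorm_zero, laguerreNorm_zero, Real.div_rpow hβ.le ht.le, mul_zero, pow_zero]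
    field_simp
  | succ n ih =>
    rw [laguerreNorm_succ hα (div_pos hβ ht), ih, laguerreNorm_succ hα hβ]
    field_simp
    ring

end Scaling
namespace FirstOrderLimit

open Filter Asymptotics Topology

lemma of_comp_add {f : ℕ → ℝ} {L : ℝ} (k : ℕ) (h : FirstOrderLimit (fun n => f (n + k)) L) :
    FirstOrderLimit f L := by
  have h1 : (fun n => f (n + k) - L) =O[atTop] (fun n : ℕ => ((n + k : ℕ) : ℝ)⁻¹) := by
    refine IsBigO.trans h (IsBigO.of_bound (k + 1) ?_)
    filter_upwards [eventually_gt_atTop 0] with N hN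
    have hN' : (1 : ℝ) ≤ N := by exact_mod_cast hN
    simp only [Real.norm_eq_abs, Nat.cast_add]
    rw [abs_of_pos (by positivity), abs_of_pos (by positivity), ← div_eq_mul_inv,
      inv_eq_one_div, div_le_div_iff₀ (by positivity) (by positivity)]
    have : (0 : ℝ) ≤ k := by positivity
    nlinarith
  obtain ⟨c, hc⟩ := isBigO_iff.1 h1
  rw [FirstOrderLimit, isBigO_iff]
  refine ⟨c, ?_⟩
  rw [← map_add_atTop_eq_nat k]
  exact hc

/-- Affine functions of `n` divided by `n`. -/
lemma affine_div (a b : ℝ) : FirstOrderLimit (fun n => (a * n + b) / n) a := by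
  have h : FirstOrderLimit (fun n => a + b * (n : ℝ)⁻¹) (a + b * 0) :=
    (const a).add (inv_nat.const_mul b)
  rw [mul_zero, add_zero] at h
  refine h.congr' ?_
  filter_upwards [eventually_gt_atTop 0] with n hn
  have : (n : ℝ) ≠ 0 := by positivity
  field_simp

lemma affine_div_affine (a b c d : ℝ) (hc : c ≠ 0) :
    FirstOrderLimit (fun n => (a * n + b) / (c * n + d)) (a / c) := by
  refine ((affine_div a b).div (affine_div c d) hc).congr' ?_
  filter_upwards [eventually_gt_atTop 0] with n hn
  have : (n : ℝ) ≠ 0 := by positivity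
  field_simp

end FirstOrderLimit

/-- The large parameter in the Liouville–Green form of the Laguerre equation. -/
noncomputable def laguerreNu (α : ℝ) (n : ℕ) : ℝ := n + (α + 1) / 2

lemma laguerreNu_pos {α : ℝ} (hα : -1 < α) (n : ℕ) : 0 < laguerreNu α n := by
  have : (0 : ℝ) ≤ n := by positivity
  unfold laguerreNu
  linarith

section Moments

open Polynomial Real

variable {α : ℝ}

lemma firstOrderLimit_laguerreInt_aux (hα : -1 < α) (K k i j : ℕ) (hk : k ≤ i) :
    FirstOrderLimit (fun r => laguerreInt α (4 * laguerreNu α (r + K))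
        (X ^ k * monicLaguerre α (4 * laguerreNu α (r + K)) (r + i) *
          monicLaguerre α (4 * laguerreNu α (r + K)) (r + j)) /
        laguerreNorm α (4 * laguerreNu α (r + K)) r)
      ((1 / 4) ^ (i + j) * (1 / π * ∫ θ in 0..π, ((1 + cos θ) / 2) ^ k * cos (((i : ℝ) - j) * θ))) := by
  have hβ : ∀ r, 0 < 4 * laguerreNu α (r + K) := fun r => by
    have := laguerreNu_pos hα (r + K); linarith
  have hA : ∀ i : ℕ, FirstOrderLimit (fun r =>
      (2 * ((r + i : ℕ) : ℝ) + α + 1) / (4 * laguerreNu α (r + K))) (1 / 2) := by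
    intro i
    have := FirstOrderLimit.affine_div_affine 2 (2 * i + α + 1) 4 (4 * K + 2 * (α + 1)) (by norm_num)
    norm_num at this
    refine this.congr' (Filter.Eventually.of_forall fun r => ?_)
    simp only [laguerreNu, Nat.cast_add]
    congr 1 <;> ring
  have hB : ∀ i : ℕ, FirstOrderLimit (fun r =>
      ((r + i : ℕ) : ℝ) * ((r + i : ℕ) + α) / (4 * laguerreNu α (r + K)) ^ 2) (1 / 16) := by
    intro i
    have h1 := FirstOrderLimit.affine_div_affine 1 i 4 (4 * K + 2 * (α + 1)) (by norm_num)
    have h2 := FirstOrderLimit.affine_div_affine 1 (i + α) 4 (4 * K + 2 * (α + 1)) (by norm_num)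
    have := h1.mul h2
    norm_num at this
    refine this.congr' (Filter.Eventually.of_forall fun r => ?_)
    simp only [laguerreNu, Nat.cast_add]
    rw [div_mul_div_comm]
    congr 1 <;> ring
  induction k generalizing i j with
  | zero =>
    simp only [pow_zero, one_mul]
    by_cases hij : i = j
    · subst hij
      simp only [sub_self, zero_mul, cos_zero, intervalIntegral.integral_const, sub_zero, smul_eq_mul,
        mul_one]
      rw [one_div_mul_cancel pi_ne_zero, mul_one]
      clear hk
      induction i with
      | zero =>
        simp only [add_zero]
        refine (FirstOrderLimit.const _).congr' (Filter.Eventually.of_forall fun r => ?_)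
        have := (laguerreNorm_pos hα (hβ r) r).ne'
        rw [pow_zero]
        exact (div_self this).symm
      | succ i ih =>
        have := (hB (i + 1)).mul ih
        rw [show ((1 : ℝ) / 4) ^ (i + 1 + (i + 1)) = 1 / 16 * (1 / 4) ^ (i + i) by ring]
        refine this.congr' (Filter.Eventually.of_forall fun r => ?_)
        have e := laguerreNorm_succ hα (hβ r) (r + i)
        simp only [laguerreNorm] at e ⊢
        rw [← add_assoc, e]
        push_cast
        ring
    · have h0 : ∫ θ in 0..π, cos (((i : ℝ) - j) * θ) = 0 := by
        have hne : (i : ℝ) - j ≠ 0 := sub_ne_zero.2 (by exact_mod_cast hij)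
        rw [intervalIntegral.integral_comp_mul_left (fun x => cos x) hne, integral_cos]
        have : sin (((i : ℝ) - j) * π) = 0 := by
          have := sin_int_mul_pi ((i : ℤ) - j)
          push_cast at this
          exact this
        simp [this]
      rw [h0, mul_zero, mul_zero]
      refine (FirstOrderLimit.const _).congr' (Filter.Eventually.of_forall fun r => ?_)
      beta_reduce
      rw [laguerreInt_mul_of_ne hα (hβ r) (by omega), zero_div]
  | succ k ih =>
    obtain ⟨i, rfl⟩ : ∃ i', i = i' + 1 := ⟨i - 1, by omega⟩
    have h1 := ih (i + 1 + 1) j (by omega)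
    have h2 := (hA (i + 1)).mul (ih (i + 1) j (by omega))
    have h3 := (hB (i + 1)).mul (ih i j (by omega))
    have h := (h1.add h2).add h3
    have h_int : ∀ c : ℝ, IntervalIntegrable (fun θ => ((1 + cos θ) / 2) ^ k * cos (c * θ)) volume 0 π :=
      fun c => Continuous.intervalIntegrable (by fun_prop) _ _
    have e : ∫ θ in 0..π, ((1 + cos θ) / 2) ^ (k + 1) * cos ((((i + 1 : ℕ) : ℝ) - j) * θ) =
        1 / 4 * (∫ θ in 0..π, ((1 + cos θ) / 2) ^ k * cos ((((i + 1 + 1 : ℕ) : ℝ) - j) * θ)) +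
        1 / 2 * (∫ θ in 0..π, ((1 + cos θ) / 2) ^ k * cos ((((i + 1 : ℕ) : ℝ) - j) * θ)) +
        1 / 4 * (∫ θ in 0..π, ((1 + cos θ) / 2) ^ k * cos (((i : ℝ) - j) * θ)) := by
      rw [← intervalIntegral.integral_const_mul, ← intervalIntegral.integral_const_mul,
        ← intervalIntegral.integral_const_mul,
        ← intervalIntegral.integral_add ((h_int _).const_mul _) ((h_int _).const_mul _),
        ← intervalIntegral.integral_add (((h_int _).const_mul _).add ((h_int _).const_mul _))
          ((h_int _).const_mul _)]
      refine intervalIntegral.integral_congr fun θ _ => ?_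
      have c1 : cos ((((i + 1 + 1 : ℕ) : ℝ) - j) * θ) =
          cos ((((i + 1 : ℕ) : ℝ) - j) * θ) * cos θ - sin ((((i + 1 : ℕ) : ℝ) - j) * θ) * sin θ := by
        rw [← cos_add]; congr 1; push_cast; ring
      have c2 : cos (((i : ℝ) - j) * θ) =
          cos ((((i + 1 : ℕ) : ℝ) - j) * θ) * cos θ + sin ((((i + 1 : ℕ) : ℝ) - j) * θ) * sin θ := by
        rw [← cos_sub]; congr 1; push_cast; ring
      rw [c1, c2]
      ring
    rw [e]
    refine (h.congr' (Filter.Eventually.of_forall fun r => ?_)).congr_limit ?_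
    · beta_reduce
      have e2 : X ^ (k + 1) * monicLaguerre α (4 * laguerreNu α (r + K)) (r + (i + 1)) *
          monicLaguerre α (4 * laguerreNu α (r + K)) (r + j) =
          X ^ k * (X * monicLaguerre α (4 * laguerreNu α (r + K)) (r + (i + 1))) *
          monicLaguerre α (4 * laguerreNu α (r + K)) (r + j) := by ring
      rw [e2, X_mul_monicLaguerre]
      have e3 : ∀ (a b : ℝ) (p q s t u : ℝ[X]), p * (q + C a * s + C b * t) * u =
          p * q * u + C a * (p * s * u) + C b * (p * t * u) := fun a b p q s t u => by ring
      rw [e3, map_add, map_add, ← smul_eq_C_mul, ← smul_eq_C_mul, map_smul, map_smul, smul_eq_mul,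
        smul_eq_mul]
      simp only [← add_assoc, Nat.add_sub_cancel]
      ring
    · ring

lemma firstOrderLimit_laguerreInt_pow (hα : -1 < α) (k : ℕ) :
    FirstOrderLimit (fun n => laguerreInt α (4 * laguerreNu α n)
        (X ^ k * monicLaguerre α (4 * laguerreNu α n) n * monicLaguerre α (4 * laguerreNu α n) n) /
        laguerreNorm α (4 * laguerreNu α n) n)
      (1 / π * ∫ θ in 0..π, ((1 + cos θ) / 2) ^ k) := by
  apply FirstOrderLimit.of_comp_add k
  have h1 := firstOrderLimit_laguerreInt_aux hα k k k k le_rfl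
  have h2 := firstOrderLimit_laguerreInt_aux hα k 0 k k (Nat.zero_le _)
  simp only [sub_self, zero_mul, cos_zero, mul_one, pow_zero, one_mul,
    intervalIntegral.integral_const, sub_zero, smul_eq_mul] at h1 h2
  rw [one_div_mul_cancel pi_ne_zero, mul_one] at h2
  refine ((h1.div h2 (by positivity)).congr' (Filter.Eventually.of_forall fun r => ?_)).congr_limit ?_
  · beta_reduce
    have hβ : 0 < 4 * laguerreNu α (r + k) := by
      have := laguerreNu_pos hα (r + k); linarith
    have := (laguerreNorm_pos hα hβ r).ne'
    rw [div_div_div_cancel_right₀ this]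
    rfl
  · have : ((1 : ℝ) / 4) ^ (k + k) ≠ 0 := by positivity
    field_simp

/-- Averages of polynomials against the arcsine-type limit of the orthonormal densities. -/
lemma firstOrderLimit_laguerreInt (hα : -1 < α) (f : ℝ[X]) :
    FirstOrderLimit (fun n => laguerreInt α (4 * laguerreNu α n)
        (f * monicLaguerre α (4 * laguerreNu α n) n ^ 2) / laguerreNorm α (4 * laguerreNu α n) n)
      (1 / π * ∫ θ in 0..π, f.eval ((1 + cos θ) / 2)) := by
  induction f using Polynomial.induction_on' with
  | add p q hp hq =>
    refine ((hp.add hq).congr' (Filter.Eventually.of_forall fun r => ?_)).congr_limit ?_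
    · beta_reduce
      simp only [add_mul, map_add]
      ring
    · simp only [eval_add]
      rw [intervalIntegral.integral_add (Continuous.intervalIntegrable (by fun_prop) _ _)
        (Continuous.intervalIntegrable (by fun_prop) _ _)]
      ring
  | monomial k c =>
    refine (((firstOrderLimit_laguerreInt_pow hα k).const_mul c).congr'
      (Filter.Eventually.of_forall fun r => ?_)).congr_limit ?_
    · beta_reduce
      rw [← C_mul_X_pow_eq_monomial, mul_assoc, mul_assoc (C c), ← sq, ← smul_eq_C_mul c,
        map_smul, smul_eq_mul]
      ring
    · simp only [eval_monomial, intervalIntegral.integral_const_mul]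
      ring

end Moments
section Amplitude

open Real

/-- The adiabatic invariant of `u'' = -(4 ν² (1 / y - 1) + c / y²) u` on `(0, 1)`, where `u₁ = u'`. -/
noncomputable def lgInvariant (ν c : ℝ) (u u₁ : ℝ → ℝ) (y : ℝ) : ℝ :=
  √(y * (1 - y)) / (1 - y) * (u₁ y ^ 2 - u y * u₁ y / (2 * (y * (1 - y))) +
    (4 * ν ^ 2 * (1 / y - 1) + c / y ^ 2 + (4 * y - 1) / (8 * (y * (1 - y)) ^ 2)) * u y ^ 2)

variable {ν c : ℝ} {u u₁ : ℝ → ℝ}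

lemma hasDerivAt_lgInvariant {y : ℝ} (hy : y ∈ Set.Ioo (0 : ℝ) 1) (hu : HasDerivAt u (u₁ y) y)
    (hu₁ : HasDerivAt u₁ (-(4 * ν ^ 2 * (1 / y - 1) + c / y ^ 2) * u y) y) :
    HasDerivAt (lgInvariant ν c u u₁)
      (√(y * (1 - y)) / (1 - y) * (c / (y * (1 - y) * y ^ 2) - 2 * c / y ^ 3 +
        (1 / 8 - 3 * (1 - 2 * y) / 4 + y * (1 - y) + (1 - 2 * y) ^ 2) / (2 * (y * (1 - y)) ^ 3)) *
        u y ^ 2) y := by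
  obtain ⟨h0, h1⟩ := hy
  have h2 : 0 < 1 - y := by linarith
  have hw : 0 < y * (1 - y) := by positivity
  have dw : HasDerivAt (fun y : ℝ => y * (1 - y)) (1 - 2 * y) y := by
    have := (hasDerivAt_id y).mul ((hasDerivAt_const y (1 : ℝ)).sub (hasDerivAt_id y))
    refine this.congr_deriv ?_
    simp; ring
  have d1 : HasDerivAt (fun y : ℝ => 1 - y) (-1) y := by
    exact ((hasDerivAt_const y (1 : ℝ)).sub (hasDerivAt_id y)).congr_deriv (by simp)
  have dg := (dw.sqrt hw.ne').div d1 h2.ne'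
  have dF := (((hasDerivAt_inv h0.ne').sub_const 1).const_mul (4 * ν ^ 2)).add
    ((hasDerivAt_const y c).div (hasDerivAt_pow 2 y) (by positivity))
  have dS := ((((hasDerivAt_id y).const_mul 4).sub_const 1).div ((dw.pow 2).const_mul 8)
    (mul_ne_zero (by norm_num) (pow_ne_zero 2 hw.ne')))
  have dV := ((hu₁.pow 2).sub ((hu.mul hu₁).div (dw.const_mul 2) (by positivity))).add
    ((dF.add dS).mul (hu.pow 2))
  have hs : √(y * (1 - y)) ^ 2 = y * (1 - y) := sq_sqrt hw.le
  have hs0 : 0 < √(y * (1 - y)) := sqrt_pos.2 hw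
  have d := dg.mul dV
  have d' := d.congr_of_eventuallyEq (f₁ := lgInvariant ν c u u₁)
    (Filter.Eventually.of_forall fun y => by simp [lgInvariant])
  refine d'.congr_deriv ?_
  simp only [Pi.pow_apply, Pi.mul_apply, Pi.div_apply, id, Pi.add_apply, Pi.sub_apply]
  generalize √(y * (1 - y)) = S at *
  have e : ((1 - 2 * y) / (2 * S) * (1 - y) - S * -1) / (1 - y) ^ 2 =
      S / (1 - y) * (1 / (2 * (y * (1 - y)))) := by
    field_simp
    rw [hs]; ring
  rw [e]
  generalize u y = U
  generalize u₁ y = U1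
  field_simp
  ring

lemma abs_lgInvariant_deriv_le {y : ℝ} (hy : y ∈ Set.Ioo (0 : ℝ) 1) :
    |√(y * (1 - y)) / (1 - y) * (c / (y * (1 - y) * y ^ 2) - 2 * c / y ^ 3 +
        (1 / 8 - 3 * (1 - 2 * y) / 4 + y * (1 - y) + (1 - 2 * y) ^ 2) / (2 * (y * (1 - y)) ^ 3))| ≤
      (3 * |c| + 2) / (y * (1 - y)) ^ 4 := by
  obtain ⟨h0, h1⟩ := hy
  have h2 : 0 < 1 - y := by linarith
  have hw : 0 < y * (1 - y) := by positivity
  have hw1 : y * (1 - y) ≤ 1 - y := by nlinarith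
  have hw2 : y * (1 - y) ≤ y := by nlinarith
  have hg : |√(y * (1 - y)) / (1 - y)| ≤ 1 / (y * (1 - y)) := by
    rw [abs_of_nonneg (by positivity)]
    have : √(y * (1 - y)) ≤ 1 := by
      exact Real.sqrt_le_one.2 (by nlinarith)
    gcongr
  have t1 : |c / (y * (1 - y) * y ^ 2)| ≤ |c| / (y * (1 - y)) ^ 3 := by
    rw [abs_div, abs_of_pos (by positivity : 0 < y * (1 - y) * y ^ 2)]
    gcongr
    calc (y * (1 - y)) ^ 3 = y * (1 - y) * (y * (1 - y)) ^ 2 := by ring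
      _ ≤ _ := by gcongr
  have t2 : |2 * c / y ^ 3| ≤ 2 * |c| / (y * (1 - y)) ^ 3 := by
    rw [abs_div, abs_mul, abs_of_pos (by positivity : 0 < y ^ 3), abs_two]
    gcongr
  have t3 : |(1 / 8 - 3 * (1 - 2 * y) / 4 + y * (1 - y) + (1 - 2 * y) ^ 2) /
      (2 * (y * (1 - y)) ^ 3)| ≤ 2 / (y * (1 - y)) ^ 3 := by
    rw [abs_div, abs_of_pos (by positivity : 0 < 2 * (y * (1 - y)) ^ 3),
      div_le_div_iff₀ (by positivity) (by positivity)]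
    have : |1 / 8 - 3 * (1 - 2 * y) / 4 + y * (1 - y) + (1 - 2 * y) ^ 2| ≤ 4 := by
      rw [abs_le]; constructor <;> nlinarith
    have h3 : 0 < (y * (1 - y)) ^ 3 := by positivity
    nlinarith
  rw [abs_mul]
  calc _ ≤ 1 / (y * (1 - y)) * (|c| / (y * (1 - y)) ^ 3 + 2 * |c| / (y * (1 - y)) ^ 3 +
        2 / (y * (1 - y)) ^ 3) := by
        refine mul_le_mul hg ?_ (abs_nonneg _) (by positivity)
        refine (abs_add_le _ _).trans (add_le_add ((abs_sub _ _).trans (add_le_add t1 t2)) t3)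
    _ = _ := by field_simp; ring

lemma abs_lgInvariant_sub_le (hcu : Continuous u) (hu : ∀ y > 0, HasDerivAt u (u₁ y) y)
    (hu₁ : ∀ y > 0, HasDerivAt u₁ (-(4 * ν ^ 2 * (1 / y - 1) + c / y ^ 2) * u y) y)
    {a b : ℝ} (ha : 0 < a) (hab : a ≤ b) (hb : b < 1) :
    |lgInvariant ν c u u₁ b - lgInvariant ν c u u₁ a| ≤
      (3 * |c| + 2) / (a * (1 - b)) ^ 4 * ∫ t in 0..1, u t ^ 2 := by
  set M := (3 * |c| + 2) / (a * (1 - b)) ^ 4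
  have hb1 : 0 < 1 - b := by linarith
  have hM : 0 ≤ M := by positivity
  set J : ℝ → ℝ := fun y => ∫ t in 0..y, u t ^ 2
  have hJ : ∀ y, HasDerivAt J (u y ^ 2) y := fun y =>
    (Continuous.integral_hasStrictDerivAt (hcu.pow 2) 0 y).hasDerivAt
  have hJm : Monotone J := monotone_of_deriv_nonneg (fun y => (hJ y).differentiableAt)
    fun y => by rw [(hJ y).deriv]; positivity
  have key : ∀ ε : ℝ, |ε| = 1 → ε * (lgInvariant ν c u u₁ b - lgInvariant ν c u u₁ a) ≤
      M * (J b - J a) := by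
    intro ε hε
    have hd : ∀ y ∈ Set.Icc a b, HasDerivAt (fun y => M * J y - ε * lgInvariant ν c u u₁ y) _ y :=
      fun y hy => ((hJ y).const_mul M).sub ((hasDerivAt_lgInvariant (c := c) (ν := ν)
        ⟨ha.trans_le hy.1, hy.2.trans_lt hb⟩ (hu y (ha.trans_le hy.1))
        (hu₁ y (ha.trans_le hy.1))).const_mul ε)
    have hmono : MonotoneOn (fun y => M * J y - ε * lgInvariant ν c u u₁ y) (Set.Icc a b) := by
      refine monotoneOn_of_deriv_nonneg (convex_Icc a b)
        (fun y hy => (hd y hy).continuousAt.continuousWithinAt)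
        (fun y hy => (hd y (interior_subset hy)).differentiableAt.differentiableWithinAt)
        fun y hy => ?_
      have hy' := interior_subset hy
      rw [(hd y hy').deriv, ← mul_assoc ε, ← sub_mul]
      refine mul_nonneg (sub_nonneg.2 ((le_abs_self _).trans ?_)) (sq_nonneg _)
      rw [abs_mul, hε, one_mul]
      have h3 : 0 ≤ 1 - b := by linarith
      have h4 : 0 < y := ha.trans_le hy'.1
      refine (abs_lgInvariant_deriv_le ⟨h4, hy'.2.trans_lt hb⟩).trans ?_
      have h5 : a * (1 - b) ≤ y * (1 - y) := by
        have := hy'.1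
        have := hy'.2
        gcongr
      change _ ≤ (3 * |c| + 2) / (a * (1 - b)) ^ 4
      gcongr
    have := hmono (Set.left_mem_Icc.2 hab) (Set.right_mem_Icc.2 hab) hab
    simp only at this
    linarith
  have hJJ : J b - J a ≤ J 1 := by
    have h1 := hJm hb.le
    have h2 : J 0 ≤ J a := hJm ha.le
    have h3 : J 0 = 0 := intervalIntegral.integral_same
    linarith
  have k1 := key 1 (by simp)
  have k2 := key (-1) (by simp)
  have k3 : M * (J b - J a) ≤ M * J 1 := by gcongr
  change _ ≤ M * J 1
  rw [abs_le]
  constructor <;> linarith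

/-- The remainder polynomial in the virial identity `integral_lgInvariant`. -/
noncomputable def lgRemainder (c y : ℝ) : ℝ :=
  2 * c * y ^ 4 * (1 - y) ^ 6 + (30 * (y * (1 - y)) ^ 4 * (1 - 2 * y) ^ 2 - 12 * (y * (1 - y)) ^ 5 +
    5 / 2 * (y * (1 - y)) ^ 4 * (1 - 2 * y)) / 2 + (4 * y - 1) * (y * (1 - y)) ^ 4 / 8

/-- The invariant multiplied by a weight that makes it continuous up to the end points. -/
noncomputable def lgDensity (ν c : ℝ) (u u₁ : ℝ → ℝ) (y : ℝ) : ℝ :=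
  y ^ 4 * (1 - y) ^ 6 * (y * u₁ y) ^ 2 - y ^ 4 * (1 - y) ^ 5 * u y * (y * u₁ y) / 2 +
    (4 * ν ^ 2 * y ^ 5 * (1 - y) ^ 7 + c * y ^ 4 * (1 - y) ^ 6 +
      (4 * y - 1) * (y * (1 - y)) ^ 4 / 8) * u y ^ 2

lemma integral_lgDensity (hcu : Continuous u) (hcz : Continuous fun y => y * u₁ y)
    (hu : ∀ y > 0, HasDerivAt u (u₁ y) y)
    (hu₁ : ∀ y > 0, HasDerivAt u₁ (-(4 * ν ^ 2 * (1 / y - 1) + c / y ^ 2) * u y) y) :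
    ∫ y in 0..1, lgDensity ν c u u₁ y =
      ∫ y in 0..1, (8 * ν ^ 2 * y ^ 5 * (1 - y) ^ 7 + lgRemainder c y) * u y ^ 2 := by
  have hc1 : Continuous (lgDensity ν c u u₁) := by
    unfold lgDensity; fun_prop
  have hc2 : Continuous fun y => (8 * ν ^ 2 * y ^ 5 * (1 - y) ^ 7 + lgRemainder c y) * u y ^ 2 := by
    unfold lgRemainder; fun_prop
  rw [← sub_eq_zero, ← intervalIntegral.integral_sub (hc1.intervalIntegrable _ _)
    (hc2.intervalIntegrable _ _)]
  have hB := intervalIntegral.integral_eq_sub_of_hasDerivAt_of_le (a := 0) (b := 1)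
    (f := fun y => y ^ 5 * (1 - y) ^ 6 * (u y * (y * u₁ y)) -
      (6 * (y * (1 - y)) ^ 5 * (1 - 2 * y) + (y * (1 - y)) ^ 5 / 2) / 2 * u y ^ 2)
    (f' := fun y => lgDensity ν c u u₁ y -
      (8 * ν ^ 2 * y ^ 5 * (1 - y) ^ 7 + lgRemainder c y) * u y ^ 2)
    zero_le_one (by fun_prop) ?_ ((hc1.sub hc2).intervalIntegrable _ _)
  · rw [hB]; norm_num
  · intro y hy
    have d1 : HasDerivAt (fun y : ℝ => 1 - y) (-1) y :=
      ((hasDerivAt_const y (1 : ℝ)).sub (hasDerivAt_id y)).congr_deriv (by simp)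
    have d2 : HasDerivAt (fun y : ℝ => 1 - 2 * y) (-2) y :=
      ((hasDerivAt_const y (1 : ℝ)).sub ((hasDerivAt_id y).const_mul 2)).congr_deriv (by simp)
    have dw : HasDerivAt (fun y : ℝ => y * (1 - y)) (1 - 2 * y) y := by
      refine ((hasDerivAt_id y).mul d1).congr_deriv ?_
      simp; ring
    have du := hu y hy.1
    have du₁ := hu₁ y hy.1
    have d := (((hasDerivAt_pow 5 y).mul (d1.pow 6)).mul (du.mul ((hasDerivAt_id y).mul du₁))).sub
      ((((((dw.pow 5).const_mul 6).mul d2).add ((dw.pow 5).div_const 2)).div_const 2).mul (du.pow 2))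
    refine d.congr_deriv ?_
    have h0 := hy.1.ne'
    simp only [Pi.pow_apply, Pi.mul_apply, Pi.add_apply, lgDensity, lgRemainder, id]
    push_cast
    field_simp
    ring

end Amplitude
section Amplitude

open Real

variable {ν c : ℝ} {u u₁ : ℝ → ℝ}

lemma abs_lgRemainder_le {y : ℝ} (hy : y ∈ Set.Icc (0 : ℝ) 1) : |lgRemainder c y| ≤ 2 * |c| + 40 := by
  obtain ⟨h0, h1⟩ := hy
  have h2 : 0 ≤ 1 - y := by linarith
  have hw0 : 0 ≤ y * (1 - y) := by positivity
  have hw1 : y * (1 - y) ≤ 1 := by nlinarith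
  have p : ∀ k, 0 ≤ (y * (1 - y)) ^ k ∧ (y * (1 - y)) ^ k ≤ 1 := fun k =>
    ⟨by positivity, pow_le_one₀ hw0 hw1⟩
  have q1 : |1 - 2 * y| ≤ 1 := by rw [abs_le]; constructor <;> linarith
  have q2 : |4 * y - 1| ≤ 3 := by rw [abs_le]; constructor <;> linarith
  have a1 : |2 * c * y ^ 4 * (1 - y) ^ 6| ≤ 2 * |c| := by
    have e : 2 * c * y ^ 4 * (1 - y) ^ 6 = 2 * c * (y ^ 4 * (1 - y) ^ 6) := by ring
    have h3 : y ^ 4 * (1 - y) ^ 6 ≤ 1 :=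
      mul_le_one₀ (pow_le_one₀ h0 h1) (by positivity) (pow_le_one₀ h2 (by linarith))
    rw [e, abs_mul, abs_mul, abs_two, abs_of_nonneg (by positivity : 0 ≤ y ^ 4 * (1 - y) ^ 6)]
    exact mul_le_of_le_one_right (by positivity) h3
  have a2 : |30 * (y * (1 - y)) ^ 4 * (1 - 2 * y) ^ 2| ≤ 30 := by
    rw [abs_mul, abs_mul, abs_pow (1 - 2 * y), abs_of_nonneg (p 4).1, abs_of_pos (by norm_num)]
    have := mul_le_one₀ (p 4).2 (by positivity) (pow_le_one₀ (n := 2) (abs_nonneg _) q1)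
    linarith
  have a3 : |12 * (y * (1 - y)) ^ 5| ≤ 12 := by
    rw [abs_mul, abs_of_nonneg (p 5).1, abs_of_pos (by norm_num)]
    linarith [(p 5).2]
  have a4 : |5 / 2 * (y * (1 - y)) ^ 4 * (1 - 2 * y)| ≤ 5 / 2 := by
    rw [abs_mul, abs_mul, abs_of_nonneg (p 4).1, abs_of_pos (by norm_num)]
    have := mul_le_one₀ (p 4).2 (by positivity) q1
    linarith
  have a5 : |(4 * y - 1) * (y * (1 - y)) ^ 4| ≤ 3 := by
    rw [abs_mul, abs_of_nonneg (p 4).1]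
    nlinarith [(p 4).1, (p 4).2, abs_nonneg (4 * y - 1)]
  rw [abs_le] at *
  unfold lgRemainder
  constructor <;> linarith [a1.1, a1.2, a2.1, a2.2, a3.1, a3.2, a4.1, a4.2, a5.1, a5.2]

/-- The weight relating `lgInvariant` and `lgDensity`. -/
noncomputable def lgWeight (y : ℝ) : ℝ := (y * (1 - y)) ^ 5 * (1 - y) * √(y * (1 - y))

lemma continuous_lgWeight : Continuous lgWeight := by
  unfold lgWeight; fun_prop

lemma lgWeight_mul_lgInvariant {y : ℝ} (hy : y ∈ Set.Ioo (0 : ℝ) 1) :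
    lgWeight y * lgInvariant ν c u u₁ y = lgDensity ν c u u₁ y := by
  obtain ⟨h0, h1⟩ := hy
  have h2 : 0 < 1 - y := by linarith
  have hw : 0 < y * (1 - y) := by positivity
  have hs : √(y * (1 - y)) ^ 2 = y * (1 - y) := sq_sqrt hw.le
  unfold lgWeight lgInvariant lgDensity
  generalize √(y * (1 - y)) = S at *
  generalize u y = U
  generalize u₁ y = U1
  field_simp
  rw [hs]

lemma lgWeight_le {y : ℝ} (hy : y ∈ Set.Ioo (0 : ℝ) 1) :
    0 ≤ lgWeight y ∧ lgWeight y ≤ (y * (1 - y)) ^ 4 := by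
  obtain ⟨h0, h1⟩ := hy
  have h2 : 0 < 1 - y := by linarith
  have hw : 0 < y * (1 - y) := by positivity
  have hs : √(y * (1 - y)) ≤ 1 := Real.sqrt_le_one.2 (by nlinarith)
  unfold lgWeight
  refine ⟨by positivity, ?_⟩
  calc _ = (y * (1 - y)) ^ 4 * (y * (1 - y) * (1 - y) * √(y * (1 - y))) := by ring
    _ ≤ (y * (1 - y)) ^ 4 * 1 := by
      gcongr
      refine mul_le_one₀ (mul_le_one₀ ?_ h2.le (by linarith)) (by positivity) hs
      nlinarith
    _ = _ := mul_one _

lemma abs_lgInvariant_sub_le' (hcu : Continuous u) (hu : ∀ y > 0, HasDerivAt u (u₁ y) y)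
    (hu₁ : ∀ y > 0, HasDerivAt u₁ (-(4 * ν ^ 2 * (1 / y - 1) + c / y ^ 2) * u y) y)
    {a b : ℝ} (ha : a ∈ Set.Ioo (0 : ℝ) 1) (hb : b ∈ Set.Ioo (0 : ℝ) 1) :
    |lgInvariant ν c u u₁ b - lgInvariant ν c u u₁ a| ≤
      (3 * |c| + 2) / (a * (1 - a) * (b * (1 - b))) ^ 4 * ∫ t in 0..1, u t ^ 2 := by
  have hI : 0 ≤ ∫ t in 0..1, u t ^ 2 :=
    intervalIntegral.integral_nonneg zero_le_one fun _ _ => sq_nonneg _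
  wlog hab : a ≤ b generalizing a b
  · rw [abs_sub_comm, mul_comm (a * (1 - a))]
    exact this hb ha (le_of_not_ge hab)
  refine (abs_lgInvariant_sub_le hcu hu hu₁ ha.1 hab hb.2).trans ?_
  have h1 := ha.1
  have h2 : 0 < 1 - a := by linarith [ha.2]
  have h3 := hb.1
  have h4 : 0 < 1 - b := by linarith [hb.2]
  have h5 : 0 < a * (1 - a) * (b * (1 - b)) := by positivity
  refine mul_le_mul_of_nonneg_right (div_le_div_of_nonneg_left (by positivity) (by positivity)
    (pow_le_pow_left₀ h5.le ?_ 4)) hI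
  calc a * (1 - a) * (b * (1 - b)) = a * (1 - b) * ((1 - a) * b) := by ring
    _ ≤ a * (1 - b) * 1 := by
      gcongr
      exact mul_le_one₀ (by linarith) h3.le hb.2.le
    _ = _ := mul_one _

/-- The invariant is determined, up to a relative error of order `ν⁻²`, by an integral of `u²`. -/
lemma abs_lgInvariant_mul_sub_le (hcu : Continuous u) (hcz : Continuous fun y => y * u₁ y)
    (hu : ∀ y > 0, HasDerivAt u (u₁ y) y)
    (hu₁ : ∀ y > 0, HasDerivAt u₁ (-(4 * ν ^ 2 * (1 / y - 1) + c / y ^ 2) * u y) y)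
    {δ a : ℝ} (hδ : 0 < δ) (ha : a ∈ Set.Icc δ (1 - δ)) :
    |lgInvariant ν c u u₁ a * (∫ y in 0..1, lgWeight y) -
        8 * ν ^ 2 * ∫ y in 0..1, y ^ 5 * (1 - y) ^ 7 * u y ^ 2| ≤
      ((3 * |c| + 2) / δ ^ 8 + (2 * |c| + 40)) * ∫ y in 0..1, u y ^ 2 := by
  set I := ∫ y in 0..1, u y ^ 2
  have hI : 0 ≤ I := intervalIntegral.integral_nonneg zero_le_one fun _ _ => sq_nonneg _
  have ha' : a ∈ Set.Ioo (0 : ℝ) 1 := ⟨hδ.trans_le ha.1, by linarith [ha.2]⟩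
  have hwa : δ ^ 2 ≤ a * (1 - a) := by
    rw [sq]
    have := ha.1
    have := ha.2
    gcongr <;> linarith
  have hcd : Continuous (lgDensity ν c u u₁) := by
    unfold lgDensity; fun_prop
  have h1 : |(∫ y in 0..1, lgDensity ν c u u₁ y) -
      lgInvariant ν c u u₁ a * (∫ y in 0..1, lgWeight y)| ≤ (3 * |c| + 2) / δ ^ 8 * I := by
    rw [← intervalIntegral.integral_const_mul, ← intervalIntegral.integral_sub
      (hcd.intervalIntegrable _ _) ((continuous_lgWeight.const_mul _).intervalIntegrable _ _)]
    have := intervalIntegral.norm_integral_le_of_norm_le_const (a := 0) (b := 1)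
      (C := (3 * |c| + 2) / δ ^ 8 * I)
      (f := fun y => lgDensity ν c u u₁ y - lgInvariant ν c u u₁ a * lgWeight y) ?_
    · simpa using this
    · intro y hy
      rw [Set.uIoc_of_le zero_le_one] at hy
      rcases hy.2.eq_or_lt with h | h
      · subst h
        simp only [lgDensity, lgWeight]
        norm_num
        positivity
      · have hy' : y ∈ Set.Ioo (0 : ℝ) 1 := ⟨hy.1, h⟩
        obtain ⟨k0, k1⟩ := lgWeight_le hy'
        have h2 : 0 < 1 - y := by linarith
        have h3 := hy.1
        rw [← lgWeight_mul_lgInvariant hy', mul_comm _ (lgWeight y), ← mul_sub, norm_mul,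
          norm_eq_abs, norm_eq_abs, abs_of_nonneg k0]
        calc _ ≤ (y * (1 - y)) ^ 4 *
            ((3 * |c| + 2) / (δ ^ 2 * (y * (1 - y))) ^ 4 * I) := by
              refine mul_le_mul k1 ?_ (abs_nonneg _) (by positivity)
              refine (abs_lgInvariant_sub_le' hcu hu hu₁ ha' hy').trans ?_
              gcongr
          _ = _ := by field_simp
  have h2 : |(∫ y in 0..1, lgDensity ν c u u₁ y) -
      8 * ν ^ 2 * ∫ y in 0..1, y ^ 5 * (1 - y) ^ 7 * u y ^ 2| ≤ (2 * |c| + 40) * I := by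
    have hc2 : Continuous fun y => lgRemainder c y * u y ^ 2 := by
      unfold lgRemainder; fun_prop
    have e : (∫ y in 0..1, lgDensity ν c u u₁ y) -
      8 * ν ^ 2 * (∫ y in 0..1, y ^ 5 * (1 - y) ^ 7 * u y ^ 2) =
        ∫ y in 0..1, lgRemainder c y * u y ^ 2 := by
      rw [integral_lgDensity hcu hcz hu hu₁, ← intervalIntegral.integral_const_mul,
        ← intervalIntegral.integral_sub]
      · refine intervalIntegral.integral_congr fun y _ => ?_
        ring
      · refine Continuous.intervalIntegrable ?_ _ _
        unfold lgRemainder; fun_prop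
      · exact Continuous.intervalIntegrable (by fun_prop) _ _
    rw [e, ← intervalIntegral.integral_const_mul]
    rw [← norm_eq_abs]
    refine intervalIntegral.norm_integral_le_of_norm_le (μ := volume)
      (g := fun y => (2 * |c| + 40) * u y ^ 2) zero_le_one
      (Filter.Eventually.of_forall fun y hy => ?_)
      (Continuous.intervalIntegrable (by fun_prop) _ _)
    rw [norm_mul, norm_eq_abs, norm_eq_abs, abs_of_nonneg (sq_nonneg (u y))]
    gcongr
    exact abs_lgRemainder_le ⟨hy.1.le, hy.2⟩
  rw [abs_le] at *
  constructor <;> linarith [h1.1, h1.2, h2.1, h2.2]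

end Amplitude
section LaguerreFunction

open Real Polynomial Filter Topology

variable {α : ℝ}

/-- The monic Laguerre polynomials, scaled so that the zeros of the `n`-th one fill `(0, 1)`. -/
noncomputable def lgPoly (α : ℝ) (n : ℕ) : ℝ[X] := monicLaguerre α (4 * laguerreNu α n) n

/-- The Laguerre function in Liouville–Green normal form. -/
noncomputable def lgFun (α : ℝ) (n : ℕ) (y : ℝ) : ℝ :=
  y ^ ((α + 1) / 2) * exp (-(2 * laguerreNu α n * y)) * (lgPoly α n).eval y

/-- The derivative of `lgFun`. -/
noncomputable def lgFunDeriv (α : ℝ) (n : ℕ) (y : ℝ) : ℝ :=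
  y ^ ((α + 1) / 2) * exp (-(2 * laguerreNu α n * y)) *
    ((derivative (lgPoly α n)).eval y + ((α + 1) / 2 / y - 2 * laguerreNu α n) * (lgPoly α n).eval y)

lemma continuous_lgFun (hα : -1 < α) (n : ℕ) : Continuous (lgFun α n) := by
  have h : Continuous fun y : ℝ => y ^ ((α + 1) / 2) :=
    Real.continuous_rpow_const (by linarith)
  unfold lgFun
  fun_prop

lemma continuous_mul_lgFunDeriv (hα : -1 < α) (n : ℕ) :
    Continuous fun y => y * lgFunDeriv α n y := by
  have h : Continuous fun y : ℝ => y ^ ((α + 1) / 2) :=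
    Real.continuous_rpow_const (by linarith)
  have e : (fun y => y * lgFunDeriv α n y) = fun y =>
      y ^ ((α + 1) / 2) * exp (-(2 * laguerreNu α n * y)) *
        (y * (derivative (lgPoly α n)).eval y +
          ((α + 1) / 2 - 2 * laguerreNu α n * y) * (lgPoly α n).eval y) := by
    funext y
    rcases eq_or_ne y 0 with rfl | hy
    · rw [Real.zero_rpow (by linarith)]; simp
    · unfold lgFunDeriv; field_simp
  rw [e]
  fun_prop

lemma hasDerivAt_lgFun_aux (ν A : ℝ) {y : ℝ} (hy : 0 < y) :
    HasDerivAt (fun y : ℝ => y ^ A * exp (-(2 * ν * y)))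
      (y ^ A * exp (-(2 * ν * y)) * (A / y - 2 * ν)) y := by
  have h1 := hasDerivAt_rpow_const (x := y) (p := A) (Or.inl hy.ne')
  have h2 := (((hasDerivAt_id y).const_mul (2 * ν)).neg).exp
  refine (h1.mul h2).congr_deriv ?_
  rw [rpow_sub_one hy.ne']
  simp only [id, mul_one, Pi.neg_apply]
  field_simp
  ring

lemma hasDerivAt_lgFun (n : ℕ) {y : ℝ} (hy : 0 < y) :
    HasDerivAt (lgFun α n) (lgFunDeriv α n y) y := by
  refine ((hasDerivAt_lgFun_aux (laguerreNu α n) ((α + 1) / 2) hy).mul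
    ((lgPoly α n).hasDerivAt y)).congr_deriv ?_
  unfold lgFunDeriv
  ring

lemma hasDerivAt_lgFunDeriv (hα : -1 < α) (n : ℕ) {y : ℝ} (hy : 0 < y) :
    HasDerivAt (lgFunDeriv α n)
      (-(4 * laguerreNu α n ^ 2 * (1 / y - 1) + (1 - α ^ 2) / 4 / y ^ 2) * lgFun α n y) y := by
  have hode := congrArg (eval y) (monicLaguerre_ode (α := α)
    (mul_pos four_pos (laguerreNu_pos hα n)) n)
  change eval y (X * derivative (derivative (lgPoly α n)) +
      (C (α + 1) - C (4 * laguerreNu α n) * X) * derivative (lgPoly α n) +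
      C (4 * laguerreNu α n * n) * lgPoly α n) = eval y 0 at hode
  simp only [eval_add, eval_mul, eval_sub, eval_X, eval_C, eval_zero] at hode
  have hA := ((hasDerivAt_inv hy.ne').const_mul ((α + 1) / 2)).sub_const (2 * laguerreNu α n)
  refine ((hasDerivAt_lgFun_aux (laguerreNu α n) ((α + 1) / 2) hy).mul
    (((derivative (lgPoly α n)).hasDerivAt y).add
      (hA.mul ((lgPoly α n).hasDerivAt y)))).congr_deriv ?_
  have e : (derivative (derivative (lgPoly α n))).eval y = -((α + 1 - 4 * laguerreNu α n * y) *
      (derivative (lgPoly α n)).eval y + 4 * laguerreNu α n * n * (lgPoly α n).eval y) / y := by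
    field_simp
    linear_combination hode
  have hn : (n : ℝ) = laguerreNu α n - (α + 1) / 2 := by unfold laguerreNu; ring
  unfold lgFun
  simp only [Pi.add_apply, Pi.mul_apply]
  rw [e, hn]
  field_simp
  ring

/-- The polynomial factor of `y * lgFunDeriv α n y`. -/
noncomputable def lgPolyDeriv (α : ℝ) (n : ℕ) : ℝ[X] :=
  X * derivative (lgPoly α n) + (C ((α + 1) / 2) - C (2 * laguerreNu α n) * X) * lgPoly α n

lemma lgFun_products (n : ℕ) {y : ℝ} (hy : 0 < y) :
    lgFun α n y ^ 2 =
      y * (lgPoly α n).eval y ^ 2 * (y ^ α * exp (-(4 * laguerreNu α n) * y)) ∧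
    lgFun α n y * lgFunDeriv α n y = (lgPoly α n).eval y * (lgPolyDeriv α n).eval y *
      (y ^ α * exp (-(4 * laguerreNu α n) * y)) ∧
    lgFunDeriv α n y ^ 2 = (lgPolyDeriv α n).eval y ^ 2 / y *
      (y ^ α * exp (-(4 * laguerreNu α n) * y)) := by
  have h1 : (y ^ ((α + 1) / 2)) ^ 2 = y ^ α * y := by
    rw [← rpow_natCast, ← rpow_mul hy.le, ← rpow_add_one hy.ne']
    congr 1; push_cast; ring
  have h2 : exp (-(2 * laguerreNu α n * y)) ^ 2 = exp (-(4 * laguerreNu α n) * y) := by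
    rw [← exp_nat_mul]; congr 1; push_cast; ring
  have h3 : lgFunDeriv α n y = y ^ ((α + 1) / 2) * exp (-(2 * laguerreNu α n * y)) *
      ((lgPolyDeriv α n).eval y / y) := by
    simp only [lgPolyDeriv, eval_add, eval_mul, eval_sub, eval_X, eval_C]
    unfold lgFunDeriv
    field_simp
  rw [h3, lgFun, ← h2]
  generalize y ^ ((α + 1) / 2) = a at *
  generalize exp (-(2 * laguerreNu α n * y)) = b at *
  refine ⟨?_, ?_, ?_⟩
  · linear_combination (b ^ 2 * eval y (lgPoly α n) ^ 2) * h1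
  · field_simp
    linear_combination (b ^ 2 * eval y (lgPoly α n) * eval y (lgPolyDeriv α n)) * h1
  · field_simp
    linear_combination (b ^ 2 * eval y (lgPolyDeriv α n) ^ 2) * h1

lemma tendsto_eval_mul_laguerreWeight {β : ℝ} (hβ : 0 < β) (p : ℝ[X]) :
    Tendsto (fun y => p.eval y * (y ^ α * exp (-β * y))) atTop (𝓝 0) := by
  have h : Tendsto (fun y : ℝ => ∑ k ∈ range (p.natDegree + 1),
      p.coeff k * (y ^ ((k : ℝ) + α) * exp (-β * y))) atTop
      (𝓝 (∑ k ∈ range (p.natDegree + 1), p.coeff k * 0)) :=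
    tendsto_finsetSum _ fun k _ =>
      (tendsto_rpow_mul_exp_neg_mul_atTop_nhds_zero _ β hβ).const_mul _
  simp only [mul_zero, Finset.sum_const_zero] at h
  refine h.congr' ?_
  filter_upwards [eventually_gt_atTop 0] with y hy
  rw [eval_eq_sum_range, Finset.sum_mul]
  refine Finset.sum_congr rfl fun k _ => ?_
  rw [rpow_add hy, rpow_natCast]
  ring

/-- A majorant for the remainder in the tail estimate. -/
noncomputable def lgTailPoly (α : ℝ) : ℝ[X] :=
  C (|(1 - α ^ 2) / 4|) * (X ^ 5 * (X - 1) ^ 6) +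
    C (1 / 2) * (X * (30 * (X * (X - 1)) ^ 4 * (2 * X - 1) ^ 2 + 12 * (X ^ 6 * (X - 1) ^ 4)))

lemma lgFun_tail (hα : -1 < α) (n : ℕ) :
    4 * laguerreNu α n ^ 2 * ∫ y in Set.Ioi 1, (X ^ 6 * (X - 1) ^ 7 * lgPoly α n ^ 2).eval y *
        (y ^ α * exp (-(4 * laguerreNu α n) * y)) ≤
      laguerreInt α (4 * laguerreNu α n) (lgTailPoly α * lgPoly α n ^ 2) := by
  have hβ : 0 < 4 * laguerreNu α n := mul_pos four_pos (laguerreNu_pos hα n)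
  set ν := laguerreNu α n
  set p := lgPoly α n
  set r := lgPolyDeriv α n
  set w : ℝ → ℝ := fun y => y ^ α * exp (-(4 * ν) * y)
  have hw : ∀ y, 0 < y → 0 < w y := fun y hy => mul_pos (rpow_pos_of_pos hy _) (exp_pos _)
  have h_int : ∀ q : ℝ[X], IntegrableOn (fun y => q.eval y * w y) (Set.Ioi 0) := fun q =>
    integrableOn_eval_mul_laguerreWeight hα hβ q
  have hint1 : ∀ q : ℝ[X], IntegrableOn (fun y => q.eval y * w y) (Set.Ioi 1) := fun q =>
    (h_int q).mono_set (Set.Ioi_subset_Ioi zero_le_one)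
  set h' : ℝ[X] := 6 * (X * (X - 1)) ^ 5 * (2 * X - 1)
  set h'' : ℝ[X] := 30 * (X * (X - 1)) ^ 4 * (2 * X - 1) ^ 2 + 12 * (X * (X - 1)) ^ 5
  set B' : ℝ[X] := X ^ 5 * (X - 1) ^ 6 * r ^ 2 + C (4 * ν ^ 2) * (X ^ 6 * (X - 1) ^ 7 * p ^ 2) -
    C ((1 - α ^ 2) / 4) * (X ^ 5 * (X - 1) ^ 6 * p ^ 2) - C (1 / 2) * (X * h'' * p ^ 2)
  set B : ℝ[X] := (X * (X - 1)) ^ 6 * (p * r) - C (1 / 2) * (X * h' * p ^ 2)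
  have hprod : ∀ y > 0, lgFun α n y ^ 2 = y * p.eval y ^ 2 * w y ∧
      lgFun α n y * lgFunDeriv α n y = p.eval y * r.eval y * w y ∧
      lgFunDeriv α n y ^ 2 = r.eval y ^ 2 / y * w y := fun y hy => lgFun_products n hy
  have hder : ∀ y > 0, HasDerivAt (fun y => (y * (y - 1)) ^ 6 * (lgFun α n y * lgFunDeriv α n y) -
      1 / 2 * (6 * (y * (y - 1)) ^ 5 * (2 * y - 1) * lgFun α n y ^ 2)) (B'.eval y * w y) y := by
    intro y hy
    have du := hasDerivAt_lgFun (α := α) n hy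
    have du₁ := hasDerivAt_lgFunDeriv hα n hy
    have d1 : HasDerivAt (fun y : ℝ => y * (y - 1)) (2 * y - 1) y := by
      refine ((hasDerivAt_id y).mul ((hasDerivAt_id y).sub_const 1)).congr_deriv ?_
      simp; ring
    have d2 : HasDerivAt (fun y : ℝ => 2 * y - 1) 2 y :=
      (((hasDerivAt_id y).const_mul 2).sub_const 1).congr_deriv (by simp)
    refine (((d1.pow 6).mul (du.mul du₁)).sub
      (((((d1.pow 5).const_mul 6).mul d2).mul (du.pow 2)).const_mul (1 / 2))).congr_deriv ?_
    obtain ⟨e1, e2, e3⟩ := hprod y hy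
    have e : B'.eval y * w y = (y * (y - 1)) ^ 6 * lgFunDeriv α n y ^ 2 +
        ((4 * ν ^ 2 * y ^ 5 * (y - 1) ^ 7) - (1 - α ^ 2) / 4 * y ^ 4 * (y - 1) ^ 6 -
          1 / 2 * h''.eval y) * lgFun α n y ^ 2 := by
      rw [e1, e3]
      simp only [B', eval_add, eval_sub, eval_mul, eval_pow, eval_X, eval_C, eval_one]
      field_simp
      ring
    rw [e]
    simp only [h'', eval_add, eval_sub, eval_mul, eval_pow, eval_X, eval_one, eval_ofNat,
      Pi.mul_apply, Pi.pow_apply]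
    push_cast
    generalize lgFun α n y = U at *
    generalize lgFunDeriv α n y = U1 at *
    change _ = _
    field_simp
    ring
  have hB : ∀ y > 0, (y * (y - 1)) ^ 6 * (lgFun α n y * lgFunDeriv α n y) -
      1 / 2 * (6 * (y * (y - 1)) ^ 5 * (2 * y - 1) * lgFun α n y ^ 2) = B.eval y * w y := by
    intro y hy
    obtain ⟨e1, e2, e3⟩ := hprod y hy
    rw [e1, e2]
    simp only [B, h', eval_sub, eval_mul, eval_pow, eval_X, eval_one, eval_ofNat, eval_C]
    ring
  have hzero : ∫ y in Set.Ioi 1, B'.eval y * w y = 0 := by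
    have := integral_Ioi_of_hasDerivAt_of_tendsto' (a := 1) (m := 0)
      (fun y hy => hder y (zero_lt_one.trans_le hy)) (hint1 B')
      ((tendsto_eval_mul_laguerreWeight (α := α) hβ B).congr' ?_)
    · rw [this]; norm_num
    · filter_upwards [eventually_gt_atTop 0] with y hy
      exact (hB y hy).symm
  have hle : ∫ y in Set.Ioi 1, (C (4 * ν ^ 2) * (X ^ 6 * (X - 1) ^ 7 * p ^ 2) -
      lgTailPoly α * p ^ 2).eval y * w y ≤ ∫ y in Set.Ioi 1, B'.eval y * w y := by
    refine setIntegral_mono_on (hint1 _) (hint1 _) measurableSet_Ioi fun y hy => ?_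
    have hy1 : 0 < y - 1 := sub_pos.2 hy
    have hy0 : 0 < y := by linarith
    refine mul_le_mul_of_nonneg_right ?_ (hw y hy0).le
    simp only [B', h'', lgTailPoly, eval_add, eval_sub, eval_mul, eval_pow, eval_X, eval_one,
      eval_ofNat, eval_C]
    have k1 : 0 ≤ y ^ 5 * (y - 1) ^ 6 * eval y r ^ 2 := by positivity
    have k2 : (1 - α ^ 2) / 4 * (y ^ 5 * (y - 1) ^ 6 * eval y p ^ 2) ≤
        |(1 - α ^ 2) / 4| * (y ^ 5 * (y - 1) ^ 6 * eval y p ^ 2) := by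
      gcongr
      exact le_abs_self _
    have k3 : y * (12 * (y * (y - 1)) ^ 5) * eval y p ^ 2 ≤
        y * (12 * (y ^ 6 * (y - 1) ^ 4)) * eval y p ^ 2 := by
      gcongr
      calc (y * (y - 1)) ^ 5 = y ^ 5 * (y - 1) ^ 4 * (y - 1) := by ring
        _ ≤ y ^ 5 * (y - 1) ^ 4 * y := by gcongr; linarith
        _ = _ := by ring
    linarith
  rw [hzero] at hle
  have e : ∀ q₁ q₂ : ℝ[X], ∀ a : ℝ, ∫ y in Set.Ioi 1, (C a * q₁ - q₂).eval y * w y =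
      a * (∫ y in Set.Ioi 1, q₁.eval y * w y) - ∫ y in Set.Ioi 1, q₂.eval y * w y := by
    intro q₁ q₂ a
    rw [← integral_const_mul, ← integral_sub ((hint1 q₁).const_mul a) (hint1 q₂)]
    refine integral_congr_ae (Eventually.of_forall fun y => ?_)
    simp only [eval_sub, eval_mul, eval_C]
    ring
  rw [e] at hle
  have hT : ∫ y in Set.Ioi 1, (lgTailPoly α * p ^ 2).eval y * w y ≤
      laguerreInt α (4 * ν) (lgTailPoly α * p ^ 2) := by
    rw [laguerreInt_eq_integral hα hβ]
    refine setIntegral_mono_set (h_int _) ?_ (Set.Ioi_subset_Ioi zero_le_one).eventuallyLE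
    refine (ae_restrict_iff' measurableSet_Ioi).2 (Eventually.of_forall fun y hy => ?_)
    have hy0 : 0 < y := hy
    refine mul_nonneg ?_ (hw y hy0).le
    simp only [lgTailPoly, eval_add, eval_sub, eval_mul, eval_pow, eval_X, eval_one,
      eval_ofNat, eval_C]
    have : 0 ≤ (y - 1) ^ 4 := by positivity
    have : 0 ≤ (y - 1) ^ 6 := by positivity
    positivity
  linarith

end LaguerreFunction
section LaguerreAmplitude

open Real Polynomial Filter Topology

variable {α : ℝ}

lemma integral_lgWeight :
    ∫ y in 0..1, lgWeight y =
      -∫ θ in 0..π, (X ^ 6 * (X - 1) ^ 7 : ℝ[X]).eval ((1 + cos θ) / 2) := by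
  have h := intervalIntegral.integral_comp_mul_deriv (a := 0) (b := π)
    (f := fun θ => (1 + cos θ) / 2) (f' := fun θ => -sin θ / 2) (g := lgWeight)
    (fun θ _ => ((hasDerivAt_cos θ).const_add 1).div_const 2)
    (Continuous.continuousOn (by fun_prop)) continuous_lgWeight
  simp only [cos_zero, cos_pi] at h
  norm_num at h
  rw [intervalIntegral.integral_symm, ← h, neg_inj]
  refine intervalIntegral.integral_congr fun θ hθ => ?_
  rw [Set.uIcc_of_le pi_pos.le] at hθ
  have hs := sin_nonneg_of_mem_Icc hθ
  have e : (1 + cos θ) / 2 * (1 - (1 + cos θ) / 2) = (sin θ / 2) ^ 2 := by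
    have := sin_sq_add_cos_sq θ
    linear_combination (-1 / 4) * this
  have e2 : √((1 + cos θ) / 2 * (1 - (1 + cos θ) / 2)) = sin θ / 2 := by
    rw [e, sqrt_sq (by positivity)]
  simp only [lgWeight, eval_mul, eval_pow, eval_X, eval_sub, eval_one]
  rw [e2]
  generalize (1 + cos θ) / 2 = y at *
  linear_combination ((y * (1 - y)) ^ 5 * (1 - y)) * e

lemma integral_lgWeight_pos : 0 < ∫ y in 0..1, lgWeight y := by
  refine intervalIntegral.intervalIntegral_pos_of_pos_on
    (continuous_lgWeight.intervalIntegrable _ _) (fun y hy => ?_) one_pos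
  have h1 : 0 < y := hy.1
  have h2 : 0 < 1 - y := sub_pos.2 hy.2
  unfold lgWeight
  positivity

lemma integral_sq_lgFun_le (hα : -1 < α) (n : ℕ) :
    ∫ y in 0..1, lgFun α n y ^ 2 ≤
      laguerreInt α (4 * laguerreNu α n) (X * lgPoly α n ^ 2) := by
  have hβ : 0 < 4 * laguerreNu α n := mul_pos four_pos (laguerreNu_pos hα n)
  rw [laguerreInt_eq_integral hα hβ, intervalIntegral.integral_of_le zero_le_one]
  have e : Set.EqOn (fun y => lgFun α n y ^ 2) (fun y => (X * lgPoly α n ^ 2).eval y *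
      (y ^ α * exp (-(4 * laguerreNu α n) * y))) (Set.Ioi 0) := fun y hy => by
    simp only [(lgFun_products (α := α) n hy).1, eval_mul, eval_X, eval_pow]
  rw [setIntegral_congr_fun measurableSet_Ioc (e.mono Set.Ioc_subset_Ioi_self)]
  refine setIntegral_mono_set (integrableOn_eval_mul_laguerreWeight hα hβ _) ?_
    Set.Ioc_subset_Ioi_self.eventuallyLE
  refine (ae_restrict_iff' measurableSet_Ioi).2 (Eventually.of_forall fun y hy => ?_)
  rw [← e hy]
  exact sq_nonneg _

lemma integral_mul_sq_lgFun (hα : -1 < α) (n : ℕ) :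
    ∫ y in 0..1, y ^ 5 * (1 - y) ^ 7 * lgFun α n y ^ 2 =
      (∫ y in Set.Ioi 1, (X ^ 6 * (X - 1) ^ 7 * lgPoly α n ^ 2).eval y *
        (y ^ α * exp (-(4 * laguerreNu α n) * y))) -
      laguerreInt α (4 * laguerreNu α n) (X ^ 6 * (X - 1) ^ 7 * lgPoly α n ^ 2) := by
  have hβ : 0 < 4 * laguerreNu α n := mul_pos four_pos (laguerreNu_pos hα n)
  have h_int := integrableOn_eval_mul_laguerreWeight hα hβ (X ^ 6 * (X - 1) ^ 7 * lgPoly α n ^ 2)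
  rw [laguerreInt_eq_integral hα hβ, intervalIntegral.integral_of_le zero_le_one,
    ← Set.Ioc_union_Ioi_eq_Ioi (zero_le_one' ℝ),
    setIntegral_union Set.Ioc_disjoint_Ioi_same measurableSet_Ioi
      (h_int.mono_set Set.Ioc_subset_Ioi_self)
      (h_int.mono_set (Set.Ioi_subset_Ioi zero_le_one)), sub_add_cancel_right,
    ← integral_neg]
  refine setIntegral_congr_fun measurableSet_Ioc fun y hy => ?_
  simp only [(lgFun_products (α := α) n hy.1).1, eval_mul, eval_X, eval_pow, eval_sub, eval_one]
  ring

lemma lgFun_tail_nonneg (n : ℕ) :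
    0 ≤ ∫ y in Set.Ioi 1, (X ^ 6 * (X - 1) ^ 7 * lgPoly α n ^ 2).eval y *
        (y ^ α * exp (-(4 * laguerreNu α n) * y)) := by
  refine setIntegral_nonneg measurableSet_Ioi fun y hy => ?_
  have h1 : 0 < y - 1 := sub_pos.2 hy
  have h0 : 0 < y := by linarith
  simp only [eval_mul, eval_X, eval_pow, eval_sub, eval_one]
  positivity

/-- The limiting amplitude of the Laguerre functions in the bulk. -/
lemma firstOrderLimit_lgInvariant (hα : -1 < α) {δ : ℝ} (hδ : 0 < δ) {a : ℕ → ℝ}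
    (ha : ∀ᶠ n in atTop, a n ∈ Set.Icc δ (1 - δ)) :
    FirstOrderLimit (fun n => lgInvariant (laguerreNu α n) ((1 - α ^ 2) / 4) (lgFun α n)
      (lgFunDeriv α n) (a n) /
      (4 * laguerreNu α n ^ 2 * laguerreNorm α (4 * laguerreNu α n) n)) (2 / π) := by
  set c := (1 - α ^ 2) / 4
  set h : ℕ → ℝ := fun n => laguerreNorm α (4 * laguerreNu α n) n
  set F : ℝ[X] := X ^ 6 * (X - 1) ^ 7
  set Q := ∫ y in 0..1, lgWeight y
  set J : ℝ[X] → ℕ → ℝ := fun f n => laguerreInt α (4 * laguerreNu α n) (f * lgPoly α n ^ 2)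
  set G : ℕ → ℝ := fun n => lgInvariant (laguerreNu α n) c (lgFun α n) (lgFunDeriv α n) (a n)
  set K : ℝ := (3 * |c| + 2) / δ ^ 8 + (2 * |c| + 40)
  have hK : 0 ≤ K := by positivity
  have hh : ∀ n, 0 < h n := fun n =>
    laguerreNorm_pos hα (mul_pos four_pos (laguerreNu_pos hα n)) n
  have hJ : ∀ f : ℝ[X], FirstOrderLimit (fun n => J f n / h n)
    (1 / π * ∫ θ in 0..π, f.eval ((1 + cos θ) / 2)) := fun f => firstOrderLimit_laguerreInt hα f
  have hQ : 1 / π * ∫ θ in 0..π, F.eval ((1 + cos θ) / 2) = -(Q / π) := by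
    rw [eq_neg_iff_add_eq_zero, show Q = _ from integral_lgWeight]
    ring
  have key : ∀ᶠ n in atTop, |G n * Q + 2 * (4 * laguerreNu α n ^ 2) * J F n| ≤
      2 * J (lgTailPoly α) n + K * J X n := by
    filter_upwards [ha] with n hn
    have h1 := abs_lgInvariant_mul_sub_le (ν := laguerreNu α n) (c := c) (continuous_lgFun hα n)
      (continuous_mul_lgFunDeriv hα n) (fun y hy => hasDerivAt_lgFun n hy)
      (fun y hy => hasDerivAt_lgFunDeriv hα n hy) hδ hn
    have h2 := mul_le_mul_of_nonneg_left (integral_sq_lgFun_le hα n) hK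
    have h3 := lgFun_tail hα n
    have h4 := lgFun_tail_nonneg (α := α) n
    rw [integral_mul_sq_lgFun hα n] at h1
    set T := ∫ y in Set.Ioi 1, (F * lgPoly α n ^ 2).eval y *
        (y ^ α * exp (-(4 * laguerreNu α n) * y))
    have h5 : 0 ≤ 4 * laguerreNu α n ^ 2 * T := by positivity
    have e : G n * Q + 2 * (4 * laguerreNu α n ^ 2) * J F n =
        (G n * Q - 8 * laguerreNu α n ^ 2 * (T - J F n)) +
          2 * (4 * laguerreNu α n ^ 2 * T) := by ring
    rw [e]
    refine (abs_add_le _ _).trans ?_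
    rw [abs_of_nonneg (mul_nonneg zero_le_two h5)]
    change |G n * Q - 8 * laguerreNu α n ^ 2 * (T - J F n)| ≤ _ at h1
    change _ ≤ K * J X n at h2
    change _ ≤ J (lgTailPoly α) n at h3
    linarith
  have hbd : FirstOrderLimit (fun n => G n * Q / (4 * laguerreNu α n ^ 2 * h n) +
      2 * (J F n / h n)) 0 := by
    obtain ⟨B, hB⟩ := ((((hJ (lgTailPoly α)).const_mul 2).add
      ((hJ X).const_mul K)).isBigO_one).bound
    refine FirstOrderLimit.of_abs_le (C := B) ?_
    filter_upwards [key, hB, eventually_ge_atTop 1] with n h1 h2 hn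
    have hν := laguerreNu_pos hα n
    have hn1 : (1 : ℝ) ≤ n := by exact_mod_cast hn
    have hνn : (n : ℝ) ≤ 4 * laguerreNu α n ^ 2 := by
      have : (n : ℝ) ≤ laguerreNu α n := by unfold laguerreNu; linarith
      nlinarith
    have e : G n * Q / (4 * laguerreNu α n ^ 2 * h n) + 2 * (J F n / h n) - 0 =
        (G n * Q + 2 * (4 * laguerreNu α n ^ 2) * J F n) / h n / (4 * laguerreNu α n ^ 2) := by
      have := (hh n).ne'
      field_simp
      ring
    rw [e, abs_div, abs_div, abs_of_pos (hh n),
      abs_of_pos (show 0 < 4 * laguerreNu α n ^ 2 by positivity)]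
    have h3 : |G n * Q + 2 * (4 * laguerreNu α n ^ 2) * J F n| / h n ≤ B := by
      refine (div_le_div_of_nonneg_right h1 (hh n).le).trans ?_
      refine le_trans (le_of_eq ?_) ((le_norm_self _).trans (h2.trans (by simp)))
      ring
    have hB0 : 0 ≤ B := le_trans (by have := hh n; positivity) h3
    exact div_le_div₀ hB0 h3 (by linarith) hνn
  have hQ0 : 0 < Q := integral_lgWeight_pos
  refine (((hbd.sub ((hJ F).const_mul 2)).const_mul Q⁻¹).congr'
    (Eventually.of_forall fun n => ?_)).congr_limit ?_
  · beta_reduce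
    change _ = G n / (4 * laguerreNu α n ^ 2 * h n)
    field_simp
    ring
  · rw [hQ]
    field_simp
    ring

end LaguerreAmplitude
namespace FirstOrderLimit

open Filter Asymptotics Topology

lemma sqrt {f : ℕ → ℝ} {L : ℝ} (hf : FirstOrderLimit f L) (hL : 0 < L) :
    FirstOrderLimit (fun N => √(f N)) √L := by
  have h0 := Real.sqrt_pos.2 hL
  refine IsBigO.trans (IsBigO.of_bound (√L)⁻¹ ?_) hf
  filter_upwards [hf.tendsto.eventually_const_lt hL] with N hN
  have e : (√(f N) - √L) * (√(f N) + √L) = f N - L := by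
    have h1 := Real.sq_sqrt hN.le
    have h2 := Real.sq_sqrt hL.le
    linear_combination h1 - h2
  rw [Real.norm_eq_abs, Real.norm_eq_abs, ← e, abs_mul, mul_comm, mul_assoc]
  refine le_mul_of_one_le_right (abs_nonneg _) ?_
  rw [← div_eq_mul_inv, one_le_div h0, abs_of_nonneg (by positivity)]
  linarith [Real.sqrt_nonneg (f N)]

/-- Boundedness of the arguments of an asymptotically definite quadratic form. -/
lemma isBigO_of_quadratic {a b d X Y : ℕ → ℝ} {a₀ d₀ L : ℝ} (ha : FirstOrderLimit a a₀)
    (hb : FirstOrderLimit b 0) (hd : FirstOrderLimit d d₀) (ha₀ : 0 < a₀) (hd₀ : 0 < d₀)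
    (h : FirstOrderLimit (fun N => a N * X N ^ 2 + b N * (X N * Y N) + d N * Y N ^ 2) L) :
    X =O[atTop] (fun _ => (1 : ℝ)) ∧ Y =O[atTop] (fun _ => (1 : ℝ)) := by
  set e := min a₀ d₀
  have he : 0 < e := lt_min ha₀ hd₀
  have key : ∀ᶠ N in atTop, e / 4 * (X N ^ 2 + Y N ^ 2) ≤ |L| + 1 := by
    filter_upwards [ha.tendsto.eventually_const_lt (show e / 2 < a₀ by
        have := min_le_left a₀ d₀; linarith),
      hd.tendsto.eventually_const_lt (show e / 2 < d₀ by
        have := min_le_right a₀ d₀; linarith),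
      hb.tendsto.eventually_lt_const (show 0 < e / 2 by linarith),
      hb.tendsto.eventually_const_lt (show -(e / 2) < 0 by linarith),
      h.tendsto.eventually_lt_const (show L < |L| + 1 by
        have := le_abs_self L; linarith)] with N h1 h2 h3 h4 h5
    nlinarith [mul_nonneg (sub_nonneg.2 h1.le) (sq_nonneg (X N)),
      mul_nonneg (sub_nonneg.2 h2.le) (sq_nonneg (Y N)),
      mul_nonneg (sub_nonneg.2 h3.le) (sq_nonneg (X N - Y N)),
      mul_nonneg (sub_nonneg.2 h4.le) (sq_nonneg (X N + Y N))]
  have hsq : ∀ x y : ℝ, e / 4 * (x ^ 2 + y ^ 2) ≤ |L| + 1 → |x| ≤ √((|L| + 1) / (e / 4)) := by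
    intro x y hxy
    refine Real.abs_le_sqrt ?_
    rw [le_div_iff₀ (by positivity)]
    nlinarith [sq_nonneg y]
  refine ⟨IsBigO.of_bound (√((|L| + 1) / (e / 4))) (key.mono fun N hN => ?_),
    IsBigO.of_bound (√((|L| + 1) / (e / 4))) (key.mono fun N hN => ?_)⟩
  · rw [norm_one, mul_one]
    exact hsq (X N) (Y N) hN
  · rw [norm_one, mul_one]
    exact hsq (Y N) (X N) (by rw [add_comm]; exact hN)

lemma quadratic {a b d X Y : ℕ → ℝ} {a₀ d₀ L : ℝ} (ha : FirstOrderLimit a a₀)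
    (hb : FirstOrderLimit b 0) (hd : FirstOrderLimit d d₀) (ha₀ : 0 < a₀) (hd₀ : 0 < d₀)
    (h : FirstOrderLimit (fun N => a N * X N ^ 2 + b N * (X N * Y N) + d N * Y N ^ 2) L) :
    FirstOrderLimit (fun N => a₀ * X N ^ 2 + d₀ * Y N ^ 2) L := by
  obtain ⟨hX, hY⟩ := isBigO_of_quadratic ha hb hd ha₀ hd₀ h
  have hXX : (fun N => X N ^ 2) =O[atTop] (fun _ => (1 : ℝ)) := by simpa using hX.pow 2
  have hYY : (fun N => Y N ^ 2) =O[atTop] (fun _ => (1 : ℝ)) := by simpa using hY.pow 2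
  have hXY : (fun N => X N * Y N) =O[atTop] (fun _ => (1 : ℝ)) := by simpa using hX.mul hY
  have h1 := bdd_mul hXX ((ha.sub (const a₀)).congr_limit (sub_self _))
  have h2 := bdd_mul hYY ((hd.sub (const d₀)).congr_limit (sub_self _))
  have h3 := bdd_mul hXY hb
  refine ((((h.sub h1).sub h2).sub h3).congr' (Eventually.of_forall fun N => ?_)).congr_limit ?_
  · beta_reduce; ring
  · ring

end FirstOrderLimit

section JetCoefficients

open Polynomial

/-- The coefficient of `s ^ a` in `exp (-2 s) * p (x + s / N)`. -/
noncomputable def jetCoeff (N x : ℝ) : ℕ → ℝ[X] →ₗ[ℝ] ℝ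
  | 0 => leval x
  | a + 1 => ((a : ℝ) + 1)⁻¹ • (N⁻¹ • (jetCoeff N x a ∘ₗ derivative) - (2 : ℝ) • jetCoeff N x a)

variable {N x : ℝ}

lemma jetCoeff_zero (p : ℝ[X]) : jetCoeff N x 0 p = p.eval x := rfl

lemma jetCoeff_succ (a : ℕ) (p : ℝ[X]) : jetCoeff N x (a + 1) p =
    ((a : ℝ) + 1)⁻¹ * (N⁻¹ * jetCoeff N x a (derivative p) - 2 * jetCoeff N x a p) := by
  simp [jetCoeff]

lemma jetCoeff_derivative (hN : N ≠ 0) (a : ℕ) (p : ℝ[X]) : jetCoeff N x a (derivative p) =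
    N * ((a + 1) * jetCoeff N x (a + 1) p + 2 * jetCoeff N x a p) := by
  have : (a : ℝ) + 1 ≠ 0 := by positivity
  rw [jetCoeff_succ]
  field_simp
  ring

lemma jetCoeff_X_mul_zero (p : ℝ[X]) : jetCoeff N x 0 (X * p) = x * jetCoeff N x 0 p := by
  simp [jetCoeff_zero]

lemma jetCoeff_X_mul_succ (a : ℕ) (p : ℝ[X]) : jetCoeff N x (a + 1) (X * p) =
    x * jetCoeff N x (a + 1) p + jetCoeff N x a p / N := by
  induction a generalizing p with
  | zero =>
    simp only [jetCoeff_succ, jetCoeff_zero, derivative_mul, derivative_X, eval_add, eval_mul,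
      eval_X, one_mul]
    push_cast
    ring
  | succ a ih =>
    have : (a : ℝ) + 1 ≠ 0 := by positivity
    have : (a : ℝ) + 1 + 1 ≠ 0 := by positivity
    rw [jetCoeff_succ (a + 1), derivative_mul, derivative_X, one_mul, map_add, ih, ih,
      jetCoeff_succ (a + 1)]
    have e : N⁻¹ * jetCoeff N x a (derivative p) =
        (a + 1) * jetCoeff N x (a + 1) p + 2 * jetCoeff N x a p := by
      rw [jetCoeff_succ]; field_simp; ring
    push_cast
    linear_combination (a + 1 + 1 : ℝ)⁻¹ * N⁻¹ * e +
      (N⁻¹ * jetCoeff N x (a + 1) p) * (inv_mul_cancel₀ this)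

end JetCoefficients

section LocalAmplitude

open Real Polynomial Filter Topology

variable {α x : ℝ}

/-- The normalised local Taylor coefficients of the `(N + k)`-th Laguerre polynomial. -/
noncomputable def laguerreJet (α x : ℝ) (k a N : ℕ) : ℝ :=
  √(x ^ α * exp (-(4 * N) * x) / laguerreNorm α (4 * N) (N + k)) *
    jetCoeff N x a (monicLaguerre α (4 * N) (N + k))

/-- The local wave number of the Laguerre polynomials, `π` times the eigenvalue density. -/
noncomputable def waveNumber (x : ℝ) : ℝ := 2 * √(1 / x - 1)

lemma laguerreJet_mul (hx : 0 < x) (hα : -1 < α) {N : ℕ} (hN : 0 < N) (k a b : ℕ) :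
    laguerreJet α x k a N * laguerreJet α x k b N =
      x ^ α * exp (-(4 * N) * x) / laguerreNorm α (4 * N) (N + k) *
        (jetCoeff N x a (monicLaguerre α (4 * N) (N + k)) *
          jetCoeff N x b (monicLaguerre α (4 * N) (N + k))) := by
  have : 0 < laguerreNorm α (4 * N) (N + k) := laguerreNorm_pos hα (by positivity) _
  unfold laguerreJet
  rw [mul_mul_mul_comm, mul_self_sqrt (by positivity)]

lemma lgInvariant_eq_laguerreJet (hα : -1 < α) (hx : 0 < x) (k : ℕ) {N : ℕ} (hN : 0 < N) :
    let ν := laguerreNu α (N + k)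
    let y := N * x / ν
    let e := (α + 1) / (2 * y)
    let f := 1 / (2 * (y * (1 - y)))
    let c := (1 - α ^ 2) / 4
    lgInvariant ν c (lgFun α (N + k)) (lgFunDeriv α (N + k)) y /
      (4 * ν ^ 2 * laguerreNorm α (4 * ν) (N + k)) =
    √(y * (1 - y)) / (1 - y) * x * (1 / 4 * laguerreJet α x k 1 N ^ 2 +
      (2 * e - f) / (4 * ν) * (laguerreJet α x k 1 N * laguerreJet α x k 0 N) +
      ((1 / y - 1) + (e ^ 2 - e * f + c / y ^ 2 + (4 * y - 1) / (8 * (y * (1 - y)) ^ 2)) /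
        (4 * ν ^ 2)) * laguerreJet α x k 0 N ^ 2) := by
  intro ν y e f c
  have hν : 0 < ν := laguerreNu_pos hα _
  have hN' : (0 : ℝ) < N := by exact_mod_cast hN
  have hy : 0 < y := by positivity
  set n := N + k
  set t := ν / N
  have ht : 0 < t := by positivity
  have hβ : 4 * ν / t = 4 * N := by simp only [t]; field_simp
  have hty : t * y = x := by simp only [t, y]; field_simp
  have hnorm := laguerreNorm_scale hα (show 0 < 4 * ν by positivity) ht n
  have hev := monicLaguerre_eval_scale (α := α) (β := 4 * ν) ht.ne' n y
  have hdv := monicLaguerre_derivative_eval_scale (α := α) (β := 4 * ν) ht.ne' n y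
  rw [hβ] at hnorm hev hdv
  rw [hty] at hev hdv
  have hh : 0 < laguerreNorm α (4 * ν) n := laguerreNorm_pos hα (by positivity) n
  have htn : t ^ n ≠ 0 := by positivity
  set D := y ^ ((α + 1) / 2) * exp (-(2 * ν * y)) / t ^ n
  have hD : D ^ 2 / laguerreNorm α (4 * ν) n =
      x * (x ^ α * exp (-(4 * N) * x) / laguerreNorm α (4 * N) n) := by
    have h1 : (y ^ ((α + 1) / 2)) ^ 2 = y ^ (α + 1) := by
      rw [← rpow_natCast, ← rpow_mul hy.le]
      congr 1; push_cast; ring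
    have h2 : exp (-(2 * ν * y)) ^ 2 = exp (-(4 * N) * x) := by
      rw [← exp_nat_mul]; congr 1; push_cast; simp only [y]; field_simp; ring
    have h3 : x * x ^ α = t ^ (α + 1) * y ^ (α + 1) := by
      rw [← mul_rpow ht.le hy.le, hty, rpow_add_one hx.ne', mul_comm]
    have h4 : t ^ (2 * n) = (t ^ n) ^ 2 := by ring
    have h5 : t ^ (α + 1) ≠ 0 := by positivity
    rw [hnorm, ← mul_div_assoc, ← mul_assoc, h3, h4]
    simp only [D, div_pow, mul_pow]
    rw [h1, h2]
    field_simp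
  set A₀ := jetCoeff N x 0 (monicLaguerre α (4 * N) n)
  set A₁ := jetCoeff N x 1 (monicLaguerre α (4 * N) n)
  have hA₀ : t ^ n * (lgPoly α n).eval y = A₀ := hev.symm
  have hA₁ : t ^ n * (derivative (lgPoly α n)).eval y = ν * (A₁ + 2 * A₀) := by
    have h := jetCoeff_derivative (x := x) hN'.ne' 0 (monicLaguerre α (4 * N) n)
    rw [jetCoeff_zero] at h
    change t ^ n * (derivative (monicLaguerre α (4 * ν) n)).eval y = _
    rw [← hdv, h]
    simp only [t, A₀, A₁]
    push_cast
    field_simp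
    ring
  have hu : lgFun α n y = D * A₀ := by
    rw [← hA₀]
    simp only [lgFun, D]
    change _ * exp (-(2 * ν * y)) * _ = _
    field_simp
  have hu₁ : lgFunDeriv α n y = D * (ν * A₁ + e * A₀) := by
    have : ν * A₁ = t ^ n * (derivative (lgPoly α n)).eval y - 2 * ν * A₀ := by
      rw [hA₁]; ring
    rw [this, ← hA₀]
    simp only [lgFunDeriv, D, e]
    change _ * exp (-(2 * ν * y)) * (_ + (_ - 2 * ν) * _) = _
    field_simp
    ring
  have hJ := laguerreJet_mul hx hα hN k
  rw [sq (laguerreJet α x k 1 N), sq (laguerreJet α x k 0 N), hJ, hJ, hJ]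
  set W := x ^ α * exp (-(4 * N) * x) / laguerreNorm α (4 * N) n
  have hD' : D ^ 2 = x * W * laguerreNorm α (4 * ν) n := by
    rw [← hD]; field_simp
  have hlg : lgInvariant ν c (lgFun α n) (lgFunDeriv α n) y = √(y * (1 - y)) / (1 - y) *
      (D ^ 2 * ((ν * A₁ + e * A₀) ^ 2 - A₀ * (ν * A₁ + e * A₀) * f +
        (4 * ν ^ 2 * (1 / y - 1) + c / y ^ 2 + (4 * y - 1) / (8 * (y * (1 - y)) ^ 2)) *
          A₀ ^ 2)) := by
    simp only [lgInvariant, hu, hu₁, f]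
    ring
  rw [hlg, hD']
  generalize (4 * y - 1) / (8 * (y * (1 - y)) ^ 2) = r
  generalize √(y * (1 - y)) / (1 - y) = s
  generalize c / y ^ 2 = r'
  generalize 1 / y - 1 = r''
  change _ = s * x * (1 / 4 * (W * (A₁ * A₁)) + (2 * e - f) / (4 * ν) * (W * (A₁ * A₀)) +
    _ * (W * (A₀ * A₀)))
  field_simp
  ring

end LocalAmplitude
section LocalExpansion

open Real Polynomial Filter Topology Asymptotics

variable {α x : ℝ}

lemma sq_waveNumber (hx : x ∈ Set.Ioo (0 : ℝ) 1) : waveNumber x ^ 2 = 4 * (1 / x - 1) := by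
  have : 0 ≤ 1 / x - 1 := sub_nonneg.2 ((one_le_div hx.1).2 hx.2.le)
  rw [waveNumber, mul_pow, sq_sqrt this]
  norm_num

lemma waveNumber_pos (hx : x ∈ Set.Ioo (0 : ℝ) 1) : 0 < waveNumber x :=
  mul_pos two_pos (sqrt_pos.2 (sub_pos.2 ((one_lt_div hx.1).2 hx.2)))

lemma laguerreJet_zero_one (hα : -1 < α) (hx : x ∈ Set.Ioo (0 : ℝ) 1) (k : ℕ) :
    (laguerreJet α x k 1 =O[atTop] (fun _ => (1 : ℝ)) ∧
      laguerreJet α x k 0 =O[atTop] (fun _ => (1 : ℝ))) ∧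
    FirstOrderLimit (fun N => laguerreJet α x k 0 N ^ 2 +
      (laguerreJet α x k 1 N / waveNumber x) ^ 2) (4 / (π * waveNumber x * x)) := by
  obtain ⟨hx0, hx1⟩ := hx
  have hx1' : 0 < 1 - x := sub_pos.2 hx1
  have hxx : 0 < 1 / x - 1 := sub_pos.2 ((one_lt_div hx0).2 hx1)
  set ν : ℕ → ℝ := fun N => laguerreNu α (N + k)
  set y : ℕ → ℝ := fun N => N * x / ν N
  have hy : FirstOrderLimit y x := by
    refine ((FirstOrderLimit.affine_div_affine x 0 1 (k + (α + 1) / 2) one_ne_zero).congr'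
      (Eventually.of_forall fun N => ?_)).congr_limit (div_one x)
    simp only [y, ν, laguerreNu]
    push_cast
    ring
  have hν : FirstOrderLimit (fun N => 1 / ν N) 0 := by
    refine ((FirstOrderLimit.affine_div_affine 0 1 1 (k + (α + 1) / 2) one_ne_zero).congr'
      (Eventually.of_forall fun N => ?_)).congr_limit (by norm_num)
    simp only [ν, laguerreNu]
    push_cast
    ring
  have h1y : FirstOrderLimit (fun N => 1 - y N) (1 - x) := (FirstOrderLimit.const 1).sub hy
  have hyy := hy.mul h1y
  have hg := (hyy.sqrt (mul_pos hx0 hx1')).div h1y hx1'.ne'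
  have hg' := hg.mul (FirstOrderLimit.const x)
  have he := (FirstOrderLimit.const (α + 1)).div (hy.const_mul 2) (by positivity)
  have hf := (FirstOrderLimit.const 1).div (hyy.const_mul 2) (by positivity)
  have hiy := (FirstOrderLimit.const 1).div hy hx0.ne'
  have hc := (FirstOrderLimit.const ((1 - α ^ 2) / 4)).div (hy.pow 2) (by positivity)
  have hr := ((hy.const_mul 4).sub (FirstOrderLimit.const 1)).div ((hyy.pow 2).const_mul 8)
    (by positivity)
  set e : ℕ → ℝ := fun N => (α + 1) / (2 * y N)
  set f : ℕ → ℝ := fun N => 1 / (2 * (y N * (1 - y N)))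
  have hb : FirstOrderLimit (fun N => (2 * e N - f N) / (4 * ν N)) 0 := by
    refine (((((he.const_mul 2).sub hf).mul hν).const_mul (1 / 4)).congr'
      (Eventually.of_forall fun N => ?_)).congr_limit (by simp)
    beta_reduce
    ring
  have hd : FirstOrderLimit (fun N => (1 / y N - 1) + (e N ^ 2 - e N * f N +
      (1 - α ^ 2) / 4 / y N ^ 2 + (4 * y N - 1) / (8 * (y N * (1 - y N)) ^ 2)) / (4 * ν N ^ 2))
      (1 / x - 1) := by
    refine (((hiy.sub (FirstOrderLimit.const 1)).add
      (((((he.pow 2).sub (he.mul hf)).add hc).add hr).mul ((hν.pow 2).const_mul (1 / 4)))).congr'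
      (Eventually.of_forall fun N => ?_)).congr_limit (by simp)
    beta_reduce
    ring
  have hmem : ∀ᶠ n : ℕ in atTop, ((n : ℝ) - k) * x / laguerreNu α n ∈
      Set.Icc (min x (1 - x) / 2) (1 - min x (1 - x) / 2) := by
    have h : FirstOrderLimit (fun n : ℕ => ((n : ℝ) - k) * x / laguerreNu α n) x := by
      refine ((FirstOrderLimit.affine_div_affine x (-(k * x)) 1 ((α + 1) / 2) one_ne_zero).congr'
        (Eventually.of_forall fun N => ?_)).congr_limit (div_one x)
      simp only [laguerreNu]
      ring
    have h1 := min_le_left x (1 - x)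
    have h2 := min_le_right x (1 - x)
    have h3 : 0 < min x (1 - x) := lt_min hx0 hx1'
    filter_upwards [h.tendsto.eventually_const_lt (show min x (1 - x) / 2 < x by linarith),
      h.tendsto.eventually_lt_const (show x < 1 - min x (1 - x) / 2 by linarith)] with n ha hb
    exact ⟨ha.le, hb.le⟩
  have hmain := (firstOrderLimit_lgInvariant hα
    (show 0 < min x (1 - x) / 2 by have := lt_min hx0 hx1'; linarith) hmem).comp_add k
  have hgx : √(x * (1 - x)) / (1 - x) * x ≠ 0 := by
    have : 0 < √(x * (1 - x)) := sqrt_pos.2 (by positivity)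
    positivity
  have hquad : FirstOrderLimit (fun N => 1 / 4 * laguerreJet α x k 1 N ^ 2 +
      (2 * e N - f N) / (4 * ν N) * (laguerreJet α x k 1 N * laguerreJet α x k 0 N) +
      ((1 / y N - 1) + (e N ^ 2 - e N * f N + (1 - α ^ 2) / 4 / y N ^ 2 +
        (4 * y N - 1) / (8 * (y N * (1 - y N)) ^ 2)) / (4 * ν N ^ 2)) *
        laguerreJet α x k 0 N ^ 2) (2 / π / (√(x * (1 - x)) / (1 - x) * x)) := by
    refine (hmain.div hg' hgx).congr' ?_
    filter_upwards [eventually_gt_atTop 0, hg'.tendsto.eventually_ne hgx] with N hN hne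
    have h := lgInvariant_eq_laguerreJet hα hx0 k hN
    simp only [Nat.cast_add, add_sub_cancel_right]
    rw [div_eq_iff hne]
    refine Eq.trans h ?_
    exact mul_comm _ _
  refine ⟨FirstOrderLimit.isBigO_of_quadratic (FirstOrderLimit.const _) hb hd (by norm_num) hxx
    hquad, ?_⟩
  have hq2 := FirstOrderLimit.quadratic (FirstOrderLimit.const _) hb hd (by norm_num) hxx hquad
  refine ((hq2.const_mul (1 / x - 1)⁻¹).congr' (Eventually.of_forall fun N => ?_)).congr_limit ?_
  · beta_reduce
    rw [div_pow, sq_waveNumber ⟨hx0, hx1⟩]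
    field_simp
    ring
  · have hs : √(x * (1 - x)) = x * √(1 / x - 1) := by
      rw [show x * (1 - x) = x ^ 2 * (1 / x - 1) by field_simp, sqrt_mul (sq_nonneg x),
        sqrt_sq hx0.le]
    have h0 : 0 < √(1 / x - 1) := sqrt_pos.2 hxx
    have h2 : √(1 / x - 1) ^ 2 = 1 / x - 1 := sq_sqrt hxx.le
    rw [hs, waveNumber, ← h2]
    generalize √(1 / x - 1) = s at *
    have h3 : 1 - x = x * s ^ 2 := by rw [h2]; field_simp
    rw [h3]
    field_simp
    norm_num

end LocalExpansion
namespace FirstOrderLimit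

open Filter Asymptotics Topology

lemma mul_sub_mul {f f' g g' : ℕ → ℝ} (hf : f =O[atTop] (fun _ => (1 : ℝ)))
    (hg' : g' =O[atTop] (fun _ => (1 : ℝ))) (hff' : FirstOrderLimit (fun N => f N - f' N) 0)
    (hgg' : FirstOrderLimit (fun N => g N - g' N) 0) :
    FirstOrderLimit (fun N => f N * g N - f' N * g' N) 0 := by
  refine (((bdd_mul hf hgg').add (bdd_mul hg' hff')).congr'
    (Eventually.of_forall fun N => ?_)).congr_limit (add_zero 0)
  beta_reduce
  ring

end FirstOrderLimit

section JetPredecessor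

open Polynomial

/-- The functional preceding `jetCoeff N x a`, which is zero for `a = 0`. -/
noncomputable def jetPred (N x : ℝ) : ℕ → ℝ[X] →ₗ[ℝ] ℝ
  | 0 => 0
  | a + 1 => jetCoeff N x a

variable {N x : ℝ}

lemma jetCoeff_X_mul (a : ℕ) (p : ℝ[X]) :
    jetCoeff N x a (X * p) = x * jetCoeff N x a p + jetPred N x a p / N := by
  cases a with
  | zero => simp [jetPred, jetCoeff_X_mul_zero]
  | succ a => exact jetCoeff_X_mul_succ a p

lemma jetPred_derivative (hN : N ≠ 0) (a : ℕ) (p : ℝ[X]) : jetPred N x a (derivative p) =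
    N * (a * jetCoeff N x a p + 2 * jetPred N x a p) := by
  cases a with
  | zero => simp [jetPred]
  | succ a => simpa [jetPred] using jetCoeff_derivative hN a p

end JetPredecessor

section LocalRecurrence

open Real Polynomial Filter Topology Asymptotics

variable {α x : ℝ}

/-- The predecessor of `laguerreJet` in the order of the Taylor coefficient. -/
noncomputable def laguerreJetPred (α x : ℝ) (k a N : ℕ) : ℝ :=
  √(x ^ α * exp (-(4 * N) * x) / laguerreNorm α (4 * N) (N + k)) *
    jetPred N x a (monicLaguerre α (4 * N) (N + k))

lemma laguerreJet_recurrence (x : ℝ) (k a : ℕ) {N : ℕ} (hN : 0 < N) :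
    x * ((a + 1) * (a + 2)) * laguerreJet α x k (a + 2) N + 4 * (1 - x) * laguerreJet α x k a N =
      -((a + α + 1) * ((a + 1) * laguerreJet α x k (a + 1) N + 2 * laguerreJet α x k a N) -
        2 * (a * laguerreJet α x k a N + 2 * laguerreJetPred α x k a N) +
        4 * k * laguerreJet α x k a N) * (N : ℝ)⁻¹ := by
  have hN' : (0 : ℝ) < N := by exact_mod_cast hN
  have h := congrArg (jetCoeff N x a) (monicLaguerre_ode (α := α)
    (show (0 : ℝ) < 4 * N by positivity) (N + k))
  unfold laguerreJet laguerreJetPred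
  set p := monicLaguerre α (4 * N) (N + k)
  generalize √(x ^ α * exp (-(4 * N) * x) / laguerreNorm α (4 * N) (N + k)) = s
  have e : X * derivative (derivative p) + (C (α + 1) - C (4 * (N : ℝ)) * X) * derivative p +
      C (4 * (N : ℝ) * (N + k : ℕ)) * p = X * derivative (derivative p) +
      (α + 1) • derivative p - (4 * (N : ℝ)) • (X * derivative p) +
      (4 * (N : ℝ) * (N + k : ℕ)) • p := by
    simp only [smul_eq_C_mul]; ring
  rw [e] at h
  simp only [map_add, map_sub, map_smul, smul_eq_mul, map_zero, jetCoeff_X_mul,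
    jetPred_derivative hN'.ne', jetCoeff_derivative hN'.ne'] at h
  push_cast at h
  field_simp at h
  replace h := (mul_eq_zero.1 h).resolve_left hN'.ne'
  field_simp
  linear_combination s * h

lemma laguerreJet_isBigO_one (hα : -1 < α) (hx : x ∈ Set.Ioo (0 : ℝ) 1) (k a : ℕ) :
    laguerreJet α x k a =O[atTop] (fun _ => (1 : ℝ)) := by
  obtain ⟨⟨h1, h0⟩, -⟩ := laguerreJet_zero_one hα hx k
  induction a using Nat.strong_induction_on with
  | _ a ih =>
    match a with
    | 0 => exact h0
    | 1 => exact h1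
    | a + 2 =>
      have hp : laguerreJetPred α x k a =O[atTop] (fun _ => (1 : ℝ)) := by
        cases a with
        | zero =>
          refine (isBigO_zero _ _).congr_left fun N => ?_
          simp [laguerreJetPred, jetPred]
        | succ a => exact ih a (by omega)
      have ha := ih a (by omega)
      have ha1 := ih (a + 1) (by omega)
      have hsmall := FirstOrderLimit.of_isBigO_one_mul_inv
        (((((ha1.const_mul_left ((a : ℝ) + 1)).add (ha.const_mul_left 2)).const_mul_left
          (a + α + 1)).sub (((ha.const_mul_left (a : ℝ)).add
            (hp.const_mul_left 2)).const_mul_left 2)).add (ha.const_mul_left (4 * (k : ℝ)))).neg_left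
      have hx0 : x * (((a : ℝ) + 1) * (a + 2)) ≠ 0 := by
        have := hx.1; positivity
      refine ((hsmall.isBigO_one.sub (ha.const_mul_left (4 * (1 - x)))).const_mul_left
        (x * (((a : ℝ) + 1) * (a + 2)))⁻¹).congr' ?_ EventuallyEq.rfl
      filter_upwards [eventually_gt_atTop 0] with N hN
      rw [inv_mul_eq_iff_eq_mul₀ hx0, sub_eq_iff_eq_add, laguerreJet_recurrence x k a hN]

lemma laguerreJetPred_isBigO_one (hα : -1 < α) (hx : x ∈ Set.Ioo (0 : ℝ) 1) (k a : ℕ) :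
    laguerreJetPred α x k a =O[atTop] (fun _ => (1 : ℝ)) := by
  cases a with
  | zero =>
    refine (isBigO_zero _ _).congr_left fun N => ?_
    simp [laguerreJetPred, jetPred]
  | succ a => exact laguerreJet_isBigO_one hα hx k a

lemma laguerreJet_recurrence_limit (hα : -1 < α) (hx : x ∈ Set.Ioo (0 : ℝ) 1) (k a : ℕ) :
    FirstOrderLimit (fun N => (a + 1) * (a + 2) * laguerreJet α x k (a + 2) N +
      waveNumber x ^ 2 * laguerreJet α x k a N) 0 := by
  have ha := laguerreJet_isBigO_one hα hx k a
  have ha1 := laguerreJet_isBigO_one hα hx k (a + 1)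
  have hp := laguerreJetPred_isBigO_one hα hx k a
  have hsmall := FirstOrderLimit.of_isBigO_one_mul_inv
    (((((ha1.const_mul_left ((a : ℝ) + 1)).add (ha.const_mul_left 2)).const_mul_left
      (a + α + 1)).sub (((ha.const_mul_left (a : ℝ)).add
        (hp.const_mul_left 2)).const_mul_left 2)).add (ha.const_mul_left (4 * (k : ℝ)))).neg_left
  refine ((hsmall.const_mul x⁻¹).congr' ?_).congr_limit (mul_zero _)
  filter_upwards [eventually_gt_atTop 0] with N hN
  rw [← laguerreJet_recurrence x k a hN, sq_waveNumber hx]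
  have := hx.1.ne'
  field_simp

/-- Taylor coefficients of the cosine with frequency `κ`. -/
noncomputable def cosCoeff (κ : ℝ) (a : ℕ) : ℝ := κ ^ a / a.factorial * (Complex.I ^ a).re

/-- Taylor coefficients of the sine with frequency `κ`. -/
noncomputable def sinCoeff (κ : ℝ) (a : ℕ) : ℝ := κ ^ a / a.factorial * (Complex.I ^ a).im

lemma succ_mul_cosCoeff (κ : ℝ) (a : ℕ) : (a + 1) * cosCoeff κ (a + 1) = -(κ * sinCoeff κ a) := by
  simp only [cosCoeff, sinCoeff, pow_succ, Nat.factorial_succ, Complex.mul_re, Complex.I_re,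
    Complex.I_im]
  push_cast
  field_simp
  ring

lemma succ_mul_sinCoeff (κ : ℝ) (a : ℕ) : (a + 1) * sinCoeff κ (a + 1) = κ * cosCoeff κ a := by
  simp only [cosCoeff, sinCoeff, pow_succ, Nat.factorial_succ, Complex.mul_im, Complex.I_re,
    Complex.I_im]
  push_cast
  field_simp
  ring

lemma laguerreJet_expansion (hα : -1 < α) (hx : x ∈ Set.Ioo (0 : ℝ) 1) (k a : ℕ) :
    FirstOrderLimit (fun N => laguerreJet α x k a N -
      (laguerreJet α x k 0 N * cosCoeff (waveNumber x) a +
        laguerreJet α x k 1 N / waveNumber x * sinCoeff (waveNumber x) a)) 0 := by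
  have hκ := (waveNumber_pos hx).ne'
  induction a using Nat.strong_induction_on with
  | _ a ih =>
    match a with
    | 0 =>
      refine (FirstOrderLimit.const 0).congr' (Eventually.of_forall fun N => ?_)
      simp [cosCoeff, sinCoeff]
    | 1 =>
      refine (FirstOrderLimit.const 0).congr' (Eventually.of_forall fun N => ?_)
      simp [cosCoeff, sinCoeff, hκ]
    | a + 2 =>
      have h := ((laguerreJet_recurrence_limit hα hx k a).sub
        ((ih a (by omega)).const_mul (waveNumber x ^ 2))).const_mul ((((a : ℝ) + 1) * (a + 2))⁻¹)
      have ha : ((a : ℝ) + 1) * (a + 2) ≠ 0 := by positivity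
      have hc : ((a : ℝ) + 1) * (a + 2) * cosCoeff (waveNumber x) (a + 2) =
          -(waveNumber x ^ 2 * cosCoeff (waveNumber x) a) := by
        have h1 := succ_mul_cosCoeff (waveNumber x) (a + 1)
        have h2 := succ_mul_sinCoeff (waveNumber x) a
        push_cast at h1
        linear_combination (a + 1 : ℝ) * h1 - waveNumber x * h2
      have hs : ((a : ℝ) + 1) * (a + 2) * sinCoeff (waveNumber x) (a + 2) =
          -(waveNumber x ^ 2 * sinCoeff (waveNumber x) a) := by
        have h1 := succ_mul_sinCoeff (waveNumber x) (a + 1)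
        have h2 := succ_mul_cosCoeff (waveNumber x) a
        push_cast at h1
        linear_combination (a + 1 : ℝ) * h1 + waveNumber x * h2
      refine (h.congr' (Eventually.of_forall fun N => ?_)).congr_limit (by simp)
      beta_reduce
      rw [inv_mul_eq_iff_eq_mul₀ ha]
      linear_combination laguerreJet α x k 0 N * hc + laguerreJet α x k 1 N / waveNumber x * hs

/-- The limiting Wronskian-type bilinear form of the local coefficients. -/
lemma laguerreJet_wronskian (hα : -1 < α) (hx : x ∈ Set.Ioo (0 : ℝ) 1) (k a b : ℕ) :
    FirstOrderLimit (fun N => laguerreJet α x k a N * ((b + 1) * laguerreJet α x k (b + 1) N) -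
        ((a + 1) * laguerreJet α x k (a + 1) N) * laguerreJet α x k b N)
      (4 / (π * x) * (sinCoeff (waveNumber x) a * cosCoeff (waveNumber x) b -
        cosCoeff (waveNumber x) a * sinCoeff (waveNumber x) b)) := by
  set κ := waveNumber x
  have hκ : κ ≠ 0 := (waveNumber_pos hx).ne'
  set J := laguerreJet α x k
  set E : ℕ → ℕ → ℝ := fun a N => J 0 N * cosCoeff κ a + J 1 N / κ * sinCoeff κ a
  have hJ : ∀ a, J a =O[atTop] (fun _ => (1 : ℝ)) := laguerreJet_isBigO_one hα hx k
  have hE : ∀ a, E a =O[atTop] (fun _ => (1 : ℝ)) := fun a =>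
    (((hJ 0).const_mul_left (cosCoeff κ a)).add
      ((hJ 1).const_mul_left (sinCoeff κ a / κ))).congr_left fun N => by
        simp only [E]; ring
  have hJE : ∀ a, FirstOrderLimit (fun N => J a N - E a N) 0 := laguerreJet_expansion hα hx k
  have h1 := FirstOrderLimit.mul_sub_mul (hJ a) (hE (b + 1)) (hJE a) (hJE (b + 1))
  have h2 := FirstOrderLimit.mul_sub_mul (hJ (a + 1)) (hE b) (hJE (a + 1)) (hJE b)
  have h3 := (laguerreJet_zero_one hα hx k).2.const_mul
    (κ * (sinCoeff κ a * cosCoeff κ b - cosCoeff κ a * sinCoeff κ b))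
  refine ((((h1.const_mul ((b : ℝ) + 1)).sub (h2.const_mul ((a : ℝ) + 1))).add h3).congr'
    (Eventually.of_forall fun N => ?_)).congr_limit ?_
  · have c1 := succ_mul_cosCoeff κ a
    have c2 := succ_mul_cosCoeff κ b
    have s1 := succ_mul_sinCoeff κ a
    have s2 := succ_mul_sinCoeff κ b
    change (b + 1 : ℝ) * (J a N * J (b + 1) N - E a N * E (b + 1) N) - (a + 1 : ℝ) *
      (J (a + 1) N * J b N - E (a + 1) N * E b N) + κ * (sinCoeff κ a * cosCoeff κ b -
        cosCoeff κ a * sinCoeff κ b) * (J 0 N ^ 2 + (J 1 N / κ) ^ 2) = _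
    simp only [E]
    generalize hQ : J 1 N / κ = Q
    generalize J 0 N = P
    linear_combination (-(P * cosCoeff κ a + Q * sinCoeff κ a)) * (P * c2 + Q * s2) +
      (P * cosCoeff κ b + Q * sinCoeff κ b) * (P * c1 + Q * s1)
  · have := hx.1.ne'
    simp only [mul_zero, sub_zero, zero_add]
    rw [show waveNumber x = κ from rfl]
    field_simp

end LocalRecurrence
section LocalKernel

open Real Polynomial Filter Topology Asymptotics

variable {α x y : ℝ}

/-- The normalised Christoffel–Darboux sum of two functionals. -/
noncomputable def laguerreKernel (α x y : ℝ) (k N : ℕ) (l l' : ℝ[X] →ₗ[ℝ] ℝ) : ℝ :=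
  √(x ^ α * exp (-(4 * N) * x)) * √(y ^ α * exp (-(4 * N) * y)) / N *
    ∑ j ∈ range (N + k), l (monicLaguerre α (4 * N) j) * l' (monicLaguerre α (4 * N) j) /
      laguerreNorm α (4 * N) j

/-- The rescaled local coefficients of `x` times the derivative. -/
noncomputable def laguerreJetDeriv (α x : ℝ) (k a N : ℕ) : ℝ :=
  x * ((a + 1) * laguerreJet α x k (a + 1) N + 2 * laguerreJet α x k a N) +
    (a * laguerreJet α x k a N + 2 * laguerreJetPred α x k a N) * (N : ℝ)⁻¹

lemma laguerreKernel_recurrence (hα : -1 < α) (x y : ℝ) (k a b : ℕ) {N : ℕ} (hN : 0 < N) :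
    N * (x - y) * laguerreKernel α x y k N (jetCoeff N x a) (jetCoeff N y b) +
      laguerreKernel α x y k N (jetPred N x a) (jetCoeff N y b) -
      laguerreKernel α x y k N (jetCoeff N x a) (jetPred N y b) =
    1 / 4 * (laguerreJet α x k a N * laguerreJetDeriv α y k b N -
      laguerreJetDeriv α x k a N * laguerreJet α y k b N) := by
  have hN' : (0 : ℝ) < N := by exact_mod_cast hN
  have hβ : (0 : ℝ) < 4 * N := by positivity
  have h := christoffel_darboux hα hβ (jetCoeff N x a) (jetCoeff N y b) (N + k)
  have hh : 0 < laguerreNorm α (4 * N) (N + k) := laguerreNorm_pos hα hβ _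
  have hsqrt : ∀ z : ℝ, √(z ^ α * exp (-(4 * N) * z) / laguerreNorm α (4 * N) (N + k)) =
      √(z ^ α * exp (-(4 * N) * z)) / √(laguerreNorm α (4 * N) (N + k)) := fun z =>
    sqrt_div' _ hh.le
  have hsq : √(laguerreNorm α (4 * N) (N + k)) ^ 2 = laguerreNorm α (4 * N) (N + k) :=
    sq_sqrt hh.le
  have hs0 : √(laguerreNorm α (4 * N) (N + k)) ≠ 0 := (sqrt_pos.2 hh).ne'
  have hsum : ∑ j ∈ range (N + k),
      (jetCoeff N x a (X * monicLaguerre α (4 * N) j) * jetCoeff N y b (monicLaguerre α (4 * N) j) -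
        jetCoeff N x a (monicLaguerre α (4 * N) j) *
          jetCoeff N y b (X * monicLaguerre α (4 * N) j)) / laguerreNorm α (4 * N) j =
      (x - y) * (∑ j ∈ range (N + k), jetCoeff N x a (monicLaguerre α (4 * N) j) *
        jetCoeff N y b (monicLaguerre α (4 * N) j) / laguerreNorm α (4 * N) j) +
      (∑ j ∈ range (N + k), jetPred N x a (monicLaguerre α (4 * N) j) *
        jetCoeff N y b (monicLaguerre α (4 * N) j) / laguerreNorm α (4 * N) j) / N -
      (∑ j ∈ range (N + k), jetCoeff N x a (monicLaguerre α (4 * N) j) *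
        jetPred N y b (monicLaguerre α (4 * N) j) / laguerreNorm α (4 * N) j) / N := by
    rw [Finset.mul_sum, Finset.sum_div, Finset.sum_div, ← Finset.sum_add_distrib,
      ← Finset.sum_sub_distrib]
    refine Finset.sum_congr rfl fun j _ => ?_
    rw [jetCoeff_X_mul, jetCoeff_X_mul]
    ring
  rw [hsum] at h
  simp only [jetCoeff_X_mul, jetPred_derivative hN'.ne', jetCoeff_derivative hN'.ne'] at h
  unfold laguerreKernel laguerreJetDeriv laguerreJet laguerreJetPred
  rw [hsqrt, hsqrt]
  generalize √(x ^ α * exp (-(4 * N) * x)) = wx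
  generalize √(y ^ α * exp (-(4 * N) * y)) = wy
  set H := √(laguerreNorm α (4 * N) (N + k))
  rw [← hsq] at h
  have h' := congrArg (fun z => wx * wy * z) h
  beta_reduce at h'
  refine Eq.trans ?_ (h'.trans ?_)
  · field_simp
  · field_simp

lemma laguerreJetDeriv_isBigO_one (hα : -1 < α) (hx : x ∈ Set.Ioo (0 : ℝ) 1) (k a : ℕ) :
    laguerreJetDeriv α x k a =O[atTop] (fun _ => (1 : ℝ)) := by
  have ha := laguerreJet_isBigO_one hα hx k a
  have ha1 := laguerreJet_isBigO_one hα hx k (a + 1)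
  have hp := laguerreJetPred_isBigO_one hα hx k a
  exact (((ha1.const_mul_left ((a : ℝ) + 1)).add (ha.const_mul_left 2)).const_mul_left x).add
    (FirstOrderLimit.of_isBigO_one_mul_inv
      ((ha.const_mul_left (a : ℝ)).add (hp.const_mul_left 2))).isBigO_one

/-- Off-diagonal decay of the Christoffel–Darboux kernel. -/
lemma laguerreKernel_off_diagonal (hα : -1 < α) (hx : x ∈ Set.Ioo (0 : ℝ) 1)
    (hy : y ∈ Set.Ioo (0 : ℝ) 1) (hxy : x ≠ y) (k a b : ℕ) :
    FirstOrderLimit (fun N => laguerreKernel α x y k N (jetCoeff N x a) (jetCoeff N y b)) 0 := by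
  induction hs : a + b using Nat.strong_induction_on generalizing a b with
  | _ s ih =>
    have h1 : (fun N : ℕ => laguerreKernel α x y k N (jetPred N x a) (jetCoeff N y b)) =O[atTop]
        (fun _ => (1 : ℝ)) := by
      cases a with
      | zero =>
        refine (isBigO_zero _ _).congr_left fun N => ?_
        simp [laguerreKernel, jetPred]
      | succ a => exact (ih (a + b) (by omega) a b rfl).isBigO_one
    have h2 : (fun N : ℕ => laguerreKernel α x y k N (jetCoeff N x a) (jetPred N y b)) =O[atTop]
        (fun _ => (1 : ℝ)) := by
      cases b with
      | zero =>
        refine (isBigO_zero _ _).congr_left fun N => ?_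
        simp [laguerreKernel, jetPred]
      | succ b => exact (ih (a + b) (by omega) a b rfl).isBigO_one
    have h3 : (fun N : ℕ => 1 / 4 * (laguerreJet α x k a N * laguerreJetDeriv α y k b N -
        laguerreJetDeriv α x k a N * laguerreJet α y k b N)) =O[atTop] (fun _ => (1 : ℝ)) := by
      have e1 := (laguerreJet_isBigO_one hα hx k a).mul (laguerreJetDeriv_isBigO_one hα hy k b)
      have e2 := (laguerreJetDeriv_isBigO_one hα hx k a).mul (laguerreJet_isBigO_one hα hy k b)
      simp only [mul_one] at e1 e2
      exact (e1.sub e2).const_mul_left _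
    have hne : x - y ≠ 0 := sub_ne_zero.2 hxy
    refine (((FirstOrderLimit.of_isBigO_one_mul_inv ((h3.sub h1).add h2)).const_mul
      (x - y)⁻¹).congr' ?_).congr_limit (mul_zero _)
    filter_upwards [eventually_gt_atTop 0] with N hN
    have hN' : (N : ℝ) ≠ 0 := by positivity
    rw [← laguerreKernel_recurrence hα x y k a b hN]
    field_simp
    ring

lemma laguerreJet_bracket (hα : -1 < α) (hx : x ∈ Set.Ioo (0 : ℝ) 1) (k a b : ℕ) :
    FirstOrderLimit (fun N => 1 / 4 * (laguerreJet α x k a N * laguerreJetDeriv α x k b N -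
      laguerreJetDeriv α x k a N * laguerreJet α x k b N))
      (1 / π * (sinCoeff (waveNumber x) a * cosCoeff (waveNumber x) b -
        cosCoeff (waveNumber x) a * sinCoeff (waveNumber x) b)) := by
  have hJ := laguerreJet_isBigO_one hα hx k
  have hP := laguerreJetPred_isBigO_one hα hx k
  have hsm : ∀ a, FirstOrderLimit (fun N => (a * laguerreJet α x k a N +
      2 * laguerreJetPred α x k a N) * (N : ℝ)⁻¹) 0 := fun a =>
    FirstOrderLimit.of_isBigO_one_mul_inv
      (((hJ a).const_mul_left (a : ℝ)).add ((hP a).const_mul_left 2))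
  refine (((((laguerreJet_wronskian hα hx k a b).const_mul x).add
    (FirstOrderLimit.bdd_mul (hJ a) (hsm b))).sub
      (FirstOrderLimit.bdd_mul (hJ b) (hsm a))).const_mul (1 / 4)).congr'
        (Eventually.of_forall fun N => ?_) |>.congr_limit ?_
  · simp only [laguerreJetDeriv]
    ring
  · have := hx.1.ne'
    field_simp
    ring

lemma sineKernelCoeff_zero_right (κ : ℝ) (a : ℕ) :
    sineKernelCoeff κ a 0 = 1 / π * (sinCoeff κ (a + 1) * cosCoeff κ 0 -
      cosCoeff κ (a + 1) * sinCoeff κ 0) := by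
  simp only [sineKernelCoeff, sinCoeff, cosCoeff, pow_succ, Nat.factorial_succ, Complex.mul_re,
    Complex.mul_im, Complex.I_re, Complex.I_im, pow_zero, Complex.one_re, Complex.one_im,
    Nat.factorial_zero, add_zero]
  push_cast
  field_simp
  ring

lemma sineKernelCoeff_succ_right (κ : ℝ) (a b : ℕ) :
    sineKernelCoeff κ a (b + 1) = sineKernelCoeff κ (a + 1) b +
      1 / π * (sinCoeff κ (a + 1) * cosCoeff κ (b + 1) -
        cosCoeff κ (a + 1) * sinCoeff κ (b + 1)) := by
  simp only [sineKernelCoeff, sinCoeff, cosCoeff, pow_succ, Nat.factorial_succ, Complex.mul_re,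
    Complex.mul_im, Complex.I_re, Complex.I_im, pow_add]
  push_cast
  have h1 : (a : ℝ) + (b + 1) + 1 ≠ 0 := by positivity
  have h2 : (a : ℝ) + 1 + b + 1 ≠ 0 := by positivity
  field_simp
  ring

/-- On the diagonal the Christoffel–Darboux kernel converges to the sine kernel. -/
lemma laguerreKernel_diagonal (hα : -1 < α) (hx : x ∈ Set.Ioo (0 : ℝ) 1) (k a b : ℕ) :
    FirstOrderLimit (fun N => laguerreKernel α x x k N (jetCoeff N x a) (jetCoeff N x b))
      (sineKernelCoeff (waveNumber x) a b) := by
  induction b generalizing a with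
  | zero =>
    refine ((laguerreJet_bracket hα hx k (a + 1) 0).congr' ?_).congr_limit
      (sineKernelCoeff_zero_right _ _).symm
    filter_upwards [eventually_gt_atTop 0] with N hN
    rw [← laguerreKernel_recurrence hα x x k (a + 1) 0 hN]
    simp [laguerreKernel, jetPred]
  | succ b ih =>
    refine (((ih (a + 1)).add (laguerreJet_bracket hα hx k (a + 1) (b + 1))).congr'
      ?_).congr_limit (sineKernelCoeff_succ_right _ _ _).symm
    filter_upwards [eventually_gt_atTop 0] with N hN
    rw [← laguerreKernel_recurrence hα x x k (a + 1) (b + 1) hN]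
    simp only [jetPred]
    ring

end LocalKernel
section GramIdentities

open Matrix Polynomial

lemma Matrix.det_mul_inv_mul_transpose_mul_det {κ ν : Type*} [Fintype κ] [DecidableEq κ]
    [Fintype ν] [DecidableEq ν] (M : Matrix (κ ⊕ ν) (κ ⊕ ν) ℝ) (hM : IsUnit M.det)
    (W : Matrix κ κ ℝ) :
    (fromCols W (0 : Matrix κ ν ℝ) * M⁻¹ * (fromCols W (0 : Matrix κ ν ℝ))ᵀ).det * M.det =
      W.det ^ 2 * M.toBlocks₂₂.det := by
  set Z := fromCols W (0 : Matrix κ ν ℝ) with hZ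
  have hMC : M * (M⁻¹ * Zᵀ) = Zᵀ := mul_nonsing_inv_cancel_left _ _ hM
  obtain ⟨C₁, C₂, hC⟩ : ∃ C₁ C₂, M⁻¹ * Zᵀ = fromRows C₁ C₂ :=
    ⟨_, _, (fromRows_toRows _).symm⟩
  rw [Matrix.mul_assoc, hC, hZ, fromCols_mul_fromRows, Matrix.zero_mul, add_zero]
  rw [hC] at hMC
  have h1 : M * fromBlocks C₁ 0 C₂ 1 = fromBlocks Wᵀ M.toBlocks₁₂ 0 M.toBlocks₂₂ := by
    rw [← fromBlocks_toBlocks M, fromBlocks_mul_fromRows, hZ, transpose_fromCols,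
      fromRows_ext_iff, transpose_zero] at hMC
    conv_lhs => rw [← fromBlocks_toBlocks M]
    rw [fromBlocks_multiply, hMC.1, hMC.2]
    simp
  have h2 := congrArg det h1
  rw [det_mul, det_fromBlocks_zero₁₂, det_fromBlocks_zero₂₁, det_one, mul_one,
    det_transpose] at h2
  rw [det_mul]
  linear_combination W.det * h2

lemma det_coeff_of_monic {ι : Type*} [Fintype ι] [DecidableEq ι] {n : ℕ} (σ : ι ≃ Fin n)
    (p : ι → ℝ[X]) (hp : ∀ i, (p i).Monic ∧ (p i).natDegree = σ i) :
    (Matrix.of fun i j : ι => (p i).coeff (σ j)).det = 1 := by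
  have h := Matrix.det_matrixOfPolynomials (fun i : Fin n => p (σ.symm i))
    (fun i => by rw [(hp _).2, σ.apply_symm_apply]) (fun i => (hp _).1)
  rw [← h, ← Matrix.det_submatrix_equiv_self σ, ← Matrix.det_transpose]
  congr 1
  ext i j
  simp

lemma map_eq_sum_coeff {ι : Type*} [Fintype ι] {n : ℕ} (σ : ι ≃ Fin n) (l : ℝ[X] →ₗ[ℝ] ℝ)
    {p : ℝ[X]} (hp : p.natDegree < n) :
    l p = ∑ i, p.coeff (σ i) * l (X ^ (σ i : ℕ)) := by
  conv_lhs => rw [p.as_sum_range_C_mul_X_pow' hp]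
  rw [map_sum, σ.sum_comp (fun i : Fin n => p.coeff i * l (X ^ (i : ℕ))),
    ← Fin.sum_univ_eq_sum_range (fun i => l (C (p.coeff i) * X ^ i))]
  simp [← smul_eq_C_mul]

lemma gram_eq {ι : Type*} [Fintype ι] [DecidableEq ι] {n : ℕ} (σ : ι ≃ Fin n)
    (L : ℝ[X] →ₗ[ℝ] ℝ) (p : ι → ℝ[X]) (hp : ∀ i, (p i).natDegree < n) :
    (Matrix.of fun i j => L (p i * p j)) = (Matrix.of fun i j : ι => (p i).coeff (σ j)) *
      (Matrix.of fun i j : ι => L (X ^ (σ i + σ j : ℕ))) *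
      (Matrix.of fun i j : ι => (p i).coeff (σ j))ᵀ := by
  ext i j
  have h1 := map_eq_sum_coeff σ (L ∘ₗ LinearMap.mulLeft ℝ (p i)) (hp j)
  simp only [LinearMap.comp_apply, LinearMap.mulLeft_apply] at h1
  simp only [Matrix.of_apply, Matrix.mul_apply, Matrix.transpose_apply, h1]
  refine Finset.sum_congr rfl fun s _ => ?_
  have h2 := map_eq_sum_coeff σ (L ∘ₗ LinearMap.mulRight ℝ (X ^ (σ s : ℕ))) (hp i)
  simp only [LinearMap.comp_apply, LinearMap.mulRight_apply] at h2
  rw [h2, mul_comm]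
  simp only [pow_add]

lemma det_gram_eq {ι : Type*} [Fintype ι] [DecidableEq ι] {n : ℕ} (σ : ι ≃ Fin n)
    (L : ℝ[X] →ₗ[ℝ] ℝ) (p : ι → ℝ[X]) (hp : ∀ i, (p i).Monic ∧ (p i).natDegree = σ i) :
    (Matrix.of fun i j => L (p i * p j)).det =
      (Matrix.of fun i j : ι => L (X ^ (σ i + σ j : ℕ))).det := by
  rw [gram_eq σ L p fun i => (hp i).2 ▸ (σ i).2, det_mul, det_mul, det_transpose,
    det_coeff_of_monic σ p hp, one_mul, mul_one]

variable {L : ℝ[X] →ₗ[ℝ] ℝ} {φ : ℕ → ℝ[X]}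

lemma gram_eq_diagonal (hL : ∀ i j, i ≠ j → L (φ i * φ j) = 0) {ι : Type*} [DecidableEq ι]
    {n : ℕ} (σ : ι ≃ Fin n) :
    (Matrix.of fun i j : ι => L (φ (σ i) * φ (σ j))) =
      diagonal fun i => L (φ (σ i) * φ (σ i)) := by
  ext i j
  rw [Matrix.of_apply, diagonal_apply]
  split_ifs with h
  · rw [h]
  · exact hL _ _ fun h' => h (σ.injective (Fin.ext h'))

lemma det_moments_eq_prod (hφ : ∀ j, (φ j).Monic ∧ (φ j).natDegree = j)
    (hL : ∀ i j, i ≠ j → L (φ i * φ j) = 0) {ι : Type*} [Fintype ι] [DecidableEq ι]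
    {n : ℕ} (σ : ι ≃ Fin n) :
    (Matrix.of fun i j : ι => L (X ^ (σ i + σ j : ℕ))).det =
      ∏ j ∈ range n, L (φ j * φ j) := by
  rw [← det_gram_eq σ L (fun i => φ (σ i)) fun i => hφ _, gram_eq_diagonal hL, det_diagonal,
    σ.prod_comp (fun i : Fin n => L (φ i * φ i)), Fin.prod_univ_eq_prod_range
      (fun j => L (φ j * φ j))]

/-- A determinant of Christoffel–Darboux sums against functionals that vanish on the multiples
of `P` is a ratio of Hankel determinants. -/
theorem det_sum_functionals_mul_prod (hφ : ∀ j, (φ j).Monic ∧ (φ j).natDegree = j)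
    (hL : ∀ i j, i ≠ j → L (φ i * φ j) = 0) (hh : ∀ j, L (φ j * φ j) ≠ 0)
    {κ : Type*} [Fintype κ] [DecidableEq κ] {k : ℕ} (τ : κ ≃ Fin k) (e : κ → ℝ[X])
    (he : ∀ t, (e t).Monic ∧ (e t).natDegree = τ t) {P : ℝ[X]} (hP : P.Monic ∧ P.natDegree = k)
    (l : κ → ℝ[X] →ₗ[ℝ] ℝ) (hl : ∀ r p, l r (P * p) = 0) (N : ℕ) :
    (Matrix.of fun r s => ∑ j ∈ range (k + N), l r (φ j) * l s (φ j) / L (φ j * φ j)).det *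
        ∏ j ∈ range (k + N), L (φ j * φ j) =
      (Matrix.of fun r s => l r (e s)).det ^ 2 *
        (Matrix.of fun i j : Fin N => L (X ^ (i + j : ℕ) * P ^ 2)).det := by
  let σ : κ ⊕ Fin N ≃ Fin (k + N) := (Equiv.sumCongr τ (Equiv.refl _)).trans finSumFinEquiv
  let f : κ ⊕ Fin N → ℝ[X] := Sum.elim e fun j => X ^ (j : ℕ) * P
  have hf : ∀ i, (f i).Monic ∧ (f i).natDegree = σ i := by
    rintro (t | j)
    · exact ⟨(he t).1, by simp [f, σ, (he t).2]⟩
    · refine ⟨(monic_X_pow _).mul hP.1, ?_⟩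
      simp [f, σ, (monic_X_pow _).natDegree_mul hP.1, hP.2, add_comm]
  set G := Matrix.of fun i j : κ ⊕ Fin N => L (X ^ (σ i + σ j : ℕ)) with hG
  have hdetG : G.det = ∏ j ∈ range (k + N), L (φ j * φ j) := det_moments_eq_prod hφ hL σ
  have hGu : IsUnit G.det := by
    rw [hdetG]; exact (prod_ne_zero_iff.2 fun j _ => hh j).isUnit
  set A := Matrix.of fun i j : κ ⊕ Fin N => (f i).coeff (σ j) with hA
  set B := Matrix.of fun i j : κ ⊕ Fin N => (φ (σ i)).coeff (σ j) with hB
  have hAu : IsUnit A.det := by rw [det_coeff_of_monic σ f hf]; exact isUnit_one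
  have hBu : IsUnit B.det := by
    rw [det_coeff_of_monic σ (fun i => φ (σ i)) fun i => hφ _]; exact isUnit_one
  set v := Matrix.of fun (r : κ) (j : κ ⊕ Fin N) => l r (X ^ (σ j : ℕ)) with hv
  have hvB : v * Bᵀ = Matrix.of fun (r : κ) (j : κ ⊕ Fin N) => l r (φ (σ j)) := by
    ext r j
    rw [Matrix.of_apply, map_eq_sum_coeff σ (l r) ((hφ _).2.trans_lt (σ j).2), mul_apply]
    exact sum_congr rfl fun _ _ => mul_comm _ _
  have hvA : v * Aᵀ = fromCols (Matrix.of fun r s => l r (e s)) 0 := by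
    have : v * Aᵀ = Matrix.of fun (r : κ) (j : κ ⊕ Fin N) => l r (f j) := by
      ext r j
      rw [Matrix.of_apply, map_eq_sum_coeff σ (l r) ((hf _).2.trans_lt (σ j).2), mul_apply]
      exact sum_congr rfl fun _ _ => mul_comm _ _
    rw [this]
    ext r (j | j)
    · rfl
    · simp [f, mul_comm _ P, hl]
  have hconj : ∀ C : Matrix (κ ⊕ Fin N) (κ ⊕ Fin N) ℝ, IsUnit C.det →
      v * Cᵀ * (C * G * Cᵀ)⁻¹ * (v * Cᵀ)ᵀ = v * G⁻¹ * vᵀ := by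
    intro C hC
    have hCt : IsUnit Cᵀ.det := by rwa [det_transpose]
    rw [transpose_mul, transpose_transpose, Matrix.mul_inv_rev, Matrix.mul_inv_rev]
    simp only [Matrix.mul_assoc]
    rw [mul_nonsing_inv_cancel_left _ _ hCt, nonsing_inv_mul_cancel_left _ _ hC]
  have hgB := gram_eq σ L (fun i => φ (σ i)) fun i => (hφ _).2.trans_lt (σ i).2
  have hgA := gram_eq σ L f fun i => (hf _).2.trans_lt (σ i).2
  have hK : (Matrix.of fun r s => ∑ j ∈ range (k + N), l r (φ j) * l s (φ j) / L (φ j * φ j)) =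
      v * G⁻¹ * vᵀ := by
    have hD : (diagonal fun i => L (φ (σ i) * φ (σ i)))⁻¹ =
        diagonal fun i => (L (φ (σ i) * φ (σ i)))⁻¹ := by
      refine inv_eq_right_inv ?_
      rw [diagonal_mul_diagonal, ← diagonal_one]
      congr 1
      ext i
      exact mul_inv_cancel₀ (hh _)
    rw [← hconj B hBu, ← hgB, gram_eq_diagonal hL, hvB, hD]
    ext r s
    rw [mul_apply, Matrix.of_apply]
    simp only [mul_diagonal, Matrix.of_apply, transpose_apply]
    rw [σ.sum_comp (fun i : Fin (k + N) => l r (φ i) * (L (φ i * φ i))⁻¹ * l s (φ i)),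
      Fin.sum_univ_eq_sum_range (fun i => l r (φ i) * (L (φ i * φ i))⁻¹ * l s (φ i))]
    exact sum_congr rfl fun _ _ => by ring
  have hmain := det_mul_inv_mul_transpose_mul_det (A * G * Aᵀ) (by
    rw [det_mul, det_mul, det_transpose]; exact (hAu.mul hGu).mul hAu)
    (Matrix.of fun r s => l r (e s))
  rw [← hvA, hconj A hAu, ← hK, ← hgA, det_gram_eq σ L f hf, ← hG, hdetG] at hmain
  rw [hmain]
  congr 2
  ext i j
  simp only [toBlocks₂₂, Matrix.of_apply, f, Sum.elim_inr]
  congr 1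
  ring

end GramIdentities
section NewtonBasis

open Matrix Polynomial

variable {N x : ℝ}

lemma jetCoeff_X_sub_C_mul (a : ℕ) (p : ℝ[X]) :
    jetCoeff N x a ((X - C x) * p) = jetPred N x a p / N := by
  rw [sub_mul, map_sub, jetCoeff_X_mul, ← smul_eq_C_mul, map_smul, smul_eq_mul]
  ring

lemma jetCoeff_X_sub_C_pow_mul_of_lt {a b : ℕ} (hab : a < b) (p : ℝ[X]) :
    jetCoeff N x a ((X - C x) ^ b * p) = 0 := by
  induction a generalizing b with
  | zero =>
    obtain ⟨b, rfl⟩ := Nat.exists_eq_succ_of_ne_zero hab.ne'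
    simp [jetCoeff_zero]
  | succ a ih =>
    obtain ⟨b, rfl⟩ := Nat.exists_eq_succ_of_ne_zero (Nat.ne_zero_of_lt hab)
    rw [Nat.succ_eq_add_one, pow_succ', mul_assoc, jetCoeff_X_sub_C_mul]
    simp [jetPred, ih (Nat.lt_of_succ_lt_succ hab)]

lemma jetCoeff_X_sub_C_pow_mul_self (a : ℕ) (p : ℝ[X]) :
    jetCoeff N x a ((X - C x) ^ a * p) = N⁻¹ ^ a * p.eval x := by
  induction a with
  | zero => simp [jetCoeff_zero]
  | succ a ih =>
    rw [pow_succ', mul_assoc, jetCoeff_X_sub_C_mul, jetPred, ih]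
    ring

variable {m : ℕ} (μ : Fin m → ℝ) (q : Fin m → ℕ)

/-- The Newton basis for interpolation at the nodes `μ i` with multiplicities `q i`. -/
noncomputable def newtonBasis (r : Σ i, Fin (q i)) : ℝ[X] :=
  (X - C (μ r.1)) ^ (r.2 : ℕ) * ∏ i ∈ Iio r.1, (X - C (μ i)) ^ q i

/-- The monic polynomial with zeros `μ i` of multiplicity `q i`. -/
noncomputable def nodePolynomial : ℝ[X] :=
  ∏ i, (X - C (μ i)) ^ q i

lemma nodePolynomial_monic_natDegree :
    (nodePolynomial μ q).Monic ∧ (nodePolynomial μ q).natDegree = ∑ i, q i := by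
  have h : ∀ i ∈ univ, ((X - C (μ i)) ^ q i).Monic := fun i _ => (monic_X_sub_C _).pow _
  refine ⟨monic_prod_of_monic _ _ h, ?_⟩
  rw [nodePolynomial, natDegree_prod_of_monic _ _ h]
  simp

lemma newtonBasis_monic_natDegree (r : Σ i, Fin (q i)) :
    (newtonBasis μ q r).Monic ∧ (newtonBasis μ q r).natDegree = finSigmaFinEquiv r := by
  have h : ∀ i ∈ Iio r.1, ((X - C (μ i)) ^ q i).Monic := fun i _ => (monic_X_sub_C _).pow _
  have h1 : ((X - C (μ r.1)) ^ (r.2 : ℕ)).Monic := (monic_X_sub_C _).pow _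
  refine ⟨h1.mul (monic_prod_of_monic _ _ h), ?_⟩
  rw [newtonBasis, h1.natDegree_mul (monic_prod_of_monic _ _ h), natDegree_prod_of_monic _ _ h,
    finSigmaFinEquiv_apply]
  simp only [natDegree_pow, natDegree_X_sub_C, mul_one]
  rw [add_comm]
  congr 1
  symm
  refine sum_bij (fun i _ => Fin.castLE r.1.2.le i) (fun i _ => ?_) (fun i _ j _ h => ?_)
    (fun i hi => ?_) (fun i _ => rfl)
  · rw [mem_Iio, Fin.lt_def]
    exact i.2
  · exact Fin.castLE_injective _ h
  · rw [mem_Iio] at hi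
    exact ⟨⟨i, hi⟩, mem_univ _, rfl⟩

lemma jetCoeff_nodePolynomial_mul (r : Σ i, Fin (q i)) (p : ℝ[X]) :
    jetCoeff N (μ r.1) r.2 (nodePolynomial μ q * p) = 0 := by
  rw [nodePolynomial, ← mul_prod_erase _ _ (mem_univ r.1), mul_assoc]
  exact jetCoeff_X_sub_C_pow_mul_of_lt r.2.2 _

lemma det_jetCoeff_newtonBasis (N : ℝ) :
    (Matrix.of fun r s => jetCoeff N (μ r.1) r.2 (newtonBasis μ q s)).det ^ 2 =
      (N⁻¹) ^ (∑ i, (q i ^ 2 - q i)) *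
        ∏ j, ∏ k ∈ Ioi j, (μ k - μ j) ^ (2 * q j * q k) := by
  have hdet : (Matrix.of fun r s => jetCoeff N (μ r.1) r.2 (newtonBasis μ q s)).det =
      ∏ r : Σ i, Fin (q i), N⁻¹ ^ (r.2 : ℕ) * ∏ i ∈ Iio r.1, (μ r.1 - μ i) ^ q i := by
    let M : Matrix (Σₗ i, Fin (q i)) (Σₗ i, Fin (q i)) ℝ :=
      Matrix.of fun r s => jetCoeff N (μ (ofLex r).1) (ofLex r).2 (newtonBasis μ q (ofLex s))
    have hM : M.IsLowerTriangular := by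
      intro r s hrs
      change jetCoeff N (μ (ofLex r).1) (ofLex r).2 (newtonBasis μ q (ofLex s)) = 0
      replace hrs : r < s := hrs
      obtain ⟨⟨i, a⟩, rfl⟩ := toLex.surjective r
      obtain ⟨⟨j, b⟩, rfl⟩ := toLex.surjective s
      rw [Sigma.Lex.lt_def] at hrs
      simp only [ofLex_toLex]
      obtain hij | ⟨hij, hab⟩ := hrs
      · change i < j at hij
        rw [newtonBasis, ← mul_prod_erase _ _ (mem_Iio.2 hij), mul_left_comm]
        exact jetCoeff_X_sub_C_pow_mul_of_lt a.2 _
      · change i = j at hij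
        subst hij
        exact jetCoeff_X_sub_C_pow_mul_of_lt hab _
    have h := det_of_isLowerTriangular M hM
    refine Eq.trans ?_ (h.trans ?_)
    · rw [← det_submatrix_equiv_self toLex M]; rfl
    · refine (toLex.prod_comp fun r => M r r).symm.trans (prod_congr rfl fun r _ => ?_)
      change jetCoeff N (μ r.1) r.2 (newtonBasis μ q r) = _
      rw [newtonBasis, jetCoeff_X_sub_C_pow_mul_self, eval_prod]
      simp
  have hswap : ∏ j, ∏ k ∈ Ioi j, (μ k - μ j) ^ (2 * q j * q k) =
      ∏ k, ∏ j ∈ Iio k, (μ k - μ j) ^ (2 * q j * q k) :=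
    prod_comm' (by simp)
  rw [hdet, Fintype.prod_sigma, hswap, ← prod_pow, ← prod_pow_eq_pow_sum, ← prod_mul_distrib]
  refine prod_congr rfl fun i _ => ?_
  dsimp only
  rw [prod_mul_distrib, mul_pow, prod_const, card_univ, Fintype.card_fin,
    prod_pow_eq_pow_sum, ← pow_mul, Fin.sum_univ_eq_sum_range (fun a => a) (q i),
    sum_range_id_mul_two, Nat.mul_sub_one, ← sq, ← pow_mul, ← prod_pow]
  congr 1
  exact prod_congr rfl fun j _ => by rw [← pow_mul]; congr 1; ring

end NewtonBasis
section Assembly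

open Real Polynomial Matrix

lemma firstOrderLimit_factorial_mul_pow_div (k : ℕ) :
    FirstOrderLimit (fun N => (N.factorial : ℝ) * (N : ℝ) ^ k / (N + k).factorial) 1 := by
  induction k with
  | zero =>
    refine (FirstOrderLimit.const 1).congr' (Filter.Eventually.of_forall fun N => ?_)
    have : (N.factorial : ℝ) ≠ 0 := by positivity
    simp [this]
  | succ k ih =>
    have h := ((FirstOrderLimit.const 1).add
      (FirstOrderLimit.inv_nat.const_mul ((k : ℝ) + 1))).inv (by simp)
    refine ((ih.mul h).congr' ?_).congr_limit (by simp)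
    filter_upwards [Filter.eventually_gt_atTop 0] with N hN
    have hN' : (0 : ℝ) < N := by exact_mod_cast hN
    have h1 : ((N + k).factorial : ℝ) ≠ 0 := by positivity
    rw [← add_assoc, Nat.factorial_succ]
    push_cast
    field_simp
    ring

lemma det_blockDiagonal'_eq_prod {m : ℕ} {q : Fin m → ℕ}
    (A : ∀ i, Matrix (Fin (q i)) (Fin (q i)) ℝ) : (blockDiagonal' A).det = ∏ i, (A i).det := by
  rw [(blockTriangular_blockDiagonal' A).det_fintype]
  refine prod_congr rfl fun i _ => ?_
  rw [← det_submatrix_equiv_self (Equiv.sigmaSubtype i).symm]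
  congr 1
  ext a b
  exact blockDiagonal'_apply_eq A i a b

lemma firstOrderLimit_det_laguerreKernel {m : ℕ} (q : Fin m → ℕ) {α : ℝ} (hα : -1 < α)
    {μ : Fin m → ℝ} (hμ : ∀ i, μ i ∈ Set.Ioo (0 : ℝ) 1) (hinj : Function.Injective μ) (k : ℕ) :
    FirstOrderLimit (fun N => (Matrix.of fun r s : Σ i, Fin (q i) =>
      laguerreKernel α (μ r.1) (μ s.1) k N (jetCoeff N (μ r.1) r.2) (jetCoeff N (μ s.1) s.2)).det)
      (∏ i, (Matrix.of fun a b : Fin (q i) => sineKernelCoeff (waveNumber (μ i)) a b).det) := by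
  rw [← det_blockDiagonal'_eq_prod fun i =>
    Matrix.of fun a b : Fin (q i) => sineKernelCoeff (waveNumber (μ i)) a b]
  refine FirstOrderLimit.det fun r s => ?_
  obtain ⟨i, a⟩ := r
  obtain ⟨j, b⟩ := s
  by_cases hij : i = j
  · subst hij
    rw [blockDiagonal'_apply_eq]
    exact laguerreKernel_diagonal hα (hμ i) k a b
  · rw [blockDiagonal'_apply_ne _ _ _ hij]
    exact laguerreKernel_off_diagonal hα (hμ i) (hμ j) (hinj.ne hij) k a b

lemma integral_vandR_laguerre {α β : ℝ} (hα : -1 < α) (hβ : 0 < β) (M : ℕ) (Q : ℝ[X]) :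
    ∫ z in Set.univ.pi (fun _ : Fin M => Set.Ioi (0 : ℝ)),
        vandR z ^ 2 * ∏ l, Q.eval (z l) * (z l ^ α * exp (-β * z l)) =
      M.factorial * (Matrix.of fun i j : Fin M => laguerreInt α β (X ^ (i + j : ℕ) * Q)).det := by
  have h : ∀ (k : ℕ) (x : ℝ), x ^ k * (Q.eval x * (x ^ α * exp (-β * x))) =
      (X ^ k * Q).eval x * (x ^ α * exp (-β * x)) := by
    intro k x
    simp only [eval_mul, eval_pow, eval_X]
    ring
  rw [integral_vandR_sq_mul_prod _ (fun x => Q.eval x * (x ^ α * exp (-β * x)))]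
  · simp only [h, laguerreInt_eq_integral hα hβ]
  · intro k
    simp only [h]
    exact integrableOn_eval_mul_laguerreWeight hα hβ _

lemma det_laguerreKernel {m : ℕ} (q : Fin m → ℕ) (α : ℝ) {μ : Fin m → ℝ} (hμ : ∀ i, 0 < μ i)
    (k N : ℕ) (l : (Σ i, Fin (q i)) → ℝ[X] →ₗ[ℝ] ℝ) :
    (Matrix.of fun r s : Σ i, Fin (q i) =>
      laguerreKernel α (μ r.1) (μ s.1) k N (l r) (l s)).det =
      (∏ i, (μ i ^ α * exp (-(4 * N) * μ i)) ^ q i) * (N : ℝ)⁻¹ ^ (∑ i, q i) *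
        (Matrix.of fun r s => ∑ j ∈ range (N + k), l r (monicLaguerre α (4 * N) j) *
          l s (monicLaguerre α (4 * N) j) / laguerreNorm α (4 * N) j).det := by
  set A := Matrix.of fun r s => ∑ j ∈ range (N + k), l r (monicLaguerre α (4 * N) j) *
          l s (monicLaguerre α (4 * N) j) / laguerreNorm α (4 * N) j with hA
  set u : (Σ i, Fin (q i)) → ℝ := fun r => √(μ r.1 ^ α * exp (-(4 * N) * μ r.1)) with hu
  have h : (Matrix.of fun r s : Σ i, Fin (q i) =>
      laguerreKernel α (μ r.1) (μ s.1) k N (l r) (l s)) =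
      Matrix.of fun r s => u r * (Matrix.of fun r s => u s * ((N : ℝ)⁻¹ • A) r s) r s := by
    ext r s
    simp only [laguerreKernel, Matrix.of_apply, Matrix.smul_apply, smul_eq_mul, hA, hu]
    ring
  rw [h, det_mul_column, det_mul_row, det_smul, Fintype.card_sigma]
  simp only [Fintype.card_fin]
  have hsq : (∏ r, u r) * ∏ r, u r = ∏ i, (μ i ^ α * exp (-(4 * N) * μ i)) ^ q i := by
    rw [← prod_mul_distrib, Fintype.prod_sigma]
    refine prod_congr rfl fun i _ => ?_
    have hi : 0 ≤ μ i ^ α * exp (-(4 * N) * μ i) :=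
      mul_nonneg (rpow_nonneg (hμ i).le _) (exp_pos _).le
    simp only [hu, mul_self_sqrt hi, prod_const, card_univ, Fintype.card_fin]
  rw [← hsq]
  ring

/-- The averaged product of characteristic polynomials is a determinant of kernel jets. -/
lemma integral_ratio_eq_det {m : ℕ} (q : Fin m → ℕ) {α : ℝ} (hα : -1 < α)
    {μ : Fin m → ℝ} (hμ : ∀ i, 0 < μ i) {N : ℕ} (hN : 0 < N) :
    (∫ z in Set.univ.pi (fun _ : Fin N => Set.Ioi (0 : ℝ)),
        vandR z ^ 2 * ∏ l, (nodePolynomial μ q ^ 2).eval (z l) *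
          (z l ^ α * exp (-(4 * N) * z l))) *
        ((N + ∑ i, q i).factorial * ((N : ℝ)⁻¹ ^ (∑ i, (q i ^ 2 - q i)) *
          ∏ j, ∏ k ∈ Ioi j, (μ k - μ j) ^ (2 * q j * q k)) *
          ((∏ i, (μ i ^ α * exp (-(4 * N) * μ i)) ^ q i) * (N : ℝ)⁻¹ ^ (∑ i, q i))) =
      (∫ z in Set.univ.pi (fun _ : Fin (N + ∑ i, q i) => Set.Ioi (0 : ℝ)),
        vandR z ^ 2 * ∏ l, (z l ^ α * exp (-(4 * N) * z l))) * N.factorial *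
      (Matrix.of fun r s : Σ i, Fin (q i) => laguerreKernel α (μ r.1) (μ s.1) (∑ i, q i) N
        (jetCoeff N (μ r.1) r.2) (jetCoeff N (μ s.1) s.2)).det := by
  have hβ : (0 : ℝ) < 4 * N := by positivity
  have h1 := integral_vandR_laguerre hα hβ N (nodePolynomial μ q ^ 2)
  have h2 := integral_vandR_laguerre hα hβ (N + ∑ i, q i) 1
  simp only [eval_one, one_mul, mul_one] at h2
  have h3 := det_moments_eq_prod (L := laguerreInt α (4 * N)) (φ := monicLaguerre α (4 * N))
    monicLaguerre_monic_natDegree (fun i j hij => laguerreInt_mul_of_ne hα hβ hij)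
    (Equiv.refl (Fin (N + ∑ i, q i)))
  have h4 := det_sum_functionals_mul_prod (L := laguerreInt α (4 * N))
    (φ := monicLaguerre α (4 * N))
    monicLaguerre_monic_natDegree (fun i j hij => laguerreInt_mul_of_ne hα hβ hij)
    (fun j => (laguerreNorm_pos hα hβ j).ne') finSigmaFinEquiv (newtonBasis μ q)
    (newtonBasis_monic_natDegree μ q) (nodePolynomial_monic_natDegree μ q)
    (fun r => jetCoeff N (μ r.1) r.2) (jetCoeff_nodePolynomial_mul μ q) N
  rw [det_jetCoeff_newtonBasis, add_comm (∑ i, q i) N] at h4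
  simp only [Equiv.refl_apply] at h3
  rw [h1, h2, h3, det_laguerreKernel q α hμ]
  simp only [laguerreNorm]
  linear_combination (-(N.factorial * (N + ∑ i, q i).factorial : ℝ) *
    ((∏ i, (μ i ^ α * exp (-(4 * N) * μ i)) ^ q i) * (N : ℝ)⁻¹ ^ (∑ i, q i))) * h4

end Assembly
section Constants

open Real Polynomial

lemma eval_nodePolynomial_sq {m : ℕ} (μ : Fin m → ℝ) (q : Fin m → ℕ) (x : ℝ) :
    (nodePolynomial μ q ^ 2).eval x = ∏ i, |μ i - x| ^ (2 * q i) := by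
  rw [nodePolynomial, eval_pow, eval_prod, ← prod_pow]
  refine prod_congr rfl fun i _ => ?_
  rw [pow_mul |μ i - x|, sq_abs, eval_pow, eval_sub, eval_X, eval_C, ← pow_mul, mul_comm (q i),
    pow_mul, sub_sq_comm]

lemma integral_vandR_laguerre_ne_zero {α β : ℝ} (hα : -1 < α) (hβ : 0 < β) (M : ℕ) :
    ∫ z in Set.univ.pi (fun _ : Fin M => Set.Ioi (0 : ℝ)),
        vandR z ^ 2 * ∏ l, (z l ^ α * exp (-β * z l)) ≠ 0 := by
  have h2 := integral_vandR_laguerre hα hβ M 1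
  have h3 := det_moments_eq_prod (L := laguerreInt α β) (φ := monicLaguerre α β)
    monicLaguerre_monic_natDegree (fun i j hij => laguerreInt_mul_of_ne hα hβ hij)
    (Equiv.refl (Fin M))
  simp only [eval_one, one_mul, mul_one] at h2
  simp only [Equiv.refl_apply] at h3
  rw [h2, h3]
  have : ∏ j ∈ range M, laguerreInt α β (monicLaguerre α β j * monicLaguerre α β j) ≠ 0 :=
    prod_ne_zero_iff.2 fun j _ => (laguerreNorm_pos hα hβ j).ne'
  positivity

lemma prod_laguerreWeight_pow_inv {m : ℕ} (q : Fin m → ℕ) (α : ℝ) {μ : Fin m → ℝ}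
    (hμ : ∀ i, 0 < μ i) (N : ℕ) :
    ∏ i, (μ i) ^ (-α * q i) * exp (4 * N * q i * μ i) =
      (∏ i, (μ i ^ α * exp (-(4 * N) * μ i)) ^ q i)⁻¹ := by
  rw [← prod_inv_distrib]
  refine prod_congr rfl fun i _ => ?_
  rw [mul_pow, mul_inv, ← exp_nat_mul, ← exp_neg, neg_mul, rpow_neg (hμ i).le,
    rpow_mul (hμ i).le, rpow_natCast]
  congr 2
  ring

lemma prod_abs_sub_zpow {m : ℕ} (q : Fin m → ℕ) (μ : Fin m → ℝ) :
    ∏ j, ∏ k ∈ Ioi j, |μ k - μ j| ^ (-(2 * (q j : ℤ) * (q k : ℤ))) =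
      (∏ j, ∏ k ∈ Ioi j, (μ k - μ j) ^ (2 * q j * q k))⁻¹ := by
  simp_rw [← prod_inv_distrib]
  refine prod_congr rfl fun j _ => prod_congr rfl fun k _ => ?_
  rw [zpow_neg, mul_assoc 2 (q j), pow_mul (μ k - μ j), ← sq_abs, ← pow_mul]
  norm_cast
  rw [mul_assoc]

lemma det_sineKernelCoeff_waveNumber (x : ℝ) (n : ℕ) :
    (Matrix.of fun a b : Fin n => sineKernelCoeff (waveNumber x) a b).det =
      (∏ l ∈ Icc 1 (n - 1), (l.factorial : ℝ)) ^ 2 /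
        (∏ l ∈ Icc 1 (2 * n - 1), (l.factorial : ℝ)) * (2 * π) ^ (n ^ 2 - n) *
        ((2 / π) * √(1 / x - 1)) ^ (n ^ 2) := by
  rw [det_sineKernelCoeff, prod_Icc_factorial, prod_Icc_factorial, waveNumber]
  have hn : n ^ 2 = n + (n ^ 2 - n) := by
    have : n ≤ n ^ 2 := Nat.le_self_pow two_ne_zero n
    omega
  have hπ : π ^ (n ^ 2) = π ^ n * π ^ (n ^ 2 - n) := by rw [← pow_add, ← hn]
  have hpi := pi_ne_zero
  have e : 2 / π * √(1 / x - 1) = 2 * √(1 / x - 1) / π := by ring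
  rw [e, div_pow _ π (n ^ 2), hπ, mul_pow 2 π, div_pow 1 π, one_pow]
  field_simp

end Constants

/-- Forrester–Frankel asymptotics, Laguerre case, integer `q`.
For the Laguerre weight `ω_N(x)=x^α e^{-4Nx}` on `(0,∞)` and pairwise distinct
`μ_i ∈ (0,1)`, the ratio `H_{N,N,m,q}(μ)/(H_{N+|q|,N}·A_N)` is `1 + O(1/N)`, where
`A_N = N^{Σ(q_i²-q_i)} ∏ μ_i^{-αq_i} e^{4Nq_iμ_i} ∏ [G²(q_i+1)/G(2q_i+1)](2π)^{q_i²-q_i}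
  ∏_{j<k}|μ_k-μ_j|^{-2q_jq_k} ∏ ρ(μ_i)^{q_i²}` with `ρ(μ) = (2/π)√(1/μ-1)`. -/
theorem forrester_frankel_laguerre
    (m : ℕ) (hm : 1 ≤ m) (q : Fin m → ℕ) (hq : ∀ i, 1 ≤ q i)
    (α : ℝ) (hα : -1 < α)
    (μ : Fin m → ℝ) (hμmem : ∀ i, μ i ∈ Set.Ioo (0 : ℝ) 1)
    (hμinj : Function.Injective μ) :
    ∃ C > (0 : ℝ), ∃ N₀ : ℕ, ∀ N ≥ N₀,
      |(∫ z in Set.univ.pi (fun _ : Fin N => Set.Ioi (0 : ℝ)),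
            vandR z ^ 2 * (∏ l, (z l) ^ α * Real.exp (-4 * N * z l)) *
              ∏ l, ∏ i, |μ i - z l| ^ (2 * q i)) /
          ((∫ z in Set.univ.pi (fun _ : Fin (N + ∑ i, q i) => Set.Ioi (0 : ℝ)),
              vandR z ^ 2 * ∏ l, (z l) ^ α * Real.exp (-4 * N * z l)) *
            ((N : ℝ) ^ (∑ i, ((q i) ^ 2 - q i)) *
              (∏ i, (μ i) ^ (-α * q i) * Real.exp (4 * N * (q i) * μ i)) *
              (∏ i, (∏ l ∈ Finset.Icc 1 (q i - 1), (l.factorial : ℝ)) ^ 2 /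
                  (∏ l ∈ Finset.Icc 1 (2 * q i - 1), (l.factorial : ℝ)) *
                  (2 * Real.pi) ^ ((q i) ^ 2 - q i)) *
              (∏ j : Fin m, ∏ k ∈ Finset.Ioi j,
                  |μ k - μ j| ^ (-(2 * (q j : ℤ) * (q k : ℤ)))) *
              ∏ i, ((2 / Real.pi) * Real.sqrt (1 / μ i - 1)) ^ ((q i) ^ 2))) - 1| ≤
        C / N := by
  set k := ∑ i, q i with hk
  set ℓ := ∏ i, (Matrix.of fun a b : Fin (q i) => sineKernelCoeff (waveNumber (μ i)) a b).det
    with hℓ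
  have hpos : ∀ i, 0 < μ i := fun i => (hμmem i).1
  have hℓ' : ℓ = (∏ i, (∏ l ∈ Finset.Icc 1 (q i - 1), (l.factorial : ℝ)) ^ 2 /
      (∏ l ∈ Finset.Icc 1 (2 * q i - 1), (l.factorial : ℝ)) *
      (2 * Real.pi) ^ ((q i) ^ 2 - q i)) *
      ∏ i, ((2 / Real.pi) * Real.sqrt (1 / μ i - 1)) ^ ((q i) ^ 2) := by
    rw [hℓ, ← prod_mul_distrib]
    exact prod_congr rfl fun i _ => det_sineKernelCoeff_waveNumber _ _
  have hℓ0 : ℓ ≠ 0 := by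
    rw [hℓ']
    refine mul_ne_zero (prod_ne_zero_iff.2 fun i _ => ?_) (prod_ne_zero_iff.2 fun i _ => ?_)
    · have h1 : ∏ l ∈ Finset.Icc 1 (q i - 1), (l.factorial : ℝ) ≠ 0 :=
        prod_ne_zero_iff.2 fun l _ => by positivity
      have h2 : ∏ l ∈ Finset.Icc 1 (2 * q i - 1), (l.factorial : ℝ) ≠ 0 :=
        prod_ne_zero_iff.2 fun l _ => by positivity
      have := Real.pi_ne_zero
      positivity
    · have h := waveNumber_pos (hμmem i)
      rw [waveNumber] at h
      have h' : 0 < √(1 / μ i - 1) := by linarith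
      positivity
  set V := ∏ j, ∏ k ∈ Ioi j, (μ k - μ j) ^ (2 * q j * q k) with hV
  have hV0 : V ≠ 0 := prod_ne_zero_iff.2 fun j _ => prod_ne_zero_iff.2 fun k hk =>
    pow_ne_zero _ (sub_ne_zero.2 (hμinj.ne (mem_Ioi.1 hk).ne'))
  have hlim := ((firstOrderLimit_factorial_mul_pow_div k).mul
    (firstOrderLimit_det_laguerreKernel q hα hμmem hμinj k)).mul (FirstOrderLimit.const ℓ⁻¹)
  refine FirstOrderLimit.exists_bound ((hlim.congr' ?_).congr_limit
    (by rw [one_mul, mul_inv_cancel₀ hℓ0]))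
  filter_upwards [Filter.eventually_gt_atTop 0] with N hN
  have hN0 : (N : ℝ) ≠ 0 := by positivity
  have hden := integral_vandR_laguerre_ne_zero (β := 4 * N) hα (by positivity) (N + k)
  have hratio := integral_ratio_eq_det q hα hpos hN
  have hexp : ∀ x : ℝ, -4 * (N : ℝ) * x = -(4 * N) * x := fun x => by ring
  have hE0 : ∏ i, (μ i ^ α * Real.exp (-(4 * N) * μ i)) ^ q i ≠ 0 :=
    prod_ne_zero_iff.2 fun i _ => by
      have := hpos i
      positivity
  have hnum : ∀ z : Fin N → ℝ, vandR z ^ 2 * (∏ l, z l ^ α * Real.exp (-(4 * N) * z l)) *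
      ∏ l, ∏ i, |μ i - z l| ^ (2 * q i) = vandR z ^ 2 *
        ∏ l, (nodePolynomial μ q ^ 2).eval (z l) * (z l ^ α * Real.exp (-(4 * N) * z l)) := by
    intro z
    simp only [eval_nodePolynomial_sq, prod_mul_distrib]
    ring
  rw [prod_laguerreWeight_pow_inv q α hpos, prod_abs_sub_zpow, ← hV]
  simp only [hexp]
  simp only [hnum]
  rw [← hk, ← hV] at hratio
  generalize (∫ z in Set.univ.pi (fun _ : Fin N => Set.Ioi (0 : ℝ)), vandR z ^ 2 *
    ∏ l, (nodePolynomial μ q ^ 2).eval (z l) * (z l ^ α * Real.exp (-(4 * N) * z l))) = I₁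
    at hratio ⊢
  generalize (∫ z in Set.univ.pi (fun _ : Fin (N + k) => Set.Ioi (0 : ℝ)), vandR z ^ 2 *
    ∏ l, z l ^ α * Real.exp (-(4 * N) * z l)) = I₂ at hratio hden ⊢
  generalize (∏ i, (μ i ^ α * Real.exp (-(4 * N) * μ i)) ^ q i) = E at hratio hE0 ⊢
  generalize (Matrix.of fun r s : Σ i, Fin (q i) => laguerreKernel α (μ r.1) (μ s.1) k N
    (jetCoeff N (μ r.1) r.2) (jetCoeff N (μ s.1) s.2)).det = K at hratio ⊢
  have hfac : ((N + k).factorial : ℝ) ≠ 0 := by positivity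
  have hI₁ : I₁ = I₂ * N.factorial * K * ((N : ℝ) ^ (∑ i, (q i ^ 2 - q i)) * (N : ℝ) ^ k) /
      ((N + k).factorial * V * E) := by
    rw [eq_div_iff (by positivity), ← hratio, inv_pow, inv_pow]
    field_simp
  have hcomm : ∀ s e c v r : ℝ, s * e * c * v * r = s * e * (c * r) * v := fun _ _ _ _ _ => by ring
  rw [hcomm _ _ _ V⁻¹, ← hℓ', hI₁]
  field_simp
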